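/- Let (X,ρ,μ) be a quasi-metric measure space in which μ is Borel regular and Q-doubling for some Q ∈ (0,∞). Fix s,p ∈ (0,∞) and q ∈ (0,∞] and assume s < ind(X,ρ), i.e. there exists a quasi-metric ϱ on X equivalent to ρ with s < (log₂ C_ϱ)^{−1}. If Ω ⊂ X is a nonempty μ-measurable set satisfying the measure density condition, then there exists C > 0 such that every u ∈ N^s_{p,q}(Ω,ρ,μ) admits an extension ũ ∈ N^s_{p,q}(X,ρ,μ) with ũ|_Ω = u μ-almost everywhere on Ω and ‖ũ‖_{N^s_{p,q}(X,ρ,μ)} ≤ C ‖u‖_{N^s_{p,q}(Ω,ρ,μ)}; moreover, if in addition p > Q/(Q+s) and q > Q/(Q+s), the extension can be realized by a bounded linear operator 𝓔 : N^s_{p,q}(Ω,ρ,μ) → N^s_{p,q}(X,ρ,μ) with (𝓔u)|_Ω = u. -/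

import Mathlib

open MeasureTheory ENNReal Set

noncomputable section

namespace HajlaszPaper

variable {X : Type*}

/-- The `ρ`-ball centered at `x` with radius `r`. -/
def qball (ρ : X → X → ℝ) (x : X) (r : ℝ) : Set X := {y | ρ x y < r}

/-- `ρ` is a quasi-metric on `X`. -/
def IsQuasiDist (ρ : X → X → ℝ) : Prop :=
  (∀ x y, 0 ≤ ρ x y) ∧ (∀ x y, ρ x y = 0 ↔ x = y) ∧
    (∃ C₀ : ℝ, 1 ≤ C₀ ∧ ∀ x y, ρ y x ≤ C₀ * ρ x y) ∧
    (∃ C₁ : ℝ, 1 ≤ C₁ ∧ ∀ x y z, ρ x y ≤ C₁ * max (ρ x z) (ρ z y))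

/-- The least admissible quasi-triangle constant `C_ρ`. -/
def Crho (ρ : X → X → ℝ) : ℝ :=
  sInf {C : ℝ | 1 ≤ C ∧ ∀ x y z : X, ρ x y ≤ C * max (ρ x z) (ρ z y)}

/-- The least admissible quasi-symmetry constant `C̃_ρ`. -/
def CrhoTilde (ρ : X → X → ℝ) : ℝ :=
  sInf {C : ℝ | 1 ≤ C ∧ ∀ x y : X, ρ y x ≤ C * ρ x y}

/-- Two quasi-metrics are (bi-Lipschitz, i.e. pointwise) equivalent. -/
def EquivQM (ρ ϱ : X → X → ℝ) : Prop :=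
  ∃ c : ℝ, 1 ≤ c ∧ ∀ x y, c⁻¹ * ϱ x y ≤ ρ x y ∧ ρ x y ≤ c * ϱ x y

variable [MeasurableSpace X]

/-- `(X, ρ, μ)` is a quasi-metric measure space. -/
structure IsQMMS (ρ : X → X → ℝ) (μ : Measure X) : Prop where
  nontrivial : ∃ x y : X, x ≠ y
  quasi : IsQuasiDist ρ
  measurableSet_ball : ∀ (x : X) (r : ℝ), 0 < r → MeasurableSet (qball ρ x r)
  ball_pos : ∀ (x : X) (r : ℝ), 0 < r → 0 < μ (qball ρ x r)
  ball_lt_top : ∀ (x : X) (r : ℝ), 0 < r → μ (qball ρ x r) < ∞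

/-- Every `μ`-measurable set is contained in a Borel (measurable) set of equal measure. -/
def BorelRegular (μ : Measure X) : Prop :=
  ∀ A : Set X, ∃ B : Set X, A ⊆ B ∧ MeasurableSet B ∧ μ A = μ B

/-- `μ` is `Q`-doubling. -/
def QDoubling (ρ : X → X → ℝ) (μ : Measure X) (Q : ℝ) : Prop :=
  ∃ κ : ℝ, 0 < κ ∧ ∀ (x y : X) (r R : ℝ), 0 < r → r ≤ R →
    qball ρ x r ⊆ qball ρ y R →
    ENNReal.ofReal (κ * (r / R) ^ Q) * μ (qball ρ y R) ≤ μ (qball ρ x r)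

/-- `μ` is doubling. -/
def DoublingMeas (ρ : X → X → ℝ) (μ : Measure X) : Prop :=
  ∃ Cd : ℝ, 0 < Cd ∧ ∀ (x : X) (r : ℝ), 0 < r →
    μ (qball ρ x (2 * r)) ≤ ENNReal.ofReal Cd * μ (qball ρ x r)

/-- The measure density condition for `Ω`. -/
def MeasDensity (ρ : X → X → ℝ) (μ : Measure X) (Ω : Set X) : Prop :=
  ∃ c : ℝ, 0 < c ∧ ∀ x ∈ Ω, ∀ r : ℝ, 0 < r → r ≤ 1 →
    μ (qball ρ x r) ≤ ENNReal.ofReal c * μ (qball ρ x r ∩ Ω)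

/-- `Ω` is locally uniformly perfect with constant `lam ∈ (0,1)`. -/
def LocUnifPerfect (ρ : X → X → ℝ) (Ω : Set X) (lam : ℝ) : Prop :=
  ∀ x ∈ Ω, ∀ r : ℝ, 0 < r → r ≤ 1 → (Ω \ qball ρ x r).Nonempty →
    ((qball ρ x r ∩ Ω) \ qball ρ x (lam * r)).Nonempty

/-- The critical radius `φ^x_{Ω,ρ}(r)`. -/
def phiRad (ρ : X → X → ℝ) (μ : Measure X) (Ω : Set X) (x : X) (r : ℝ) : ℝ :=
  sSup {t : ℝ | 0 ≤ t ∧ t ≤ r ∧ μ (qball ρ x t ∩ Ω) ≤ μ (qball ρ x r ∩ Ω) / 2}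

/-- The collection `𝔻^s_ρ(u)` of fractional `s`-gradients of `u` on `Ω`. -/
def fracGrad (ρ : X → X → ℝ) (μ : Measure X) (Ω : Set X) (s : ℝ) (u : X → ℝ) :
    Set (ℤ → X → ℝ) :=
  {g | (∀ k x, 0 ≤ g k x) ∧ (∀ k, AEMeasurable (g k) (μ.restrict Ω)) ∧
    ∃ E : Set X, μ E = 0 ∧ ∀ k : ℤ, ∀ x ∈ Ω \ E, ∀ y ∈ Ω \ E,
      (2 : ℝ) ^ (-k - 1) ≤ ρ x y → ρ x y < (2 : ℝ) ^ (-k) →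
      |u x - u y| ≤ ρ x y ^ s * (g k x + g k y)}

/-- `g` is an `s`-gradient of `u` on `S`. -/
def IsSGradOn (ρ : X → X → ℝ) (μ : Measure X) (S : Set X) (s : ℝ) (u g : X → ℝ) : Prop :=
  (∀ x, 0 ≤ g x) ∧ AEMeasurable g (μ.restrict S) ∧
    ∃ E : Set X, μ E = 0 ∧ ∀ x ∈ S \ E, ∀ y ∈ S \ E,
      |u x - u y| ≤ ρ x y ^ s * (g x + g y)

/-- The `ℓ^q` norm (`0 < q ≤ ∞`) of a `ℤ`-indexed sequence in `[0,∞]`. -/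
def lqN (q : ℝ≥0∞) (a : ℤ → ℝ≥0∞) : ℝ≥0∞ :=
  if q = ∞ then ⨆ k, a k else (∑' k, a k ^ q.toReal) ^ (1 / q.toReal)

/-- The `L^p` "norm" (`0 < p < ∞`) of a `[0,∞]`-valued function. -/
def lpN (μ : Measure X) (p : ℝ) (f : X → ℝ≥0∞) : ℝ≥0∞ :=
  (∫⁻ x, f x ^ p ∂μ) ^ (1 / p)

/-- The `L^p` norm of `u : X → ℝ` over the set `Ω`. -/
def lpOn (μ : Measure X) (Ω : Set X) (p : ℝ) (u : X → ℝ) : ℝ≥0∞ :=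
  lpN (μ.restrict Ω) p fun x => ENNReal.ofReal |u x|

/-- The homogeneous Hajłasz–Triebel–Lizorkin quasi-norm `‖u‖_{Ṁ^s_{p,q}(Ω,ρ,μ)}`. -/
def MdotNorm (ρ : X → X → ℝ) (μ : Measure X) (Ω : Set X) (s p : ℝ) (q : ℝ≥0∞)
    (u : X → ℝ) : ℝ≥0∞ :=
  ⨅ g ∈ fracGrad ρ μ Ω s u,
    lpN (μ.restrict Ω) p fun x => lqN q fun k => ENNReal.ofReal (g k x)

/-- The homogeneous Hajłasz–Besov quasi-norm `‖u‖_{Ṅ^s_{p,q}(Ω,ρ,μ)}`. -/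
def NdotNorm (ρ : X → X → ℝ) (μ : Measure X) (Ω : Set X) (s p : ℝ) (q : ℝ≥0∞)
    (u : X → ℝ) : ℝ≥0∞ :=
  ⨅ g ∈ fracGrad ρ μ Ω s u,
    lqN q fun k => lpN (μ.restrict Ω) p fun x => ENNReal.ofReal (g k x)

/-- Membership in `M^s_{p,q}(Ω,ρ,μ)`. -/
def MemMspq (ρ : X → X → ℝ) (μ : Measure X) (Ω : Set X) (s p : ℝ) (q : ℝ≥0∞)
    (u : X → ℝ) : Prop :=
  AEMeasurable u (μ.restrict Ω) ∧ lpOn μ Ω p u ≠ ∞ ∧ MdotNorm ρ μ Ω s p q u ≠ ∞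

/-- Membership in `N^s_{p,q}(Ω,ρ,μ)`. -/
def MemNspq (ρ : X → X → ℝ) (μ : Measure X) (Ω : Set X) (s p : ℝ) (q : ℝ≥0∞)
    (u : X → ℝ) : Prop :=
  AEMeasurable u (μ.restrict Ω) ∧ lpOn μ Ω p u ≠ ∞ ∧ NdotNorm ρ μ Ω s p q u ≠ ∞

/-- The quasi-norm of `M^s_{p,q}(Ω,ρ,μ)`. -/
def MNorm (ρ : X → X → ℝ) (μ : Measure X) (Ω : Set X) (s p : ℝ) (q : ℝ≥0∞)
    (u : X → ℝ) : ℝ≥0∞ :=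
  MdotNorm ρ μ Ω s p q u + lpOn μ Ω p u

/-- The quasi-norm of `N^s_{p,q}(Ω,ρ,μ)`. -/
def NNorm (ρ : X → X → ℝ) (μ : Measure X) (Ω : Set X) (s p : ℝ) (q : ℝ≥0∞)
    (u : X → ℝ) : ℝ≥0∞ :=
  NdotNorm ρ μ Ω s p q u + lpOn μ Ω p u

/-- `s ⪯_q ind(X,ρ)` : there is a quasi-metric `ϱ ≈ ρ` with `s ≤ (log₂ C_ϱ)⁻¹`
(equivalently `C_ϱ ^ s ≤ 2`), where equality is permitted only when `q = ∞`. -/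
def SPrecIndex (ρ : X → X → ℝ) (s : ℝ) (q : ℝ≥0∞) : Prop :=
  ∃ ϱ : X → X → ℝ, IsQuasiDist ϱ ∧ EquivQM ρ ϱ ∧
    (Crho ϱ ^ s < 2 ∨ (q = ∞ ∧ Crho ϱ ^ s ≤ 2))

/-- `s < ind(X,ρ)` : there is a quasi-metric `ϱ ≈ ρ` with `s < (log₂ C_ϱ)⁻¹`
(equivalently `C_ϱ ^ s < 2`). -/
def SLtIndex (ρ : X → X → ℝ) (s : ℝ) : Prop :=
  ∃ ϱ : X → X → ℝ, IsQuasiDist ϱ ∧ EquivQM ρ ϱ ∧ Crho ϱ ^ s < 2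

/-- The median value `m_u(E)`. -/
def medianVal (μ : Measure X) (E : Set X) (u : X → ℝ) : ℝ :=
  sSup {θ : ℝ | μ {x ∈ E | u x < θ} ≤ μ E / 2}

/-- `f` belongs to the homogeneous Hölder space `Ċ^α(X,ρ)`. -/
def MemHolder (ρ : X → X → ℝ) (α : ℝ) (f : X → ℝ) : Prop :=
  ∃ H : ℝ, 0 ≤ H ∧ ∀ x y : X, |f x - f y| ≤ H * ρ x y ^ α

/-- The Hölder seminorm `‖f‖_{Ċ^α(X,ρ)}`. -/
def holderNorm (ρ : X → X → ℝ) (α : ℝ) (f : X → ℝ) : ℝ :=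
  sInf {H : ℝ | 0 ≤ H ∧ ∀ x y : X, |f x - f y| ≤ H * ρ x y ^ α}

/-- The sup norm of `f`. -/
def supNorm (f : X → ℝ) : ℝ := sSup (Set.range fun x => |f x|)

/-- `ρ` is a genuine metric. -/
def IsMetricDist (ρ : X → X → ℝ) : Prop :=
  (∀ x y, 0 ≤ ρ x y) ∧ (∀ x y, ρ x y = 0 ↔ x = y) ∧ (∀ x y, ρ x y = ρ y x) ∧
    (∀ x y z, ρ x y ≤ ρ x z + ρ z y)

/-- The homogeneous Hajłasz–Sobolev quasi-norm `‖u‖_{Ṁ^{1,p}(Ω,ρ,μ)}`. -/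
def M1pDotNorm (ρ : X → X → ℝ) (μ : Measure X) (Ω : Set X) (p : ℝ) (u : X → ℝ) : ℝ≥0∞ :=
  ⨅ g ∈ {g : X → ℝ | IsSGradOn ρ μ Ω 1 u g},
    lpN (μ.restrict Ω) p fun x => ENNReal.ofReal (g x)

/-- Membership in the Hajłasz–Sobolev space `M^{1,p}(Ω,ρ,μ)`. -/
def MemM1p (ρ : X → X → ℝ) (μ : Measure X) (Ω : Set X) (p : ℝ) (u : X → ℝ) : Prop :=
  AEMeasurable u (μ.restrict Ω) ∧ lpOn μ Ω p u ≠ ∞ ∧ M1pDotNorm ρ μ Ω p u ≠ ∞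

/-- The quasi-norm of `M^{1,p}(Ω,ρ,μ)`. -/
def M1pNorm (ρ : X → X → ℝ) (μ : Measure X) (Ω : Set X) (p : ℝ) (u : X → ℝ) : ℝ≥0∞ :=
  lpOn μ Ω p u + M1pDotNorm ρ μ Ω p u

theorem tsum_sq_mul_rpow_le {ι : Type*} (w a : ι → ℝ≥0∞) {t : ℝ} (ht : 0 < t) :
    (∑' k, w k ^ 2 * a k) ^ t ≤ (∑' k, w k) ^ t * ∑' k, w k ^ t * a k ^ t := by
  set S := ∑' k, w k ^ t * a k ^ t with hS
  have h1 : ∀ k, w k * a k ≤ S ^ (1 / t) := by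
    intro k
    rw [one_div, ENNReal.le_rpow_inv_iff ht, ENNReal.mul_rpow_of_nonneg _ _ ht.le]
    exact ENNReal.le_tsum (f := fun k => w k ^ t * a k ^ t) k
  have h2 : ∑' k, w k ^ 2 * a k ≤ (∑' k, w k) * S ^ (1 / t) := by
    rw [← ENNReal.tsum_mul_right]
    refine ENNReal.tsum_le_tsum fun k => ?_
    rw [sq, mul_assoc]
    gcongr
    exact h1 k
  calc (∑' k, w k ^ 2 * a k) ^ t ≤ ((∑' k, w k) * S ^ (1 / t)) ^ t := by gcongr
    _ = _ := by
      rw [ENNReal.mul_rpow_of_nonneg _ _ ht.le, ← ENNReal.rpow_mul, one_div_mul_cancel ht.ne',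
        ENNReal.rpow_one]

theorem add_rpow_le_two_rpow_mul (a b : ℝ≥0∞) {t : ℝ} (ht : 0 ≤ t) :
    (a + b) ^ t ≤ 2 ^ t * (a ^ t + b ^ t) := by
  have h : a + b ≤ 2 * max a b := by
    rw [two_mul]; exact add_le_add (le_max_left _ _) (le_max_right _ _)
  calc (a + b) ^ t ≤ (2 * max a b) ^ t := by gcongr
    _ = 2 ^ t * (max a b) ^ t := ENNReal.mul_rpow_of_nonneg _ _ ht
    _ ≤ _ := by
      gcongr
      rcases le_total a b with h | h
      · rw [max_eq_right h]; exact le_add_self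
      · rw [max_eq_left h]; exact le_self_add

theorem sum_rpow_le_card {ι : Type*} (F : Finset ι) (a : ι → ℝ≥0∞) {M : ℕ} (hM : F.card ≤ M)
    {t : ℝ} (ht : 0 < t) : (∑ i ∈ F, a i) ^ t ≤ (M : ℝ≥0∞) ^ t * ∑ i ∈ F, a i ^ t := by
  set S := ∑ i ∈ F, a i ^ t with hS
  have h1 : ∀ i ∈ F, a i ≤ S ^ (1 / t) := by
    intro i hi
    rw [one_div, ENNReal.le_rpow_inv_iff ht]
    exact Finset.single_le_sum (f := fun i => a i ^ t) (fun _ _ => zero_le) hi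
  calc (∑ i ∈ F, a i) ^ t ≤ (F.card • S ^ (1 / t)) ^ t := by
        gcongr; exact Finset.sum_le_card_nsmul _ _ _ h1
    _ ≤ ((M : ℝ≥0∞) * S ^ (1 / t)) ^ t := by
        rw [nsmul_eq_mul]; gcongr
    _ = _ := by
      rw [ENNReal.mul_rpow_of_nonneg _ _ ht.le, ← ENNReal.rpow_mul, one_div_mul_cancel ht.ne',
        ENNReal.rpow_one]

theorem tsum_rpow_le_tsum_rpow (a : ℕ → ℝ≥0∞) {t : ℝ} (ht : 0 < t) (ht1 : t ≤ 1) :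
    (∑' i, a i) ^ t ≤ ∑' i, a i ^ t := by
  rw [← ENNReal.le_rpow_inv_iff ht]
  refine ENNReal.tsum_le_of_sum_range_le fun n => ?_
  rw [ENNReal.le_rpow_inv_iff ht]
  refine le_trans ?_ (ENNReal.sum_le_tsum (Finset.range n))
  induction n with
  | zero => simp [ht]
  | succ n ih =>
    rw [Finset.sum_range_succ, Finset.sum_range_succ]
    exact (ENNReal.rpow_add_le_add_rpow _ _ ht.le ht1).trans (by gcongr)

/-- The sum of the two-sided geometric weights `θ ^ |m|`. -/
def geomZ (θ : ℝ≥0∞) : ℝ≥0∞ := ∑' m : ℤ, θ ^ m.natAbs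

theorem geomZ_ne_top {θ : ℝ≥0∞} (hθ : θ < 1) : geomZ θ ≠ ∞ := by
  have hg : ∑' n : ℕ, θ ^ n ≠ ∞ := by
    rw [ENNReal.tsum_geometric]
    exact ENNReal.inv_ne_top.2 (tsub_pos_of_lt hθ).ne'
  rw [geomZ, tsum_of_nat_of_neg_add_one ENNReal.summable ENNReal.summable]
  refine ENNReal.add_ne_top.2 ⟨by simpa using hg, ne_top_of_le_ne_top hg ?_⟩
  refine ENNReal.tsum_le_tsum fun n => ?_
  have : (-((n : ℤ) + 1)).natAbs = n + 1 := by omega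
  rw [this]
  exact pow_le_pow_right_of_le_one' hθ.le (Nat.le_succ n)

theorem tsum_geom_left (θ : ℝ≥0∞) (j : ℤ) : ∑' k : ℤ, θ ^ (j - k).natAbs = geomZ θ :=
  (Equiv.subLeft j).tsum_eq fun m : ℤ => θ ^ m.natAbs

theorem tsum_geom_right (θ : ℝ≥0∞) (k : ℤ) : ∑' j : ℤ, θ ^ (j - k).natAbs = geomZ θ :=
  (Equiv.subRight k).tsum_eq fun m : ℤ => θ ^ m.natAbs

/-- Convolution with two-sided geometric weights, in `ℓ^t` form for arbitrary `t > 0`. -/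
theorem tsum_geom_rpow_le (η : ℝ≥0∞) {t : ℝ} (ht : 0 < t) (B : ℤ → ℝ≥0∞) (j : ℤ) :
    (∑' k : ℤ, (η ^ 2) ^ (j - k).natAbs * B k) ^ t ≤
      geomZ η ^ t * ∑' k : ℤ, (η ^ t) ^ (j - k).natAbs * B k ^ t := by
  have := tsum_sq_mul_rpow_le (fun k : ℤ => η ^ (j - k).natAbs) B ht
  rw [tsum_geom_left] at this
  convert this using 5 with k k
  · rw [← pow_mul, ← pow_mul, mul_comm]
  · rw [← ENNReal.rpow_natCast, ← ENNReal.rpow_natCast, ← ENNReal.rpow_mul, ← ENNReal.rpow_mul,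
      mul_comm]

theorem exists_sqrt_lt_one {θ : ℝ≥0∞} (hθ : θ < 1) : ∃ η : ℝ≥0∞, η < 1 ∧ η ^ 2 = θ := by
  refine ⟨θ ^ (1 / 2 : ℝ), ENNReal.rpow_lt_one hθ (by norm_num), ?_⟩
  rw [← ENNReal.rpow_natCast, ← ENNReal.rpow_mul]; norm_num

theorem le_lqN {q : ℝ≥0∞} (hq : 0 < q) (a : ℤ → ℝ≥0∞) (k : ℤ) : a k ≤ lqN q a := by
  unfold lqN
  split_ifs with h
  · exact le_iSup a k
  · have hq' : 0 < q.toReal := ENNReal.toReal_pos hq.ne' h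
    rw [one_div, ENNReal.le_rpow_inv_iff hq']
    exact ENNReal.le_tsum (f := fun k => a k ^ q.toReal) k

theorem lqN_mono {q : ℝ≥0∞} {a b : ℤ → ℝ≥0∞} (h : ∀ k, a k ≤ b k) : lqN q a ≤ lqN q b := by
  unfold lqN
  split_ifs
  · exact iSup_mono h
  · gcongr with k; exact h k

theorem lqN_const_mul {q : ℝ≥0∞} (hq : 0 < q) (c : ℝ≥0∞) (a : ℤ → ℝ≥0∞) :
    lqN q (fun k => c * a k) = c * lqN q a := by
  unfold lqN
  split_ifs with h
  · rw [ENNReal.mul_iSup]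
  · have hq' : 0 < q.toReal := ENNReal.toReal_pos hq.ne' h
    simp_rw [ENNReal.mul_rpow_of_nonneg _ _ hq'.le]
    rw [ENNReal.tsum_mul_left, ENNReal.mul_rpow_of_nonneg _ _ (by positivity), ← ENNReal.rpow_mul,
      mul_one_div_cancel hq'.ne', ENNReal.rpow_one]

theorem lqN_geom_le {p : ℝ} (hp : 0 < p) {q : ℝ≥0∞} (hq : 0 < q) {C θ : ℝ≥0∞} (hC : C ≠ ∞)
    (hθ : θ < 1) : ∃ C' : ℝ≥0∞, C' ≠ ∞ ∧ ∀ A B : ℤ → ℝ≥0∞,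
      (∀ j, A j ≤ C * ∑' k : ℤ, θ ^ (j - k).natAbs * B k) →
      lqN q (fun j => A j ^ (1 / p)) ≤ C' * lqN q (fun k => B k ^ (1 / p)) := by
  have hp' : 0 < 1 / p := by positivity
  by_cases hqt : q = ∞
  · refine ⟨(C * geomZ θ) ^ (1 / p), ENNReal.rpow_ne_top_of_nonneg hp'.le
      (ENNReal.mul_ne_top hC (geomZ_ne_top hθ)), fun A B h => ?_⟩
    simp only [lqN, hqt, if_true]
    refine iSup_le fun j => ?_
    have hB : ∀ k, B k ≤ (⨆ k, B k ^ (1 / p)) ^ p := by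
      intro k
      rw [← ENNReal.rpow_inv_le_iff hp, ← one_div]
      exact le_iSup (fun k => B k ^ (1 / p)) k
    calc A j ^ (1 / p) ≤ (C * ∑' k : ℤ, θ ^ (j - k).natAbs * (⨆ k, B k ^ (1 / p)) ^ p) ^ (1 / p) := by
          refine ENNReal.rpow_le_rpow ((h j).trans ?_) hp'.le
          gcongr with k
          exact hB k
      _ = _ := by
          rw [ENNReal.tsum_mul_right, tsum_geom_left, ← mul_assoc,
            ENNReal.mul_rpow_of_nonneg _ _ hp'.le, ← ENNReal.rpow_mul, mul_one_div_cancel hp.ne',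
            ENNReal.rpow_one]
  · obtain ⟨η, hη, rfl⟩ := exists_sqrt_lt_one hθ
    have hq' : 0 < q.toReal := ENNReal.toReal_pos hq.ne' hqt
    set t := q.toReal / p with ht
    have ht0 : 0 < t := by positivity
    have hηt : η ^ t < 1 := ENNReal.rpow_lt_one hη ht0
    refine ⟨(C ^ t * geomZ η ^ t * geomZ (η ^ t)) ^ (1 / q.toReal),
      ENNReal.rpow_ne_top_of_nonneg (by positivity) (ENNReal.mul_ne_top (ENNReal.mul_ne_top
        (ENNReal.rpow_ne_top_of_nonneg ht0.le hC)
        (ENNReal.rpow_ne_top_of_nonneg ht0.le (geomZ_ne_top hη))) (geomZ_ne_top hηt)),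
      fun A B h => ?_⟩
    simp only [lqN, hqt, if_false]
    rw [← ENNReal.mul_rpow_of_nonneg _ _ (by positivity : 0 ≤ 1 / q.toReal)]
    have e : ∀ x : ℝ≥0∞, (x ^ (1 / p)) ^ q.toReal = x ^ t := fun x => by
      rw [← ENNReal.rpow_mul, ht, one_div_mul_eq_div]
    simp_rw [e]
    gcongr
    calc ∑' j, A j ^ t ≤ ∑' j : ℤ, C ^ t * (geomZ η ^ t *
          ∑' k : ℤ, (η ^ t) ^ (j - k).natAbs * B k ^ t) := by
          refine ENNReal.tsum_le_tsum fun j => ?_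
          refine (ENNReal.rpow_le_rpow (h j) ht0.le).trans ?_
          rw [ENNReal.mul_rpow_of_nonneg _ _ ht0.le]
          gcongr
          exact tsum_geom_rpow_le η ht0 B j
      _ = _ := by
          rw [ENNReal.tsum_mul_left, ENNReal.tsum_mul_left, ENNReal.tsum_comm]
          simp_rw [ENNReal.tsum_mul_right, tsum_geom_right]
          rw [ENNReal.tsum_mul_left]
          ring

theorem lqN_add_le {q : ℝ≥0∞} (hq : 0 < q) : ∃ C : ℝ≥0∞, C ≠ ∞ ∧ ∀ a b : ℤ → ℝ≥0∞,
    lqN q (fun k => a k + b k) ≤ C * (lqN q a + lqN q b) := by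
  by_cases h : q = ∞
  · refine ⟨1, one_ne_top, fun a b => ?_⟩
    simp only [lqN, h, if_true, one_mul]
    exact iSup_le fun k => add_le_add (le_iSup a k) (le_iSup b k)
  · have hq' : 0 < q.toReal := ENNReal.toReal_pos hq.ne' h
    have hq1 : 0 ≤ 1 / q.toReal := by positivity
    refine ⟨(2 ^ q.toReal) ^ (1 / q.toReal) * 2 ^ (1 / q.toReal),
      ENNReal.mul_ne_top (by finiteness) (by finiteness), fun a b => ?_⟩
    simp only [lqN, h, if_false]
    calc (∑' k, (a k + b k) ^ q.toReal) ^ (1 / q.toReal)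
        ≤ (2 ^ q.toReal * (∑' k, a k ^ q.toReal + ∑' k, b k ^ q.toReal)) ^ (1 / q.toReal) := by
          gcongr
          rw [← ENNReal.tsum_add, ← ENNReal.tsum_mul_left]
          exact ENNReal.tsum_le_tsum fun k => add_rpow_le_two_rpow_mul _ _ hq'.le
      _ ≤ _ := by
          rw [ENNReal.mul_rpow_of_nonneg _ _ hq1, mul_assoc]
          gcongr
          exact add_rpow_le_two_rpow_mul _ _ hq1

theorem lqN_single {q : ℝ≥0∞} (hq : 0 < q) (c : ℝ≥0∞) :
    lqN q (fun k : ℤ => if k = 0 then c else 0) = c := by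
  refine le_antisymm ?_ (by simpa using le_lqN hq (fun k : ℤ => if k = 0 then c else 0) 0)
  unfold lqN
  split_ifs with h
  · refine iSup_le fun k => ?_
    change (if k = 0 then c else 0) ≤ c
    split_ifs <;> simp
  · have hq' : 0 < q.toReal := ENNReal.toReal_pos hq.ne' h
    rw [tsum_eq_single 0 (by intro k hk; simp [hk, hq'])]
    simp only [if_true]
    rw [← ENNReal.rpow_mul, mul_one_div_cancel hq'.ne', ENNReal.rpow_one]

section Metrization

variable {Y : Type*}

theorem frink_chain {d : Y → Y → ℝ} (hnn : ∀ x y, 0 ≤ d x y)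
    (htri : ∀ x y z, d x y ≤ 2 * max (d x z) (d z y)) (f : ℕ → Y) (n : ℕ) :
    ∀ i, 2 ≤ n → d (f i) (f (i + n)) ≤ 4 * ∑ k ∈ Finset.Ico i (i + n), d (f k) (f (k + 1)) -
      2 * d (f i) (f (i + 1)) - 2 * d (f (i + n - 1)) (f (i + n)) := by
  induction n using Nat.strong_induction_on with
  | _ n ih =>
  intro i hn
  set a := d (f i) (f (i + n)) with ha
  have hsplit : ∀ m, 0 < m → m < n → ∑ k ∈ Finset.Ico i (i + n), d (f k) (f (k + 1)) =
      (∑ k ∈ Finset.Ico i (i + m), d (f k) (f (k + 1))) +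
        ∑ k ∈ Finset.Ico (i + m) (i + n), d (f k) (f (k + 1)) := fun m _ _ =>
    (Finset.sum_Ico_consecutive _ (by omega) (by omega)).symm
  have hsum_ge : 4 * d (f i) (f (i + 1)) + 4 * d (f (i + n - 1)) (f (i + n)) ≤
      4 * ∑ k ∈ Finset.Ico i (i + n), d (f k) (f (k + 1)) := by
    rw [hsplit 1 (by omega) (by omega), mul_add]
    gcongr
    · simp
    · have := Finset.single_le_sum (f := fun k => d (f k) (f (k + 1))) (s := Finset.Ico (i + 1) (i + n))
        (fun _ _ => hnn _ _) (a := i + n - 1) (by simp; omega)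
      simpa [show i + n - 1 + 1 = i + n by omega] using this
  have hfirst := hnn (f i) (f (i + 1))
  have hlast := hnn (f (i + n - 1)) (f (i + n))
  rcases (hnn (f i) (f (i + n))).eq_or_lt with h0 | hpos
  · rw [ha, ← h0]; linarith
  classical
  set S := (Finset.range n).filter fun r => a / 2 ≤ d (f (i + r)) (f (i + n)) with hS
  have hSne : S.Nonempty := ⟨0, by simp [hS, ← ha]; constructor <;> [omega; linarith]⟩
  set r := S.max' hSne with hr
  have hrS : r ∈ S := S.max'_mem hSne
  obtain ⟨hrn, hra⟩ : r < n ∧ a / 2 ≤ d (f (i + r)) (f (i + n)) := by simpa [hS] using hrS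
  by_cases hr1 : r = n - 1
  · have e : i + r = i + n - 1 := by omega
    rw [e] at hra
    linarith
  have hnext : d (f (i + r + 1)) (f (i + n)) < a / 2 := by
    by_contra! hcon
    have : r + 1 ∈ S := by
      simp only [hS, Finset.mem_filter, Finset.mem_range]
      exact ⟨by omega, by simpa [add_assoc] using hcon⟩
    have := S.le_max' _ this
    omega
  have h2 : a ≤ 2 * d (f i) (f (i + r + 1)) := by
    have := htri (f i) (f (i + n)) (f (i + r + 1))
    rcases le_total (d (f i) (f (i + r + 1))) (d (f (i + r + 1)) (f (i + n))) with h | h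
    · rw [max_eq_right h] at this; linarith
    · rwa [max_eq_left h] at this
  rcases Nat.eq_zero_or_pos r with h0 | hr0
  · rw [h0] at h2
    simp only [add_zero] at h2
    linarith
  have i1 := ih (r + 1) (by omega) i (by omega)
  have i2 := ih (n - r) (by omega) (i + r) (by omega)
  rw [show i + r + (n - r) = i + n by omega] at i2
  have e1 := hsplit r hr0 hrn
  rw [show i + (r + 1) = i + r + 1 by omega, Finset.sum_Ico_succ_top (by omega),
    show i + r + 1 - 1 = i + r by omega] at i1
  linarith

theorem exists_chain_of_zipWith (d : Y → Y → NNReal) (y : Y) (l : List Y) : ∀ x,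
    ∃ (f : ℕ → Y) (n : ℕ), 1 ≤ n ∧ f 0 = x ∧ f n = y ∧
      (List.zipWith d (x :: l) (l ++ [y])).sum = ∑ k ∈ Finset.range n, d (f k) (f (k + 1)) := by
  induction l with
  | nil =>
    intro x
    exact ⟨fun k => if k = 0 then x else y, 1, le_rfl, by simp, by simp, by simp⟩
  | cons a l ih =>
    intro x
    obtain ⟨f, n, hn, h0, hy, hs⟩ := ih a
    refine ⟨fun k => Nat.casesOn k x f, n + 1, by omega, rfl, hy, ?_⟩
    rw [Finset.sum_range_succ', List.cons_append, List.zipWith_cons_cons, List.sum_cons, hs, h0.symm,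
      add_comm]
    rfl

theorem exists_pseudoMetric_of_quasi {d : Y → Y → NNReal} (hself : ∀ x, d x x = 0)
    (hcomm : ∀ x y, d x y = d y x) (htri : ∀ x y z, d x y ≤ 2 * max (d x z) (d z y)) :
    ∃ m : PseudoMetricSpace Y, ∀ x y, m.dist x y ≤ d x y ∧ (d x y : ℝ) ≤ 4 * m.dist x y := by
  refine ⟨PseudoMetricSpace.ofPreNNDist d hself hcomm, fun x y => ⟨?_, ?_⟩⟩
  · exact PseudoMetricSpace.dist_ofPreNNDist_le d hself hcomm x y
  · have := PseudoMetricSpace.dist_ofPreNNDist d hself hcomm x y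
    change _ ≤
      4 * (@dist Y (@PseudoMetricSpace.toDist Y (PseudoMetricSpace.ofPreNNDist d hself hcomm)) x y)
    rw [this]
    suffices h : d x y / 4 ≤ ⨅ l, (List.zipWith d (x :: l) (l ++ [y])).sum by
      have h' : ((d x y / 4 : NNReal) : ℝ) ≤
          ((⨅ l, (List.zipWith d (x :: l) (l ++ [y])).sum : NNReal) : ℝ) := by
        exact_mod_cast h
      push_cast at h' ⊢
      linarith
    refine le_ciInf fun l => ?_
    obtain ⟨f, n, hn, h0, hy, hs⟩ := exists_chain_of_zipWith d y l x
    rw [hs, ← NNReal.coe_le_coe]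
    push_cast
    have key : (d x y : ℝ) ≤ 4 * ∑ k ∈ Finset.range n, (d (f k) (f (k + 1)) : ℝ) := by
      rcases hn.eq_or_lt with h1 | h2
      · subst h1
        simp only [Finset.range_one, Finset.sum_singleton, zero_add, h0, hy]
        linarith [(d x y).coe_nonneg]
      · have := frink_chain (d := fun x y => (d x y : ℝ)) (fun _ _ => NNReal.coe_nonneg _)
          (fun x y z => by exact_mod_cast htri x y z) f n 0 h2
        simp only [zero_add, h0, hy, Finset.range_eq_Ico] at this ⊢
        linarith [(d x (f 1)).coe_nonneg, (d (f (n - 1)) y).coe_nonneg]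
    linarith

theorem Crho_spec {ϱ : Y → Y → ℝ} (h : IsQuasiDist ϱ) :
    1 ≤ Crho ϱ ∧ ∀ x y z, ϱ x y ≤ Crho ϱ * max (ϱ x z) (ϱ z y) := by
  obtain ⟨hnn, -, -, C₁, hC₁⟩ := h
  refine ⟨le_csInf ⟨C₁, hC₁⟩ fun C hC => hC.1, fun x y z => ?_⟩
  have hm : 0 ≤ max (ϱ x z) (ϱ z y) := le_max_of_le_left (hnn _ _)
  rcases hm.eq_or_lt with h0 | hpos
  · have := hC₁.2 x y z
    rw [← h0, mul_zero] at this ⊢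
    exact this
  · rw [← div_le_iff₀ hpos]
    exact le_csInf ⟨C₁, hC₁⟩ fun C hC => by rw [div_le_iff₀ hpos]; exact hC.2 x y z

theorem SLtIndex.exists_pseudoMetric {ρ : Y → Y → ℝ} {s : ℝ} (hs : 0 < s) (h : SLtIndex ρ s) :
    ∃ α c : ℝ, s < α ∧ 1 ≤ c ∧ ∃ m : PseudoMetricSpace Y, ∀ x y,
      ρ x y ^ α ≤ c * m.dist x y ∧ m.dist x y ≤ c * ρ x y ^ α := by
  obtain ⟨ϱ, hϱ, ⟨c₁, hc₁, hc₁'⟩, hlt⟩ := h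
  obtain ⟨hC1, hC⟩ := Crho_spec hϱ
  obtain ⟨hnn, hzero, ⟨C₀, hC₀, hC₀'⟩, -⟩ := hϱ
  obtain ⟨α, hαs, hα⟩ : ∃ α, s < α ∧ Crho ϱ ^ α ≤ 2 := by
    have hcont : ContinuousAt (fun t : ℝ => Crho ϱ ^ t) s :=
      Real.continuousAt_const_rpow (by positivity)
    have h1 : ∀ᶠ t in nhds s, Crho ϱ ^ t < 2 := hcont.eventually (gt_mem_nhds hlt)
    have h2 := h1.filter_mono (nhdsWithin_le_nhds (s := Ioi s))
    obtain ⟨t, ht, ht'⟩ := (h2.and self_mem_nhdsWithin).exists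
    exact ⟨t, ht', ht.le⟩
  have hα0 : 0 < α := hs.trans hαs
  set D : Y → Y → ℝ := fun x y => max (ϱ x y) (ϱ y x) with hD
  have hDnn : ∀ x y, 0 ≤ D x y := fun x y => le_max_of_le_left (hnn _ _)
  have hDtri : ∀ x y z, D x y ≤ Crho ϱ * max (D x z) (D z y) := by
    intro x y z
    refine max_le ((hC x y z).trans ?_) ((hC y x z).trans ?_)
    · gcongr <;> exact le_max_left _ _
    · rw [max_comm]
      gcongr <;> exact le_max_right _ _
  have hDα : ∀ x y, ((D x y ^ α).toNNReal : ℝ) = D x y ^ α := fun x y =>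
    Real.coe_toNNReal _ (Real.rpow_nonneg (hDnn x y) _)
  obtain ⟨m, hm⟩ := exists_pseudoMetric_of_quasi
    (d := fun x y => (D x y ^ α).toNNReal)
    (fun x => by simp [hD, (hzero x x).2 rfl, Real.zero_rpow hα0.ne'])
    (fun x y => by rw [show D x y = D y x from max_comm _ _])
    (fun x y z => by
      rw [← NNReal.coe_le_coe]
      push_cast
      rw [hDα, hDα, hDα, ← (Real.monotoneOn_rpow_Ici_of_exponent_nonneg hα0.le).map_max
      (hDnn x z) (hDnn z y)]
      calc D x y ^ α ≤ (Crho ϱ * max (D x z) (D z y)) ^ α :=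
            Real.rpow_le_rpow (hDnn x y) (hDtri x y z) hα0.le
        _ = Crho ϱ ^ α * max (D x z) (D z y) ^ α :=
            Real.mul_rpow (by linarith) (le_max_of_le_left (hDnn x z))
        _ ≤ _ := by
            gcongr
            exact Real.rpow_nonneg (le_max_of_le_left (hDnn x z)) _)
  simp only [hDα] at hm
  have hρnn : ∀ x y, 0 ≤ ρ x y := fun x y =>
    (mul_nonneg (inv_nonneg.2 (by linarith)) (hnn x y)).trans (hc₁' x y).1
  have hc1α : 1 ≤ c₁ ^ α := Real.one_le_rpow hc₁ hα0.le
  have hC0α : 1 ≤ C₀ ^ α := Real.one_le_rpow hC₀ hα0.le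
  refine ⟨α, 4 * (c₁ ^ α * C₀ ^ α), hαs, ?_, m, fun x y => ⟨?_, ?_⟩⟩
  · nlinarith
  · calc ρ x y ^ α ≤ (c₁ * D x y) ^ α := by
          refine Real.rpow_le_rpow (hρnn x y) ((hc₁' x y).2.trans ?_) hα0.le
          gcongr; exact le_max_left _ _
      _ = c₁ ^ α * D x y ^ α := Real.mul_rpow (by linarith) (hDnn x y)
      _ ≤ c₁ ^ α * C₀ ^ α * D x y ^ α := by
          have := Real.rpow_nonneg (hDnn x y) α
          have := mul_nonneg (by linarith : 0 ≤ c₁ ^ α) this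
          nlinarith
      _ ≤ c₁ ^ α * C₀ ^ α * (4 * m.dist x y) := by
          gcongr; exact (hm x y).2
      _ = _ := by ring
  · have hDle : D x y ≤ c₁ * C₀ * ρ x y := by
      have h1 : ϱ x y ≤ c₁ * ρ x y := by
        have := (hc₁' x y).1
        rwa [inv_mul_le_iff₀ (by linarith)] at this
      have h2 := hC₀' x y
      have h3 := hnn x y
      refine max_le ?_ ?_ <;> nlinarith
    calc m.dist x y ≤ D x y ^ α := (hm x y).1
      _ ≤ (c₁ * C₀ * ρ x y) ^ α := Real.rpow_le_rpow (hDnn x y) hDle hα0.le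
      _ = c₁ ^ α * C₀ ^ α * ρ x y ^ α := by
          rw [Real.mul_rpow (by positivity) (hρnn x y), Real.mul_rpow (by linarith) (by linarith)]
      _ ≤ _ := by
          have : 0 ≤ c₁ ^ α * C₀ ^ α * ρ x y ^ α := by
            have := Real.rpow_nonneg (hρnn x y) α
            positivity
          linarith

end Metrization

section Nets

/-- The power `ρ ^ α` is comparable, with constant `c`, to the ambient pseudometric. -/
structure DistComparable [PseudoMetricSpace X] (ρ : X → X → ℝ) (α c : ℝ) : Prop where
  nonneg : ∀ x y, 0 ≤ ρ x y
  pos : 0 < α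
  one_le : 1 ≤ c
  rpow_le : ∀ x y, ρ x y ^ α ≤ c * dist x y
  dist_le : ∀ x y, dist x y ≤ c * ρ x y ^ α

namespace DistComparable

variable [PseudoMetricSpace X] {ρ : X → X → ℝ} {α c : ℝ}

omit [MeasurableSpace X] in
theorem qball_subset_ball (h : DistComparable ρ α c) (x : X) {t : ℝ} (ht : 0 < t) :
    qball ρ x ((t / c) ^ (1 / α)) ⊆ Metric.ball x t := by
  intro y hy
  have hc : 0 < c := zero_lt_one.trans_le h.one_le
  have h1 : ρ x y ^ α < t / c := by
    have := Real.rpow_lt_rpow (h.nonneg x y) (show ρ x y < _ from hy) h.pos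
    rwa [← Real.rpow_mul (by positivity), one_div_mul_cancel h.pos.ne', Real.rpow_one] at this
  rw [Metric.mem_ball, dist_comm]
  calc dist x y ≤ c * ρ x y ^ α := h.dist_le x y
    _ < c * (t / c) := by gcongr
    _ = t := by field_simp

omit [MeasurableSpace X] in
theorem rho_lt (h : DistComparable ρ α c) {x y : X} {t : ℝ} (hxy : dist x y < t) :
    ρ x y < (c * t) ^ (1 / α) := by
  have hc : 0 < c := zero_lt_one.trans_le h.one_le
  have h1 : ρ x y ^ α < c * t := (h.rpow_le x y).trans_lt (by gcongr)
  have := Real.rpow_lt_rpow (Real.rpow_nonneg (h.nonneg x y) _) h1 (one_div_pos.2 h.pos)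
  rwa [← Real.rpow_mul (h.nonneg x y), mul_one_div_cancel h.pos.ne', Real.rpow_one] at this

omit [MeasurableSpace X] in
theorem ball_subset_qball (h : DistComparable ρ α c) (x : X) (t : ℝ) :
    Metric.ball x t ⊆ qball ρ x ((c * t) ^ (1 / α)) := fun _ hy =>
  h.rho_lt (by rwa [dist_comm])

variable {μ : Measure X}

theorem ball_pos (h : DistComparable ρ α c) (hX : IsQMMS ρ μ) (x : X) {t : ℝ} (ht : 0 < t) :
    0 < μ (Metric.ball x t) := by
  have hc : 0 < c := zero_lt_one.trans_le h.one_le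
  exact (hX.ball_pos x _ (by positivity)).trans_le (measure_mono (h.qball_subset_ball x ht))

theorem ball_lt_top (h : DistComparable ρ α c) (hX : IsQMMS ρ μ) (x : X) (t : ℝ) :
    μ (Metric.ball x t) < ∞ := by
  rcases le_or_gt t 0 with ht | ht
  · simp [Metric.ball_eq_empty.2 ht]
  have hc : 0 < c := zero_lt_one.trans_le h.one_le
  exact (measure_mono (h.ball_subset_qball x t)).trans_lt (hX.ball_lt_top x _ (by positivity))

theorem doubling (h : DistComparable ρ α c) {Q : ℝ} (hd : QDoubling ρ μ Q) :
    ∃ κ : ℝ, 0 < κ ∧ ∀ (x y : X) (t T : ℝ), 0 < t → t ≤ T → Metric.ball x t ⊆ Metric.ball y T →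
      ENNReal.ofReal (κ * (t / T) ^ (Q / α)) * μ (qball ρ y ((c * T) ^ (1 / α))) ≤
        μ (qball ρ x ((t / c) ^ (1 / α))) := by
  obtain ⟨κ, hκ, H⟩ := hd
  have hc : 0 < c := zero_lt_one.trans_le h.one_le
  refine ⟨κ * (1 / c ^ 2) ^ (Q / α), by positivity, fun x y t T ht htT hsub => ?_⟩
  have hT : 0 < T := ht.trans_le htT
  have hle : t / c ≤ c * T := by
    rw [div_le_iff₀ hc]
    nlinarith [h.one_le, mul_pos hc hT, mul_le_mul h.one_le h.one_le zero_le_one hc.le]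
  have := H x y ((t / c) ^ (1 / α)) ((c * T) ^ (1 / α)) (by positivity)
    (Real.rpow_le_rpow (by positivity) hle (one_div_pos.2 h.pos).le)
    (((h.qball_subset_ball x ht).trans hsub).trans (h.ball_subset_qball y T))
  convert this using 3
  rw [← Real.div_rpow (by positivity) (by positivity), ← Real.rpow_mul (by positivity),
    one_div_mul_eq_div, mul_assoc, ← Real.mul_rpow (by positivity) (by positivity)]
  congr 2
  field_simp

theorem card_le_of_separated (h : DistComparable ρ α c) (hX : IsQMMS ρ μ) {Q : ℝ}
    (hd : QDoubling ρ μ Q) :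
    ∃ K : ℝ, 0 < K ∧ ∀ (F : Finset X) (x : X) (t T : ℝ), 0 < t → t ≤ T →
      (F : Set X).Pairwise (fun a b => t ≤ dist a b) → (∀ z ∈ F, dist z x < T) →
      (F.card : ℝ) ≤ K * (T / t) ^ (Q / α) := by
  obtain ⟨κ, hκ, H⟩ := h.doubling hd
  have hc : 0 < c := zero_lt_one.trans_le h.one_le
  refine ⟨κ⁻¹ * 4 ^ (Q / α), by positivity, fun F x t T ht htT hsep hF => ?_⟩
  have hT : 0 < T := ht.trans_le htT
  set B := qball ρ x ((c * (2 * T)) ^ (1 / α)) with hB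
  have hBpos : 0 < μ B := hX.ball_pos x _ (by positivity)
  have hBtop : μ B < ∞ := hX.ball_lt_top x _ (by positivity)
  have hsubball : ∀ z ∈ F, Metric.ball z (t / 2) ⊆ Metric.ball x (2 * T) := fun z hz =>
    Metric.ball_subset_ball' (by linarith [hF z hz])
  have hlow : ∀ z ∈ F, ENNReal.ofReal (κ * (t / 2 / (2 * T)) ^ (Q / α)) * μ B ≤
      μ (qball ρ z ((t / 2 / c) ^ (1 / α))) := fun z hz =>
    H z x _ _ (by positivity) (by linarith) (hsubball z hz)
  have hsum : ∑ z ∈ F, μ (qball ρ z ((t / 2 / c) ^ (1 / α))) ≤ μ B := by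
    rw [← measure_biUnion_finset]
    · refine measure_mono (iUnion₂_subset fun z hz => ?_)
      exact ((h.qball_subset_ball z (by positivity)).trans (hsubball z hz)).trans
        (h.ball_subset_qball x _)
    · intro a ha b hb hab
      refine Disjoint.mono (h.qball_subset_ball a (by positivity))
        (h.qball_subset_ball b (by positivity)) (Metric.ball_disjoint_ball ?_)
      linarith [hsep ha hb hab]
    · exact fun z _ => hX.measurableSet_ball z _ (by positivity)
  have h1 : (F.card : ℝ≥0∞) * ENNReal.ofReal (κ * (t / 2 / (2 * T)) ^ (Q / α)) ≤ 1 := by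
    rw [← ENNReal.mul_le_mul_iff_left hBpos.ne' hBtop.ne, one_mul]
    calc _ = ∑ z ∈ F, ENNReal.ofReal (κ * (t / 2 / (2 * T)) ^ (Q / α)) * μ B := by
          rw [Finset.sum_const, nsmul_eq_mul, mul_assoc]
      _ ≤ _ := (Finset.sum_le_sum hlow).trans hsum
  have hp : 0 < κ * (t / 2 / (2 * T)) ^ (Q / α) := by positivity
  have h2 : (F.card : ℝ) * (κ * (t / 2 / (2 * T)) ^ (Q / α)) ≤ 1 := by
    rw [← ENNReal.ofReal_natCast, ← ENNReal.ofReal_mul (by positivity)] at h1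
    rwa [ENNReal.ofReal_le_one] at h1
  have e : κ⁻¹ * 4 ^ (Q / α) * (T / t) ^ (Q / α) = (κ * (t / 2 / (2 * T)) ^ (Q / α))⁻¹ := by
    rw [mul_inv, ← Real.inv_rpow (by positivity), mul_assoc,
      ← Real.mul_rpow (by positivity) (by positivity)]
    congr 2
    field_simp
    norm_num
  rw [e, ← one_div, le_div_iff₀ hp]
  exact h2

end DistComparable

omit [MeasurableSpace X] in
theorem exists_maximal_separated [PseudoMetricSpace X] (S : Set X) (t : ℝ) :
    ∃ N ⊆ S, N.Pairwise (fun a b => t ≤ dist a b) ∧ (0 < t → ∀ x ∈ S, ∃ z ∈ N, dist x z < t) := by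
  obtain ⟨N, hN⟩ := zorn_subset {N : Set X | N ⊆ S ∧ N.Pairwise (fun a b => t ≤ dist a b)} (by
    intro C hC hchain
    refine ⟨⋃₀ C, ⟨sUnion_subset fun N hN => (hC hN).1, ?_⟩, fun N hN => subset_sUnion_of_mem hN⟩
    exact (pairwise_sUnion hchain.directedOn).2 fun N hN => (hC hN).2)
  refine ⟨N, hN.prop.1, hN.prop.2, fun ht x hx => ?_⟩
  by_contra! hcon
  have hins : insert x N ∈ {N : Set X | N ⊆ S ∧ N.Pairwise (fun a b => t ≤ dist a b)} := by
    refine ⟨insert_subset hx hN.prop.1, hN.prop.2.insert fun b hb _ => ⟨hcon b hb, ?_⟩⟩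
    rw [dist_comm]; exact hcon b hb
  have := hN.le_of_ge hins (subset_insert x N) (mem_insert x N)
  have := hcon x this
  rw [dist_self] at this
  linarith

namespace DistComparable

variable [PseudoMetricSpace X] {ρ : X → X → ℝ} {α c : ℝ} {μ : Measure X}

theorem exists_finset_of_separated (h : DistComparable ρ α c) (hX : IsQMMS ρ μ) {Q : ℝ}
    (hd : QDoubling ρ μ Q) :
    ∃ K : ℝ, 0 < K ∧ ∀ (N : Set X) (x : X) (t T : ℝ), 0 < t → t ≤ T →
      N.Pairwise (fun a b => t ≤ dist a b) →
      ∃ F : Finset X, (∀ z, z ∈ F ↔ z ∈ N ∧ dist z x < T) ∧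
        (F.card : ℝ) ≤ K * (T / t) ^ (Q / α) := by
  obtain ⟨K, hK, H⟩ := h.card_le_of_separated hX hd
  refine ⟨K, hK, fun N x t T ht htT hN => ?_⟩
  have hsub : ∀ F : Finset X, (F : Set X) ⊆ {z | z ∈ N ∧ dist z x < T} →
      (F.card : ℝ) ≤ K * (T / t) ^ (Q / α) := fun F hF =>
    H F x t T ht htT (hN.mono fun z hz => (hF hz).1) fun z hz => (hF hz).2
  have hfin : {z | z ∈ N ∧ dist z x < T}.Finite := by
    by_contra hinf
    obtain ⟨F, hF, hcard⟩ := Set.Infinite.exists_subset_card_eq hinf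
      (⌈K * (T / t) ^ (Q / α)⌉₊ + 1)
    have h1 := hsub F hF
    rw [hcard] at h1
    have := Nat.le_ceil (K * (T / t) ^ (Q / α))
    push_cast at h1
    linarith
  refine ⟨hfin.toFinset, fun z => by simp, hsub _ (by simp)⟩

theorem countable_of_separated (h : DistComparable ρ α c) (hX : IsQMMS ρ μ) {Q : ℝ}
    (hd : QDoubling ρ μ Q) {N : Set X} {t : ℝ} (ht : 0 < t)
    (hN : N.Pairwise (fun a b => t ≤ dist a b)) : N.Countable := by
  obtain ⟨K, -, H⟩ := h.exists_finset_of_separated hX hd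
  obtain ⟨x₀, -⟩ := hX.nontrivial
  have : N ⊆ ⋃ n : ℕ, {z | z ∈ N ∧ dist z x₀ < max t n} := by
    intro z hz
    obtain ⟨n, hn⟩ := exists_nat_gt (dist z x₀)
    exact mem_iUnion.2 ⟨n, hz, lt_max_of_lt_right hn⟩
  refine (countable_iUnion fun n => ?_).mono this
  obtain ⟨F, hF, -⟩ := H N x₀ t (max t n) ht (le_max_left _ _) hN
  refine F.countable_toSet.mono fun z hz => (hF z).2 hz

theorem secondCountable (h : DistComparable ρ α c) (hX : IsQMMS ρ μ) {Q : ℝ}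
    (hd : QDoubling ρ μ Q) : SecondCountableTopology X := by
  refine Metric.secondCountable_of_almost_dense_set fun ε hε => ?_
  obtain ⟨N, -, hN, hcov⟩ := exists_maximal_separated (univ : Set X) ε
  refine ⟨N, h.countable_of_separated hX hd hε hN, fun x => ?_⟩
  obtain ⟨z, hz, hzx⟩ := hcov hε x (mem_univ x)
  exact ⟨z, hz, hzx.le⟩

theorem opensMeasurableSpace (h : DistComparable ρ α c) (hX : IsQMMS ρ μ) {Q : ℝ}
    (hd : QDoubling ρ μ Q) : OpensMeasurableSpace X := by
  have := h.secondCountable hX hd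
  have hc : 0 < c := zero_lt_one.trans_le h.one_le
  refine ⟨MeasurableSpace.generateFrom_le fun U (hU : IsOpen U) => ?_⟩
  have hr : ∀ x ∈ U, ∃ r > 0, qball ρ x r ⊆ U := fun x hx => by
    obtain ⟨t, ht, htU⟩ := Metric.isOpen_iff.1 hU x hx
    exact ⟨(t / c) ^ (1 / α), by positivity, (h.qball_subset_ball x ht).trans htU⟩
  choose! r hr0 hrU using hr
  have hint : ∀ x ∈ U, x ∈ interior (qball ρ x (r x)) := fun x hx => by
    have hpos : 0 < r x := hr0 x hx
    refine mem_interior.2 ⟨Metric.ball x (r x ^ α / c), fun y hy => ?_, Metric.isOpen_ball,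
      Metric.mem_ball_self (by positivity)⟩
    have := h.ball_subset_qball x _ hy
    rwa [mul_div_cancel₀ _ hc.ne', ← Real.rpow_mul hpos.le, mul_one_div_cancel h.pos.ne',
      Real.rpow_one] at this
  obtain ⟨T, hTU, hT, hTeq⟩ := TopologicalSpace.isOpen_biUnion_countable U
    (fun x => interior (qball ρ x (r x))) fun _ _ => isOpen_interior
  have : U = ⋃ x ∈ T, qball ρ x (r x) := by
    refine Subset.antisymm (fun x hx => ?_) (iUnion₂_subset fun x hx => hrU x (hTU hx))
    have hx' : x ∈ ⋃ x ∈ U, interior (qball ρ x (r x)) := mem_biUnion hx (hint x hx)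
    rw [← hTeq] at hx'
    exact biUnion_mono subset_rfl (fun _ _ => interior_subset) hx'
  rw [this]
  exact .biUnion hT fun x hx => hX.measurableSet_ball x _ (hr0 x (hTU hx))

end DistComparable

/-- A hierarchy of nets of `Ω` at the scales `r n`, with bounded overlap and with the measure
estimates coming from doubling and measure density. -/
structure NetSystem [PseudoMetricSpace X] (μ : Measure X) (Ω : Set X) (r : ℕ → ℝ)
    (N : ℕ → Set X) (M : ℕ) (Λ : ℝ≥0∞) : Prop where
  pos : ∀ n, 0 < r n
  anti : Antitone r
  subset : ∀ n, N n ⊆ Ω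
  countable : ∀ n, (N n).Countable
  cover : ∀ n, ∀ x ∈ Ω, ∃ z ∈ N n, dist x z < r n
  overlap : ∀ n x, ∃ F : Finset X, (∀ z, z ∈ F ↔ z ∈ N n ∧ dist z x < 8 * r n) ∧ F.card ≤ M
  dens : ∀ n, ∀ z ∈ N n,
    μ (Metric.ball z (8 * r n)) ≤ M * μ (Metric.ball z (r n) ∩ Ω)
  dens_pos : ∀ n, ∀ z ∈ N n, 0 < μ (Metric.ball z (r n) ∩ Ω)
  lt_top : ∀ n, ∀ z ∈ N n, μ (Metric.ball z (8 * r n)) < ∞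
  growth : ∀ n j, n ≤ j → ∀ z ∈ N n, ∀ z' ∈ N j, dist z z' < 4 * r n →
    μ (Metric.ball z (r n) ∩ Ω) ≤ M * Λ ^ (j - n) * μ (Metric.ball z' (r j) ∩ Ω)

theorem DistComparable.density [PseudoMetricSpace X] {ρ : X → X → ℝ} {α c : ℝ} {μ : Measure X}
    (h : DistComparable ρ α c) {Q : ℝ} (hd : QDoubling ρ μ Q) {Ω : Set X}
    (hΩ : MeasDensity ρ μ Ω) :
    ∃ K : ℝ, 0 < K ∧ ∀ (x y : X) (t T : ℝ), x ∈ Ω → 0 < t → t ≤ 1 → t ≤ T →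
      Metric.ball x t ⊆ Metric.ball y T →
      μ (Metric.ball y T) ≤ ENNReal.ofReal (K * (T / t) ^ (Q / α)) * μ (Metric.ball x t ∩ Ω) := by
  obtain ⟨κ, hκ, H⟩ := h.doubling hd
  obtain ⟨b, hb, HΩ⟩ := hΩ
  have hc : 0 < c := zero_lt_one.trans_le h.one_le
  refine ⟨κ⁻¹ * b, by positivity, fun x y t T hx ht ht1 htT hsub => ?_⟩
  have hT : 0 < T := ht.trans_le htT
  have h1 := H x y t T ht htT hsub
  have h2 := HΩ x hx ((t / c) ^ (1 / α)) (by positivity) (by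
    refine Real.rpow_le_one (by positivity) ?_ (one_div_pos.2 h.pos).le
    rw [div_le_one hc]; linarith [h.one_le])
  have hp : 0 < κ * (t / T) ^ (Q / α) := by positivity
  calc μ (Metric.ball y T) ≤ μ (qball ρ y ((c * T) ^ (1 / α))) :=
        measure_mono (h.ball_subset_qball y T)
    _ = ENNReal.ofReal (κ * (t / T) ^ (Q / α))⁻¹ * (ENNReal.ofReal (κ * (t / T) ^ (Q / α)) *
          μ (qball ρ y ((c * T) ^ (1 / α)))) := by
        rw [← mul_assoc, ← ENNReal.ofReal_mul (by positivity), inv_mul_cancel₀ hp.ne',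
          ENNReal.ofReal_one, one_mul]
    _ ≤ ENNReal.ofReal (κ * (t / T) ^ (Q / α))⁻¹ *
          (ENNReal.ofReal b * μ (Metric.ball x t ∩ Ω)) := by
        refine mul_le_mul_right (h1.trans (h2.trans ?_)) _
        gcongr
        exact h.qball_subset_ball x ht
    _ = _ := by
        rw [← mul_assoc, ← ENNReal.ofReal_mul (by positivity)]
        congr 2
        rw [mul_inv, ← Real.inv_rpow (by positivity), inv_div]
        ring

/-- The radius `ε * 2 ^ (-nα)`. -/
def netRadius (ε α : ℝ) (n : ℕ) : ℝ := ε * 2 ^ (-(n * α))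

theorem netRadius_pos {ε : ℝ} (hε : 0 < ε) (α : ℝ) (n : ℕ) : 0 < netRadius ε α n := by
  unfold netRadius; positivity

theorem netRadius_antitone {ε α : ℝ} (hε : 0 < ε) (hα : 0 < α) : Antitone (netRadius ε α) := by
  intro m n hmn
  unfold netRadius
  gcongr
  norm_num

theorem netRadius_div {ε : ℝ} (hε : 0 < ε) (α : ℝ) {n j : ℕ} (hnj : n ≤ j) :
    netRadius ε α n / netRadius ε α j = 2 ^ (((j - n : ℕ) : ℝ) * α) := by
  unfold netRadius
  rw [mul_div_mul_left _ _ hε.ne', ← Real.rpow_sub two_pos, Nat.cast_sub hnj]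
  congr 1; ring

theorem DistComparable.exists_netSystem [PseudoMetricSpace X] {ρ : X → X → ℝ} {α c : ℝ}
    {μ : Measure X} (h : DistComparable ρ α c) (hX : IsQMMS ρ μ) {Q : ℝ}
    (hd : QDoubling ρ μ Q) {Ω : Set X} (hΩ : MeasDensity ρ μ Ω) {ε : ℝ} (hε : 0 < ε)
    (hε1 : ε ≤ 1) :
    ∃ (N : ℕ → Set X) (M : ℕ),
      NetSystem μ Ω (netRadius ε α) N M (ENNReal.ofReal (2 ^ Q)) := by
  obtain ⟨K₁, hK₁, H₁⟩ := h.exists_finset_of_separated hX hd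
  obtain ⟨K₂, hK₂, H₂⟩ := h.density hd hΩ
  have hα := h.pos
  set r := netRadius ε α with hr
  have hrpos : ∀ n, 0 < r n := netRadius_pos hε α
  have hanti : Antitone r := netRadius_antitone hε hα
  have hr1 : ∀ n, r n ≤ 1 := fun n => (hanti (Nat.zero_le n)).trans (by simpa [hr, netRadius])
  choose N hNΩ hNsep hNcov using fun n => exists_maximal_separated Ω (r n)
  obtain ⟨M, hM⟩ := exists_nat_ge (max (K₁ * 8 ^ (Q / α)) (K₂ * 8 ^ (Q / α)))
  have hM1 : K₁ * 8 ^ (Q / α) ≤ M := (le_max_left _ _).trans hM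
  have hM2 : K₂ * 8 ^ (Q / α) ≤ M := (le_max_right _ _).trans hM
  have hdens : ∀ n, ∀ z ∈ N n,
      μ (Metric.ball z (8 * r n)) ≤ M * μ (Metric.ball z (r n) ∩ Ω) := fun n z hz => by
    have h8 : r n ≤ 8 * r n := by linarith [hrpos n]
    refine (H₂ z z (r n) (8 * r n) (hNΩ n hz) (hrpos n) (hr1 n) h8
      (Metric.ball_subset_ball h8)).trans ?_
    gcongr
    rw [mul_div_cancel_right₀ _ (hrpos n).ne', ← ENNReal.ofReal_natCast]
    exact ENNReal.ofReal_le_ofReal hM2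
  refine ⟨N, M, hrpos, hanti, hNΩ, fun n => h.countable_of_separated hX hd (hrpos n) (hNsep n),
    fun n => hNcov n (hrpos n), fun n x => ?_, hdens, fun n z hz => ?_,
    fun n z _ => h.ball_lt_top hX z _, fun n j hnj z hz z' hz' hzz' => ?_⟩
  · obtain ⟨F, hF, hcard⟩ := H₁ (N n) x (r n) (8 * r n) (hrpos n) (by linarith [hrpos n]) (hNsep n)
    refine ⟨F, hF, ?_⟩
    rw [mul_div_cancel_right₀ _ (hrpos n).ne'] at hcard
    exact_mod_cast hcard.trans hM1
  · refine pos_iff_ne_zero.2 fun h0 => ?_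
    have h1 := hdens n z hz
    rw [h0, mul_zero] at h1
    exact absurd h1 (not_le.2 (h.ball_pos hX z (by linarith [hrpos n])))
  · have hj : r j ≤ r n := hanti hnj
    have hn := hrpos n
    calc μ (Metric.ball z (r n) ∩ Ω) ≤ μ (Metric.ball z (8 * r n)) :=
          measure_mono (inter_subset_left.trans (Metric.ball_subset_ball (by linarith)))
      _ ≤ ENNReal.ofReal (K₂ * (8 * r n / r j) ^ (Q / α)) * μ (Metric.ball z' (r j) ∩ Ω) :=
          H₂ z' z (r j) (8 * r n) (hNΩ j hz') (hrpos j) (hr1 j) (by linarith)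
            (Metric.ball_subset_ball' (by rw [dist_comm]; linarith))
      _ ≤ _ := by
          gcongr
          rw [mul_div_assoc, netRadius_div hε α hnj, Real.mul_rpow (by norm_num) (by positivity),
            ← Real.rpow_mul (by norm_num), ← mul_assoc, ENNReal.ofReal_mul (by positivity),
            ← ENNReal.ofReal_natCast, ← ENNReal.ofReal_pow (by positivity), ← Real.rpow_natCast,
            ← Real.rpow_mul (by norm_num)]
          refine mul_le_mul' (ENNReal.ofReal_le_ofReal hM2) (le_of_eq ?_)
          congr 2
          field_simp

end Nets

section Atoms

variable {Y ι : Type*} [PseudoMetricSpace Y]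

/-- A locally finite family of Lipschitz weights `w i`, supported in `U i`, at scale `r`. -/
structure AtomFamily (I : Set ι) (U : ι → Set Y) (G : Y → Finset ι) (w : ι → Y → ℝ)
    (r L : ℝ) : Prop where
  pos : 0 < r
  nonneg : 0 ≤ L
  subset : ∀ x, ∀ i ∈ G x, i ∈ I
  mem : ∀ x y, ∀ i ∈ I, dist x y ≤ r → y ∈ U i → i ∈ G x
  eq_zero : ∀ i x, x ∉ U i → w i x = 0
  bound : ∀ i x, |w i x| ≤ L
  lip : ∀ i ∈ I, ∀ x y, dist x y ≤ r → |w i x - w i y| ≤ L * (dist x y / r)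

/-- The superposition of the atoms with coefficients `a`. -/
def atomSum (G : Y → Finset ι) (w : ι → Y → ℝ) (a : ι → ℝ) (x : Y) : ℝ :=
  ∑ i ∈ G x, w i x * a i

/-- The size of the coefficients of the atoms that are active at `x`. -/
def atomSize (I : Set ι) (U : ι → Set Y) (a : ι → ℝ) (x : Y) : ℝ≥0∞ :=
  ∑' i : I, (U i).indicator (fun _ => ENNReal.ofReal |a i|) x

namespace AtomFamily

variable {I : Set ι} {U : ι → Set Y} {G : Y → Finset ι} {w : ι → Y → ℝ} {r L : ℝ}

theorem sum_indicator_le (h : AtomFamily I U G w r L) (a : ι → ℝ) (x y : Y) :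
    ∑ i ∈ G x, (U i).indicator (fun _ => ENNReal.ofReal |a i|) y ≤ atomSize I U a y := by
  rw [atomSize, tsum_subtype I fun i => (U i).indicator (fun _ => ENNReal.ofReal |a i|) y]
  refine le_trans (Finset.sum_le_sum fun i hi => ?_) (ENNReal.sum_le_tsum (G x))
  rw [indicator_of_mem (h.subset x i hi)]

theorem atomSize_eq (h : AtomFamily I U G w r L) (a : ι → ℝ) (x : Y) :
    atomSize I U a x = ∑ i ∈ G x, (U i).indicator (fun _ => ENNReal.ofReal |a i|) x := by
  refine le_antisymm ?_ (h.sum_indicator_le a x x)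
  rw [atomSize, tsum_subtype I fun i => (U i).indicator (fun _ => ENNReal.ofReal |a i|) x,
    tsum_eq_sum (s := G x)]
  · exact Finset.sum_le_sum fun i _ => indicator_le_self _ _ i
  · intro i hi
    by_cases hI : i ∈ I
    · rw [indicator_of_mem hI, indicator_of_notMem]
      exact fun hx => hi (h.mem x x i hI (by simpa using h.pos.le) hx)
    · rw [indicator_of_notMem hI]

theorem atomSum_eq (h : AtomFamily I U G w r L) (a : ι → ℝ) {x y : Y} (hxy : dist x y ≤ r) :
    atomSum G w a y = ∑ i ∈ G x, w i y * a i := by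
  classical
  have key : ∀ x' y', dist x' y' ≤ r → ∀ i ∈ G y', i ∉ G x' → w i y' * a i = 0 := by
    intro x' y' hxy' i hi hi'
    rw [h.eq_zero i y' fun hy => hi' (h.mem x' y' i (h.subset _ i hi) hxy' hy), zero_mul]
  have key2 : ∀ i ∈ G x, i ∉ G y → w i y * a i = 0 := by
    intro i hi hi'
    rw [h.eq_zero i y fun hy => hi' (h.mem y y i (h.subset _ i hi) (by simpa using h.pos.le) hy),
      zero_mul]
  rw [atomSum, Finset.sum_subset (Finset.subset_union_right (s₁ := G x)) fun i hi hi' =>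
    key2 i ((Finset.mem_union.1 hi).resolve_right hi') hi']
  exact (Finset.sum_subset Finset.subset_union_left fun i hi hi' =>
    key x y hxy i ((Finset.mem_union.1 hi).resolve_left hi') hi').symm

theorem ofReal_abs_atomSum_le (h : AtomFamily I U G w r L) (a : ι → ℝ) (x : Y) :
    ENNReal.ofReal |atomSum G w a x| ≤ ENNReal.ofReal L * atomSize I U a x := by
  rw [h.atomSize_eq, Finset.mul_sum, atomSum]
  refine (ENNReal.ofReal_le_ofReal (Finset.abs_sum_le_sum_abs _ _)).trans ?_
  rw [ENNReal.ofReal_sum_of_nonneg fun _ _ => abs_nonneg _]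
  refine Finset.sum_le_sum fun i _ => ?_
  by_cases hx : x ∈ U i
  · rw [indicator_of_mem hx, ← ENNReal.ofReal_mul h.nonneg, abs_mul]
    gcongr
    exact h.bound i x
  · simp [h.eq_zero i x hx]

theorem abs_atomSum_sub_le (h : AtomFamily I U G w r L) (a : ι → ℝ) {x y : Y}
    (hxy : dist x y ≤ r) :
    |atomSum G w a x - atomSum G w a y| ≤ ∑ i ∈ G x, |w i x - w i y| * |a i| := by
  rw [h.atomSum_eq a hxy, atomSum, ← Finset.sum_sub_distrib]
  refine (Finset.abs_sum_le_sum_abs _ _).trans_eq (Finset.sum_congr rfl fun i _ => ?_)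
  rw [← sub_mul, abs_mul]

theorem ofReal_abs_atomSum_sub_le (h : AtomFamily I U G w r L) (a : ι → ℝ) (x y : Y) :
    ENNReal.ofReal |atomSum G w a x - atomSum G w a y| ≤
      ENNReal.ofReal L * ENNReal.ofReal (dist x y / r) *
        (atomSize I U a x + atomSize I U a y) := by
  rcases le_or_gt (dist x y) r with hxy | hxy
  · have hd : 0 ≤ dist x y / r := div_nonneg dist_nonneg h.pos.le
    refine (ENNReal.ofReal_le_ofReal (h.abs_atomSum_sub_le a hxy)).trans ?_
    rw [ENNReal.ofReal_sum_of_nonneg fun _ _ => by positivity]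
    refine le_trans ?_ (mul_le_mul_right
      (add_le_add (h.sum_indicator_le a x x) (h.sum_indicator_le a x y)) _)
    rw [← Finset.sum_add_distrib, Finset.mul_sum]
    refine Finset.sum_le_sum fun i hi => ?_
    by_cases hU : x ∈ U i ∨ y ∈ U i
    · rw [← ENNReal.ofReal_mul h.nonneg, ENNReal.ofReal_mul (abs_nonneg _)]
      gcongr
      · exact h.lip i (h.subset x i hi) x y hxy
      · rcases hU with hU | hU
        · rw [indicator_of_mem hU]; exact le_self_add
        · rw [indicator_of_mem hU]; exact le_add_self
    · push Not at hU
      rw [h.eq_zero i x hU.1, h.eq_zero i y hU.2]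
      simp
  · have h1 : 1 ≤ ENNReal.ofReal (dist x y / r) := by
      rw [ENNReal.one_le_ofReal, one_le_div h.pos]; exact hxy.le
    calc ENNReal.ofReal |atomSum G w a x - atomSum G w a y|
        ≤ ENNReal.ofReal (|atomSum G w a x| + |atomSum G w a y|) :=
          ENNReal.ofReal_le_ofReal (abs_sub _ _)
      _ ≤ ENNReal.ofReal L * (atomSize I U a x + atomSize I U a y) := by
          rw [ENNReal.ofReal_add (abs_nonneg _) (abs_nonneg _), mul_add]
          exact add_le_add (h.ofReal_abs_atomSum_le a x) (h.ofReal_abs_atomSum_le a y)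
      _ ≤ _ := by
          gcongr
          exact le_mul_of_one_le_right zero_le h1

theorem continuous_atomSum (h : AtomFamily I U G w r L) (a : ι → ℝ) :
    Continuous (atomSum G w a) := by
  refine continuous_iff_continuousAt.2 fun x => ?_
  refine continuousAt_of_locally_lipschitz h.pos (L / r * ∑ i ∈ G x, |a i|) fun y hy => ?_
  rw [dist_comm, Real.dist_eq]
  rw [dist_comm] at hy
  refine (h.abs_atomSum_sub_le a hy.le).trans ?_
  rw [Finset.mul_sum, Finset.sum_mul]
  refine Finset.sum_le_sum fun i hi => ?_
  calc |w i x - w i y| * |a i| ≤ L * (dist x y / r) * |a i| := by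
        gcongr; exact h.lip i (h.subset x i hi) x y hy.le
    _ = _ := by rw [dist_comm]; ring

omit [PseudoMetricSpace Y] in
theorem measurable_atomSize [MeasurableSpace Y] (hI : I.Countable)
    (hU : ∀ i, MeasurableSet (U i)) (a : ι → ℝ) : Measurable (atomSize I U a) := by
  have := hI.to_subtype
  exact Measurable.tsum fun i => measurable_const.indicator (hU i)

end AtomFamily

/-- The unnormalised bump at `z`. -/
def bump (r : ℝ) (z x : Y) : ℝ := max (2 - dist x z / r) 0

/-- `near x` lists the points of `N` at distance less than `8 * r` from `x`, at most `M` many. -/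
structure IsNet (N : Set Y) (r : ℝ) (M : ℕ) (near : Y → Finset Y) : Prop where
  pos : 0 < r
  mem_near : ∀ x z, z ∈ near x ↔ z ∈ N ∧ dist z x < 8 * r
  card_le : ∀ x, (near x).card ≤ M

/-- The partition of unity subordinate to a net. -/
def netWeight (r : ℝ) (near : Y → Finset Y) (z x : Y) : ℝ :=
  bump r z x / max 1 (∑ z' ∈ near x, bump r z' x)

theorem bump_nonneg (r : ℝ) (z x : Y) : 0 ≤ bump r z x := le_max_right _ _

theorem bump_le_two {r : ℝ} (hr : 0 < r) (z x : Y) : bump r z x ≤ 2 :=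
  max_le (sub_le_self _ (by positivity)) zero_le_two

theorem bump_eq_zero {r : ℝ} (hr : 0 < r) {z x : Y} (h : 2 * r ≤ dist x z) : bump r z x = 0 := by
  refine max_eq_right ?_
  rw [sub_nonpos, le_div_iff₀ hr]
  exact h

theorem abs_bump_sub_le {r : ℝ} (hr : 0 < r) (z x y : Y) :
    |bump r z x - bump r z y| ≤ dist x y / r := by
  refine (abs_max_sub_max_le_abs _ _ _).trans ?_
  have : 2 - dist x z / r - (2 - dist y z / r) = (dist y z - dist x z) / r := by ring
  rw [this, abs_div, abs_of_pos hr]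
  gcongr
  rw [dist_comm x y]
  exact abs_dist_sub_le y x z

namespace IsNet

variable {N : Set Y} {r : ℝ} {M : ℕ} {near : Y → Finset Y}

theorem sum_bump_eq (h : IsNet N r M near) {x y : Y} (hxy : dist x y ≤ r) :
    ∑ z ∈ near y, bump r z y = ∑ z ∈ near x, bump r z y := by
  classical
  have key : ∀ x', dist x' y ≤ r → ∀ z ∈ N, z ∉ near x' → bump r z y = 0 := by
    intro x' hx' z hz hzx
    refine bump_eq_zero h.pos ?_
    by_contra! hlt
    refine hzx ((h.mem_near x' z).2 ⟨hz, ?_⟩)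
    have := dist_triangle z y x'
    rw [dist_comm y x', dist_comm z y] at this
    linarith [h.pos]
  rw [Finset.sum_subset (Finset.subset_union_right (s₁ := near x)) fun i hi hi' =>
    key y (by simpa using h.pos.le) i
      ((h.mem_near x i).1 ((Finset.mem_union.1 hi).resolve_right hi')).1 hi']
  exact (Finset.sum_subset Finset.subset_union_left fun i hi hi' =>
    key x hxy i ((h.mem_near y i).1 ((Finset.mem_union.1 hi).resolve_left hi')).1 hi').symm

theorem netWeight_nonneg (z x : Y) : 0 ≤ netWeight r near z x :=
  div_nonneg (bump_nonneg _ _ _) (zero_le_one.trans (le_max_left _ _))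

theorem netWeight_le_two (h : IsNet N r M near) (z x : Y) : netWeight r near z x ≤ 2 :=
  (div_le_self (bump_nonneg _ _ _) (le_max_left _ _)).trans (bump_le_two h.pos z x)

theorem netWeight_eq_zero (h : IsNet N r M near) {z x : Y} (hzx : x ∉ Metric.ball z (2 * r)) :
    netWeight r near z x = 0 := by
  rw [netWeight, bump_eq_zero h.pos (by simpa using hzx), zero_div]

theorem abs_netWeight_sub_le (h : IsNet N r M near) (z : Y) {x y : Y} (hxy : dist x y ≤ r) :
    |netWeight r near z x - netWeight r near z y| ≤ (1 + 2 * M) * (dist x y / r) := by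
  have hd : 0 ≤ dist x y / r := div_nonneg dist_nonneg h.pos.le
  set a := bump r z x
  set b := bump r z y
  set A := max 1 (∑ z' ∈ near x, bump r z' x) with hA
  set B := max 1 (∑ z' ∈ near y, bump r z' y) with hB
  have hA1 : 1 ≤ A := le_max_left _ _
  have hB1 : 1 ≤ B := le_max_left _ _
  have hAB : |A - B| ≤ M * (dist x y / r) := by
    have h1 : |A - B| ≤ |∑ z' ∈ near x, bump r z' x - ∑ z' ∈ near y, bump r z' y| := by
      rw [hA, hB, max_comm 1, max_comm 1]
      have := abs_max_sub_max_le_abs (∑ z' ∈ near x, bump r z' x) (∑ z' ∈ near y, bump r z' y) 1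
      simpa using this
    refine h1.trans ?_
    rw [h.sum_bump_eq hxy, ← Finset.sum_sub_distrib]
    calc _ ≤ ∑ z' ∈ near x, |bump r z' x - bump r z' y| := Finset.abs_sum_le_sum_abs _ _
      _ ≤ (near x).card • (dist x y / r) :=
          Finset.sum_le_card_nsmul _ _ _ fun z' _ => abs_bump_sub_le h.pos z' x y
      _ ≤ _ := by
          rw [nsmul_eq_mul]
          have := h.card_le x
          gcongr
  have e : netWeight r near z x - netWeight r near z y = (a - b) / B - a / A * ((A - B) / B) := by
    change a / A - b / B = _
    field_simp
    ring
  have ha : |a / A| ≤ 2 := by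
    change |netWeight r near z x| ≤ 2
    rw [abs_of_nonneg (netWeight_nonneg z x)]
    exact h.netWeight_le_two z x
  have hdiv : ∀ t : ℝ, |t / B| ≤ |t| := fun t => by
    rw [abs_div, abs_of_pos (zero_lt_one.trans_le hB1)]
    exact div_le_self (abs_nonneg _) hB1
  rw [e]
  calc _ ≤ |(a - b) / B| + |a / A * ((A - B) / B)| := abs_sub _ _
    _ ≤ dist x y / r + 2 * (M * (dist x y / r)) := by
        rw [abs_mul]
        exact add_le_add ((hdiv _).trans (abs_bump_sub_le h.pos z x y))
          (mul_le_mul ha ((hdiv _).trans hAB) (abs_nonneg _) zero_le_two)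
    _ = _ := by ring

theorem sum_netWeight (h : IsNet N r M near) {x : Y} (hx : ∃ z ∈ N, dist x z < r) :
    ∑ z ∈ near x, netWeight r near z x = 1 := by
  obtain ⟨z, hz, hxz⟩ := hx
  have hmem : z ∈ near x := (h.mem_near x z).2 ⟨hz, by rw [dist_comm]; linarith [h.pos]⟩
  have h1 : 1 ≤ ∑ z' ∈ near x, bump r z' x := by
    refine le_trans ?_ (Finset.single_le_sum (fun z' _ => bump_nonneg r z' x) hmem)
    refine le_max_of_le_left ?_
    have : dist x z / r ≤ 1 := (div_le_one h.pos).2 hxz.le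
    linarith
  simp_rw [netWeight]
  rw [← Finset.sum_div, max_eq_right h1, div_self (by linarith)]

theorem atomFamily (h : IsNet N r M near) :
    AtomFamily N (fun z => Metric.ball z (2 * r)) near (netWeight r near) r (4 * (1 + 2 * M)) where
  pos := h.pos
  nonneg := by positivity
  subset x i hi := ((h.mem_near x i).1 hi).1
  mem x y i hi hxy hy := by
    refine (h.mem_near x i).2 ⟨hi, ?_⟩
    rw [Metric.mem_ball] at hy
    have := dist_triangle x y i
    rw [dist_comm i x]
    linarith [h.pos]
  eq_zero i x hx := h.netWeight_eq_zero hx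
  bound i x := by
    rw [abs_of_nonneg (netWeight_nonneg i x)]
    have := h.netWeight_le_two i x
    have : (0 : ℝ) ≤ M := M.cast_nonneg
    linarith
  lip i _ x y hxy := by
    refine (h.abs_netWeight_sub_le i hxy).trans ?_
    have : 0 ≤ (1 + 2 * M) * (dist x y / r) :=
      mul_nonneg (by positivity) (div_nonneg dist_nonneg h.pos.le)
    linarith

theorem atomFamily_prod {N' : Set Y} {r' : ℝ} {near' : Y → Finset Y} (h : IsNet N r M near)
    (h' : IsNet N' r' M near') (hr : r' ≤ r) :
    AtomFamily (N ×ˢ N')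
      (fun z : Y × Y => Metric.ball z.1 (2 * r) ∩ Metric.ball z.2 (2 * r'))
      (fun x => near x ×ˢ near' x)
      (fun z x => netWeight r near z.1 x * netWeight r' near' z.2 x) r' (4 * (1 + 2 * M)) where
  pos := h'.pos
  nonneg := by positivity
  subset x i hi := ⟨h.atomFamily.subset x _ (Finset.mem_product.1 hi).1,
    h'.atomFamily.subset x _ (Finset.mem_product.1 hi).2⟩
  mem x y i hi hxy hy := Finset.mem_product.2
    ⟨h.atomFamily.mem x y _ hi.1 (hxy.trans hr) hy.1, h'.atomFamily.mem x y _ hi.2 hxy hy.2⟩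
  eq_zero i x hx := by
    by_cases h1 : x ∈ Metric.ball i.1 (2 * r)
    · rw [h'.netWeight_eq_zero fun h2 => hx ⟨h1, h2⟩, mul_zero]
    · rw [h.netWeight_eq_zero h1, zero_mul]
  bound i x := by
    rw [abs_of_nonneg (mul_nonneg (netWeight_nonneg _ x) (netWeight_nonneg _ x))]
    have := mul_le_mul (h.netWeight_le_two i.1 x) (h'.netWeight_le_two i.2 x)
      (netWeight_nonneg _ x) zero_le_two
    have : (0 : ℝ) ≤ M := M.cast_nonneg
    linarith
  lip i _ x y hxy := by
    have e : netWeight r near i.1 x * netWeight r' near' i.2 x -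
        netWeight r near i.1 y * netWeight r' near' i.2 y =
        (netWeight r near i.1 x - netWeight r near i.1 y) * netWeight r' near' i.2 x +
        netWeight r near i.1 y * (netWeight r' near' i.2 x - netWeight r' near' i.2 y) := by ring
    have h1 : dist x y / r ≤ dist x y / r' := by
      have := h'.pos
      gcongr
    have hM : (0 : ℝ) ≤ 1 + 2 * M := by positivity
    have hd' : 0 ≤ dist x y / r' := div_nonneg dist_nonneg h'.pos.le
    rw [e]
    calc _ ≤ |netWeight r near i.1 x - netWeight r near i.1 y| * |netWeight r' near' i.2 x| +
          |netWeight r near i.1 y| * |netWeight r' near' i.2 x - netWeight r' near' i.2 y| := by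
          rw [← abs_mul, ← abs_mul]; exact abs_add_le _ _
      _ ≤ (1 + 2 * M) * (dist x y / r') * 2 + 2 * ((1 + 2 * M) * (dist x y / r')) := by
          rw [abs_of_nonneg (netWeight_nonneg (near := near') i.2 x),
            abs_of_nonneg (netWeight_nonneg (near := near) i.1 y)]
          refine add_le_add (mul_le_mul ((h.abs_netWeight_sub_le i.1 (hxy.trans hr)).trans ?_)
            (h'.netWeight_le_two _ _) (netWeight_nonneg _ _) (by positivity))
            (mul_le_mul (h.netWeight_le_two _ _) (h'.abs_netWeight_sub_le i.2 hxy)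
              (abs_nonneg _) zero_le_two)
          gcongr
      _ = _ := by ring

end IsNet

end Atoms

section Reconstruction

theorem exists_limit_extension : ∃ Φ : (ℕ → ℝ) →ₗ[ℝ] ℝ, ∀ (a : ℕ → ℝ) (l : ℝ),
    Filter.Tendsto a Filter.atTop (nhds l) → Φ a = l := by
  let P : Submodule ℝ (ℕ → ℝ) :=
    { carrier := {a | ∃ l, Filter.Tendsto a Filter.atTop (nhds l)}
      add_mem' := fun ⟨l, hl⟩ ⟨l', hl'⟩ => ⟨l + l', hl.add hl'⟩
      zero_mem' := ⟨0, tendsto_const_nhds⟩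
      smul_mem' := fun t _ ⟨l, hl⟩ => ⟨t * l, hl.const_mul t⟩ }
  let f : P →ₗ[ℝ] ℝ :=
    { toFun := fun a => a.2.choose
      map_add' := fun a b => tendsto_nhds_unique (a + b).2.choose_spec
        (a.2.choose_spec.add b.2.choose_spec)
      map_smul' := fun t a => tendsto_nhds_unique (t • a).2.choose_spec
        (a.2.choose_spec.const_mul t) }
  obtain ⟨Φ, hΦ⟩ := f.exists_extend
  refine ⟨Φ, fun a l h => ?_⟩
  have : Φ a = f ⟨a, l, h⟩ := by rw [← hΦ]; rfl
  rw [this]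
  exact tendsto_nhds_unique
    (Exists.choose_spec (⟨l, h⟩ : ∃ l, Filter.Tendsto a Filter.atTop (nhds l))) h

/-- A linear functional on sequences extending the limit functional. -/
def genLim : (ℕ → ℝ) →ₗ[ℝ] ℝ := exists_limit_extension.choose

theorem genLim_eq {a : ℕ → ℝ} {l : ℝ} (h : Filter.Tendsto a Filter.atTop (nhds l)) :
    genLim a = l := exists_limit_extension.choose_spec a l h

/-- The value of the series `∑ f n`, made linear in `f` for divergent series too. -/
def seriesVal (f : ℕ → X → ℝ) (x : X) : ℝ :=
  genLim fun n => ∑ k ∈ Finset.range (n + 1), f k x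

theorem summable_of_tsum_ofReal_abs {f : ℕ → ℝ} (h : ∑' n, ENNReal.ofReal |f n| ≠ ∞) :
    Summable f := by
  have := ENNReal.summable_toReal h
  simp only [ENNReal.toReal_ofReal (abs_nonneg _)] at this
  exact this.of_abs

theorem ofReal_abs_tsum_le {f : ℕ → ℝ} (hf : Summable fun n => |f n|) :
    ENNReal.ofReal |∑' n, f n| ≤ ∑' n, ENNReal.ofReal |f n| := by
  rw [← ENNReal.ofReal_tsum_of_nonneg (fun _ => abs_nonneg _) hf]
  have h := norm_tsum_le_tsum_norm (f := f) (by simpa only [Real.norm_eq_abs] using hf)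
  simp only [Real.norm_eq_abs] at h
  exact ENNReal.ofReal_le_ofReal h

omit [MeasurableSpace X] in
theorem tendsto_seriesVal {f : ℕ → X → ℝ} {x : X} (h : ∑' n, ENNReal.ofReal |f n x| ≠ ∞) :
    Filter.Tendsto (fun n => ∑ k ∈ Finset.range (n + 1), f k x) Filter.atTop
      (nhds (seriesVal f x)) := by
  have h1 := (Filter.tendsto_add_atTop_iff_nat 1).2
    (summable_of_tsum_ofReal_abs h).hasSum.tendsto_sum_nat
  rwa [seriesVal, genLim_eq h1]

omit [MeasurableSpace X] in
theorem seriesVal_eq_tsum {f : ℕ → X → ℝ} {x : X} (h : ∑' n, ENNReal.ofReal |f n x| ≠ ∞) :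
    seriesVal f x = ∑' n, f n x :=
  genLim_eq ((Filter.tendsto_add_atTop_iff_nat 1).2
    (summable_of_tsum_ofReal_abs h).hasSum.tendsto_sum_nat)

theorem abs_summable_of_tsum {f : ℕ → ℝ} (h : ∑' n, ENNReal.ofReal |f n| ≠ ∞) :
    Summable fun n => |f n| := by
  have := ENNReal.summable_toReal h
  simpa only [ENNReal.toReal_ofReal (abs_nonneg _)] using this

theorem rpow_decay {s α : ℝ} (n : ℕ) (j : ℤ) (hnj : j ≤ n) :
    (2 : ℝ) ^ (-((n : ℝ) * s)) ≤
      2 ^ (-((j : ℝ) * s)) * (2 ^ (-min s (α - s))) ^ (j - n).natAbs := by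
  have e : ((j - n).natAbs : ℝ) = n - j := by
    rw [Nat.cast_natAbs, Int.cast_abs]
    push_cast
    rw [abs_of_nonpos (by rw [sub_nonpos]; exact_mod_cast hnj)]
    ring
  rw [← Real.rpow_natCast, e, ← Real.rpow_mul two_pos.le, ← Real.rpow_add two_pos]
  refine Real.rpow_le_rpow_of_exponent_le one_le_two ?_
  have h1 : (0 : ℝ) ≤ n - j := sub_nonneg.2 (by exact_mod_cast hnj)
  nlinarith [mul_le_mul_of_nonneg_left (min_le_left s (α - s)) h1]

theorem rpow_decay' {s α : ℝ} (n : ℕ) (j : ℤ) (hnj : (n : ℤ) ≤ j) :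
    (2 : ℝ) ^ (((n : ℝ) - j) * α) * 2 ^ (-((n : ℝ) * s)) ≤
      2 ^ (-((j : ℝ) * s)) * (2 ^ (-min s (α - s))) ^ (j - n).natAbs := by
  have e : ((j - n).natAbs : ℝ) = j - n := by
    rw [Nat.cast_natAbs, Int.cast_abs]
    push_cast
    rw [abs_of_nonneg (by rw [sub_nonneg]; exact_mod_cast hnj)]
  rw [← Real.rpow_natCast, e, ← Real.rpow_mul two_pos.le, ← Real.rpow_add two_pos,
    ← Real.rpow_add two_pos]
  refine Real.rpow_le_rpow_of_exponent_le one_le_two ?_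
  have h1 : (0 : ℝ) ≤ j - n := sub_nonneg.2 (by exact_mod_cast hnj)
  nlinarith [mul_le_mul_of_nonneg_left (min_le_right s (α - s)) h1]

/-- Extension of a sequence indexed by `ℕ` to `ℤ` by zero. -/
def extZ (a : ℕ → ℝ≥0∞) (k : ℤ) : ℝ≥0∞ := if 0 ≤ k then a k.toNat else 0

@[simp] theorem extZ_natCast (a : ℕ → ℝ≥0∞) (n : ℕ) : extZ a n = a n := by simp [extZ]

theorem tsum_extZ (a : ℕ → ℝ≥0∞) (w : ℤ → ℝ≥0∞) :
    ∑' k : ℤ, w k * extZ a k = ∑' n : ℕ, w n * a n := by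
  rw [tsum_of_nat_of_neg_add_one ENNReal.summable ENNReal.summable]
  have : ∀ n : ℕ, extZ a (-((n : ℤ) + 1)) = 0 := fun n => by
    rw [extZ, if_neg (by omega)]
  simp only [this, mul_zero, tsum_zero, add_zero, extZ_natCast]

variable [PseudoMetricSpace X] [OpensMeasurableSpace X]

/-- Pieces of a decomposition at scales `r n`, with sizes `H n`. -/
structure PieceBounds (f : ℕ → X → ℝ) (H : ℕ → X → ℝ≥0∞) (r : ℕ → ℝ) (L : ℝ) : Prop where
  cont : ∀ n, Continuous (f n)
  meas : ∀ n, Measurable (H n)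
  bound : ∀ n x, ENNReal.ofReal |f n x| ≤ ENNReal.ofReal L * H n x
  lip : ∀ n x y, ENNReal.ofReal |f n x - f n y| ≤
    ENNReal.ofReal L * ENNReal.ofReal (dist x y / r n) * (H n x + H n y)

theorem PieceBounds.reconstruct {ρ : X → X → ℝ} {α c : ℝ} {μ : Measure X}
    (hρ : DistComparable ρ α c) {s p : ℝ} {q : ℝ≥0∞} (hs : 0 < s) (hsα : s < α) (hp : 0 < p)
    (hq : 0 < q) {ε L : ℝ} (hε : 0 < ε) (hε1 : ε ≤ 1) (hL : 0 ≤ L) :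
    ∃ C : ℝ≥0∞, C ≠ ∞ ∧ ∀ (f : ℕ → X → ℝ) (H : ℕ → X → ℝ≥0∞),
      PieceBounds f H (netRadius ε α) L →
      lqN q (fun k => extZ (fun n => ∫⁻ x, (ENNReal.ofReal (2 ^ (n * s)) * H n x) ^ p ∂μ) k ^ (1 / p))
        ≠ ∞ →
      (∀ᵐ x ∂μ, ∑' n, ENNReal.ofReal |f n x| ≠ ∞) ∧ MemNspq ρ μ univ s p q (seriesVal f) ∧
      NNorm ρ μ univ s p q (seriesVal f) ≤ C *
        lqN q (fun k => extZ (fun n => ∫⁻ x, (ENNReal.ofReal (2 ^ (n * s)) * H n x) ^ p ∂μ) k ^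
          (1 / p)) := by
  have hα := hρ.pos
  have hc : 0 < c := zero_lt_one.trans_le hρ.one_le
  set θ₀ : ℝ := 2 ^ (-min s (α - s)) with hθ₀
  have hθ₀pos : 0 < θ₀ := by positivity
  have hσ : 0 < min s (α - s) := lt_min hs (sub_pos.2 hsα)
  have hθ1 : ENNReal.ofReal θ₀ < 1 := by
    rw [ENNReal.ofReal_lt_one]
    exact Real.rpow_lt_one_of_one_lt_of_neg one_lt_two (neg_lt_zero.2 hσ)
  obtain ⟨η, hη1, hηθ⟩ := exists_sqrt_lt_one hθ1
  have hηp : η ^ p < 1 := ENNReal.rpow_lt_one hη1 hp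
  set K₀ : ℝ := L * (c / ε) with hK₀
  have hcε : 1 ≤ c / ε := by rw [one_le_div hε]; linarith [hρ.one_le]
  have hLK : L ≤ K₀ := le_mul_of_one_le_right hL hcε
  have hK₀nn : 0 ≤ K₀ := hL.trans hLK
  set K : ℝ := 2 ^ s * K₀ with hK
  have h2s : (1 : ℝ) ≤ 2 ^ s := Real.one_le_rpow one_le_two hs.le
  have hK₀K : K₀ ≤ K := le_mul_of_one_le_left hK₀nn h2s
  have hcoef : ENNReal.ofReal K ^ p * geomZ η ^ p ≠ ∞ := ENNReal.mul_ne_top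
    (ENNReal.rpow_ne_top_of_nonneg hp.le ofReal_ne_top)
    (ENNReal.rpow_ne_top_of_nonneg hp.le (geomZ_ne_top hη1))
  obtain ⟨C, hC, hCle⟩ := lqN_geom_le hp hq hcoef hηp
  refine ⟨C + C, by finiteness, fun f H hfH hfin => ?_⟩
  set A : ℕ → X → ℝ≥0∞ := fun n x => ENNReal.ofReal (2 ^ (n * s)) * H n x with hA
  set b : ℤ → ℝ≥0∞ := fun k => extZ (fun n => ∫⁻ x, A n x ^ p ∂μ) k with hb
  have hAm : ∀ n, Measurable (A n) := fun n => (hfH.meas n).const_mul _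
  set g : ℤ → X → ℝ≥0∞ := fun j x =>
    ENNReal.ofReal K * ∑' k : ℤ, ENNReal.ofReal θ₀ ^ (j - k).natAbs * extZ (fun n => A n x) k with hg
  have hextm : ∀ k, Measurable fun x => extZ (fun n => A n x) k := fun k => by
    unfold extZ
    split_ifs
    · exact hAm _
    · exact measurable_const
  have hgm : ∀ j, Measurable (g j) := fun j =>
    (Measurable.tsum fun k => (hextm k).const_mul _).const_mul _
  have hext_int : ∀ k, ∫⁻ x, extZ (fun n => A n x) k ^ p ∂μ = b k := fun k => by
    simp only [hb, extZ]
    split_ifs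
    · rfl
    · simp [hp]
  have hgint : ∀ j, ∫⁻ x, g j x ^ p ∂μ ≤ ENNReal.ofReal K ^ p * geomZ η ^ p *
      ∑' k : ℤ, (η ^ p) ^ (j - k).natAbs * b k := fun j => by
    calc ∫⁻ x, g j x ^ p ∂μ ≤ ∫⁻ x, ENNReal.ofReal K ^ p * (geomZ η ^ p *
          ∑' k : ℤ, (η ^ p) ^ (j - k).natAbs * extZ (fun n => A n x) k ^ p) ∂μ := by
          refine lintegral_mono fun x => ?_
          simp only [hg]
          rw [ENNReal.mul_rpow_of_nonneg _ _ hp.le, ← hηθ]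
          gcongr
          exact tsum_geom_rpow_le η hp _ j
      _ = _ := by
          have hm : ∀ k : ℤ, Measurable fun x => (η ^ p) ^ (j - k).natAbs *
              extZ (fun n => A n x) k ^ p := fun k => ((hextm k).pow_const p).const_mul _
          rw [lintegral_const_mul _ ((Measurable.tsum hm).const_mul _),
            lintegral_const_mul _ (Measurable.tsum hm),
            lintegral_tsum fun k => (hm k).aemeasurable, mul_assoc]
          congr 3
          ext k
          rw [lintegral_const_mul _ ((hextm k).pow_const p), hext_int]
  have hlq := hCle (fun j => ∫⁻ x, g j x ^ p ∂μ) b hgint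
  have hlqtop : C * lqN q (fun k => b k ^ (1 / p)) ≠ ∞ := ENNReal.mul_ne_top hC hfin
  have hgp : ∀ j, (∫⁻ x, g j x ^ p ∂μ) ^ (1 / p) ≤ C * lqN q (fun k => b k ^ (1 / p)) := fun j =>
    (le_lqN hq (fun j => (∫⁻ x, g j x ^ p ∂μ) ^ (1 / p)) j).trans hlq
  have hgfin : ∀ j, ∀ᵐ x ∂μ, g j x ≠ ∞ := fun j => by
    have h1 : ∫⁻ x, g j x ^ p ∂μ ≠ ∞ := fun h => by
      have := hgp j
      rw [h, ENNReal.top_rpow_of_pos (by positivity)] at this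
      exact hlqtop (top_le_iff.1 this)
    filter_upwards [ae_lt_top ((hgm j).pow_const p) h1] with x hx h
    rw [h, ENNReal.top_rpow_of_pos hp] at hx
    exact lt_irrefl _ hx
  have hsumH : ∀ x, ∑' n, ENNReal.ofReal |f n x| ≤ g 0 x := fun x => by
    simp only [hg]
    rw [tsum_extZ, ← ENNReal.tsum_mul_left]
    refine ENNReal.tsum_le_tsum fun n => (hfH.bound n x).trans ?_
    have h1 := rpow_decay (s := s) (α := α) n 0 (by positivity)
    have h2 : (1 : ℝ) ≤ θ₀ ^ (0 - (n : ℤ)).natAbs * 2 ^ ((n : ℝ) * s) := by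
      have h3 : (2 : ℝ) ^ (-((n : ℝ) * s)) * 2 ^ ((n : ℝ) * s) = 1 := by
        rw [← Real.rpow_add two_pos]; simp
      rw [← h3]
      gcongr
      simpa using h1
    have h4 : 1 ≤ ENNReal.ofReal θ₀ ^ (0 - (n : ℤ)).natAbs * ENNReal.ofReal (2 ^ ((n : ℝ) * s)) := by
      rw [← ENNReal.ofReal_pow hθ₀pos.le, ← ENNReal.ofReal_mul (by positivity)]
      exact ENNReal.one_le_ofReal.2 h2
    simp only [hA]
    rw [← mul_assoc (_ ^ _)]
    exact mul_le_mul' (ENNReal.ofReal_le_ofReal (hLK.trans hK₀K)) (le_mul_of_one_le_left zero_le h4)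
  have hsummable : ∀ᵐ x ∂μ, ∑' n, ENNReal.ofReal |f n x| ≠ ∞ := by
    filter_upwards [hgfin 0] with x hx
    exact ne_top_of_le_ne_top hx (hsumH x)
  have hvmeas : AEMeasurable (seriesVal f) μ := by
    refine aemeasurable_of_tendsto_metrizable_ae Filter.atTop
      (f := fun n x => ∑ k ∈ Finset.range (n + 1), f k x) (fun n => ?_) ?_
    · exact (continuous_finsetSum _ fun k _ => hfH.cont k).measurable.aemeasurable
    · filter_upwards [hsummable] with x hx using tendsto_seriesVal hx
  have hvbound : ∀ᵐ x ∂μ, ENNReal.ofReal |seriesVal f x| ≤ g 0 x := by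
    filter_upwards [hsummable] with x hx
    rw [seriesVal_eq_tsum hx]
    exact (ofReal_abs_tsum_le (abs_summable_of_tsum hx)).trans (hsumH x)
  have hlp : lpOn μ univ p (seriesVal f) ≤ C * lqN q (fun k => b k ^ (1 / p)) := by
    rw [lpOn, lpN, Measure.restrict_univ]
    refine le_trans ?_ (hgp 0)
    gcongr ?_ ^ (1 / p)
    refine lintegral_mono_ae ?_
    filter_upwards [hvbound] with x hx
    gcongr
  have hgrad : (fun j x => (g j x).toReal) ∈ fracGrad ρ μ univ s (seriesVal f) := by
    refine ⟨fun _ _ => ENNReal.toReal_nonneg, fun j => (hgm j).ennreal_toReal.aemeasurable,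
      {x | ¬ ∀ j, g j x ≠ ∞}, ae_iff.1 (ae_all_iff.2 hgfin), ?_⟩
    intro j x hx y hy hj1 hj2
    have hgx : ∀ j, g j x ≠ ∞ := not_not.1 hx.2
    have hgy : ∀ j, g j y ≠ ∞ := not_not.1 hy.2
    have hx0 := ne_top_of_le_ne_top (hgx 0) (hsumH x)
    have hy0 := ne_top_of_le_ne_top (hgy 0) (hsumH y)
    have hρ0 : 0 ≤ ρ x y := hρ.nonneg x y
    suffices h : ENNReal.ofReal |seriesVal f x - seriesVal f y| ≤
        ENNReal.ofReal (ρ x y ^ s) * (g j x + g j y) by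
      rw [← ENNReal.ofReal_le_ofReal_iff (by positivity), ENNReal.ofReal_mul (by positivity),
        ENNReal.ofReal_add ENNReal.toReal_nonneg ENNReal.toReal_nonneg,
        ENNReal.ofReal_toReal (hgx j), ENNReal.ofReal_toReal (hgy j)]
      exact h
    have hdist : dist x y ≤ c * 2 ^ (-((j : ℝ) * α)) := by
      refine (hρ.dist_le x y).trans ?_
      gcongr
      calc ρ x y ^ α ≤ ((2 : ℝ) ^ (-j)) ^ α := by gcongr
        _ = _ := by
          rw [← Real.rpow_intCast, ← Real.rpow_mul two_pos.le]
          congr 1; push_cast; ring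
    have hρs : (2 : ℝ) ^ (-((j : ℝ) * s)) ≤ 2 ^ s * ρ x y ^ s := by
      rw [← Real.mul_rpow two_pos.le hρ0]
      calc (2 : ℝ) ^ (-((j : ℝ) * s)) = ((2 : ℝ) ^ (-j)) ^ s := by
            rw [← Real.rpow_intCast, ← Real.rpow_mul two_pos.le]
            congr 1; push_cast; ring
        _ ≤ _ := by
            gcongr
            rw [zpow_sub_one₀ two_ne_zero] at hj1
            linarith
    have hterm : ∀ n : ℕ, ENNReal.ofReal |f n x - f n y| ≤
        ENNReal.ofReal (ρ x y ^ s) * (ENNReal.ofReal K * (ENNReal.ofReal θ₀ ^ (j - n).natAbs * A n x) +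
          ENNReal.ofReal K * (ENNReal.ofReal θ₀ ^ (j - n).natAbs * A n y)) := by
      intro n
      have h1 : ∃ t : ℝ, ENNReal.ofReal |f n x - f n y| ≤ ENNReal.ofReal t * (H n x + H n y) ∧
          t ≤ K₀ * (2 ^ (-((j : ℝ) * s)) * θ₀ ^ (j - n).natAbs) * 2 ^ ((n : ℝ) * s) := by
        have hcancel : (2 : ℝ) ^ (-((n : ℝ) * s)) * 2 ^ ((n : ℝ) * s) = 1 := by
          rw [← Real.rpow_add two_pos]; simp
        rcases le_total j n with hjn | hjn
        · refine ⟨L, ?_, ?_⟩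
          · calc ENNReal.ofReal |f n x - f n y| ≤ ENNReal.ofReal (|f n x| + |f n y|) :=
                  ENNReal.ofReal_le_ofReal (abs_sub _ _)
              _ ≤ _ := by
                  rw [ENNReal.ofReal_add (abs_nonneg _) (abs_nonneg _), mul_add]
                  exact add_le_add (hfH.bound n x) (hfH.bound n y)
          · calc L ≤ K₀ := hLK
              _ = K₀ * 2 ^ (-((n : ℝ) * s)) * 2 ^ ((n : ℝ) * s) := by rw [mul_assoc, hcancel, mul_one]
              _ ≤ _ := by
                exact mul_le_mul_of_nonneg_right (mul_le_mul_of_nonneg_left (rpow_decay n j hjn)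
                  hK₀nn) (by positivity)
        · refine ⟨L * (dist x y / netRadius ε α n), ?_, ?_⟩
          · rw [ENNReal.ofReal_mul hL]
            exact hfH.lip n x y
          · calc L * (dist x y / netRadius ε α n)
                ≤ L * (c * 2 ^ (-((j : ℝ) * α)) / netRadius ε α n) := by
                  have := netRadius_pos hε α n
                  gcongr
              _ = K₀ * (2 ^ (((n : ℝ) - j) * α) * 2 ^ (-((n : ℝ) * s))) * 2 ^ ((n : ℝ) * s) := by
                  rw [mul_assoc K₀, mul_assoc (2 ^ (((n : ℝ) - j) * α)), hcancel, mul_one, hK₀,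
                    netRadius, sub_mul, sub_eq_neg_add, Real.rpow_add two_pos,
                    Real.rpow_neg two_pos.le (n * α)]
                  field_simp
              _ ≤ _ := by
                exact mul_le_mul_of_nonneg_right (mul_le_mul_of_nonneg_left (rpow_decay' n j hjn)
                  hK₀nn) (by positivity)
      obtain ⟨t, ht1, ht2⟩ := h1
      have ht3 : t ≤ ρ x y ^ s * (K * (θ₀ ^ (j - n).natAbs * 2 ^ ((n : ℝ) * s))) := by
        refine ht2.trans ?_
        calc _ ≤ K₀ * (2 ^ s * ρ x y ^ s * θ₀ ^ (j - n).natAbs) * 2 ^ ((n : ℝ) * s) := by gcongr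
          _ = _ := by rw [hK]; ring
      refine ht1.trans ((mul_le_mul_left (ENNReal.ofReal_le_ofReal ht3) _).trans_eq ?_)
      rw [ENNReal.ofReal_mul (p := ρ x y ^ s) (by positivity),
        ENNReal.ofReal_mul (p := K) (hK₀nn.trans hK₀K),
        ENNReal.ofReal_mul (p := θ₀ ^ (j - (n : ℤ)).natAbs) (by positivity),
        ENNReal.ofReal_pow hθ₀pos.le]
      simp only [hA]
      ring
    have hsub : seriesVal f x - seriesVal f y = ∑' n, (f n x - f n y) := by
      rw [seriesVal_eq_tsum hx0, seriesVal_eq_tsum hy0,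
        (summable_of_tsum_ofReal_abs hx0).tsum_sub (summable_of_tsum_ofReal_abs hy0)]
    have habs : Summable fun n => |f n x - f n y| :=
      ((abs_summable_of_tsum hx0).add (abs_summable_of_tsum hy0)).of_nonneg_of_le
        (fun _ => abs_nonneg _) fun n => abs_sub _ _
    rw [hsub]
    refine (ofReal_abs_tsum_le habs).trans ((ENNReal.tsum_le_tsum hterm).trans_eq ?_)
    rw [ENNReal.tsum_mul_left, ENNReal.tsum_add, ENNReal.tsum_mul_left, ENNReal.tsum_mul_left]
    simp only [hg]
    rw [tsum_extZ, tsum_extZ]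
  have hN : NdotNorm ρ μ univ s p q (seriesVal f) ≤ C * lqN q (fun k => b k ^ (1 / p)) := by
    refine (iInf₂_le _ hgrad).trans (le_trans (lqN_mono fun k => ?_) hlq)
    rw [lpN, Measure.restrict_univ]
    gcongr ?_ ^ (1 / p)
    refine lintegral_mono fun x => ?_
    gcongr
    exact ENNReal.ofReal_toReal_le
  refine ⟨hsummable, ⟨by rwa [Measure.restrict_univ], ne_top_of_le_ne_top hlqtop hlp,
    ne_top_of_le_ne_top hlqtop hN⟩, ?_⟩
  rw [NNorm, add_mul]
  exact add_le_add hN hlp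

end Reconstruction

section Averages

variable [PseudoMetricSpace X]

/-- The integral of `R` over the ball of radius `a * r`, relative to the mass of the ball of
radius `r`. -/
def netAvg (μ : Measure X) (Ω : Set X) (a r : ℝ) (R : X → ℝ≥0∞) (z : X) : ℝ≥0∞ :=
  (∫⁻ y in Metric.ball z (a * r) ∩ Ω, R y ∂μ) / μ (Metric.ball z r ∩ Ω)

theorem netAvg_mono_right {μ : Measure X} {Ω : Set X} {a r : ℝ} {R R' : X → ℝ≥0∞} (h : R ≤ R')
    (z : X) : netAvg μ Ω a r R z ≤ netAvg μ Ω a r R' z :=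
  ENNReal.div_le_div_right (lintegral_mono h) _

theorem netAvg_mono_left {μ : Measure X} {Ω : Set X} {a b r : ℝ} (hr : 0 ≤ r) (hab : a ≤ b)
    (R : X → ℝ≥0∞) (z : X) : netAvg μ Ω a r R z ≤ netAvg μ Ω b r R z :=
  ENNReal.div_le_div_right (lintegral_mono_set (inter_subset_inter_left _
    (Metric.ball_subset_ball (by gcongr)))) _

omit [PseudoMetricSpace X] in
theorem le_average_add {μ : Measure X} {A : Set X} (h0 : μ A ≠ 0) (ht : μ A ≠ ∞) {c d : ℝ≥0∞}
    {f : X → ℝ≥0∞} (h : ∀ᵐ x ∂μ.restrict A, c ≤ f x + d) :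
    c ≤ (∫⁻ x in A, f x ∂μ) / μ A + d := by
  have h1 : c * μ A ≤ (∫⁻ x in A, f x ∂μ) + d * μ A := by
    calc c * μ A = ∫⁻ _ in A, c ∂μ := (setLIntegral_const A c).symm
      _ ≤ ∫⁻ x in A, (f x + d) ∂μ := lintegral_mono_ae h
      _ = _ := by rw [lintegral_add_right _ measurable_const, setLIntegral_const]
  calc c = c * μ A / μ A := (ENNReal.mul_div_cancel_right h0 ht).symm
    _ ≤ ((∫⁻ x in A, f x ∂μ) + d * μ A) / μ A := ENNReal.div_le_div_right h1 _
    _ = _ := by rw [ENNReal.add_div, ENNReal.mul_div_cancel_right h0 ht]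

end Averages

section Pieces

variable [PseudoMetricSpace X]

namespace NetSystem

variable {μ : Measure X} {Ω : Set X} {r : ℕ → ℝ} {N : ℕ → Set X} {M : ℕ} {Λ : ℝ≥0∞}

/-- The points of the `n`-th net near `x`. -/
def near (S : NetSystem μ Ω r N M Λ) (n : ℕ) (x : X) : Finset X := (S.overlap n x).choose

theorem isNet (S : NetSystem μ Ω r N M Λ) (n : ℕ) : IsNet (N n) (r n) M (S.near n) where
  pos := S.pos n
  mem_near x := (S.overlap n x).choose_spec.1
  card_le x := (S.overlap n x).choose_spec.2

/-- The `n`-th partition of unity applied to the coefficients `a`. -/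
def smooth (S : NetSystem μ Ω r N M Λ) (n : ℕ) (a : X → ℝ) : X → ℝ :=
  atomSum (S.near n) (netWeight (r n) (S.near n)) a

/-- The differences of consecutive approximations with coefficients `m`. -/
def piece (S : NetSystem μ Ω r N M Λ) (m : ℕ → X → ℝ) : ℕ → X → ℝ
  | 0 => S.smooth 0 (m 0)
  | n + 1 => atomSum (fun x => S.near n x ×ˢ S.near (n + 1) x)
      (fun z x => netWeight (r n) (S.near n) z.1 x * netWeight (r (n + 1)) (S.near (n + 1)) z.2 x)
      fun z => m (n + 1) z.2 - m n z.1

/-- The sizes of the pieces. -/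
def pieceSize (_ : NetSystem μ Ω r N M Λ) (m : ℕ → X → ℝ) : ℕ → X → ℝ≥0∞
  | 0 => atomSize (N 0) (fun z => Metric.ball z (2 * r 0)) (m 0)
  | n + 1 => atomSize (N n ×ˢ N (n + 1))
      (fun z : X × X => Metric.ball z.1 (2 * r n) ∩ Metric.ball z.2 (2 * r (n + 1)))
      fun z => m (n + 1) z.2 - m n z.1

theorem pieceBounds [OpensMeasurableSpace X] (S : NetSystem μ Ω r N M Λ) (m : ℕ → X → ℝ) :
    PieceBounds (S.piece m) (S.pieceSize m) r (4 * (1 + 2 * M)) where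
  cont
    | 0 => (S.isNet 0).atomFamily.continuous_atomSum _
    | n + 1 => ((S.isNet n).atomFamily_prod (S.isNet (n + 1))
        (S.anti n.le_succ)).continuous_atomSum _
  meas
    | 0 => AtomFamily.measurable_atomSize (U := fun z => Metric.ball z (2 * r 0)) (S.countable 0)
        (fun _ => measurableSet_ball) _
    | n + 1 => AtomFamily.measurable_atomSize
        (U := fun z : X × X => Metric.ball z.1 (2 * r n) ∩ Metric.ball z.2 (2 * r (n + 1)))
        ((S.countable n).prod (S.countable (n + 1)))
        (fun _ => measurableSet_ball.inter measurableSet_ball) fun z => m (n + 1) z.2 - m n z.1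
  bound
    | 0 => (S.isNet 0).atomFamily.ofReal_abs_atomSum_le _
    | n + 1 => ((S.isNet n).atomFamily_prod (S.isNet (n + 1))
        (S.anti n.le_succ)).ofReal_abs_atomSum_le _
  lip
    | 0 => (S.isNet 0).atomFamily.ofReal_abs_atomSum_sub_le _
    | n + 1 => ((S.isNet n).atomFamily_prod (S.isNet (n + 1))
        (S.anti n.le_succ)).ofReal_abs_atomSum_sub_le _

theorem sum_piece (S : NetSystem μ Ω r N M Λ) (m : ℕ → X → ℝ) (n : ℕ) {x : X} (hx : x ∈ Ω) :
    ∑ k ∈ Finset.range (n + 1), S.piece m k x = S.smooth n (m n) x := by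
  induction n with
  | zero => simp [piece]
  | succ n ih =>
    rw [Finset.sum_range_succ, ih]
    have h1 := (S.isNet n).sum_netWeight (S.cover n x hx)
    have h2 := (S.isNet (n + 1)).sum_netWeight (S.cover (n + 1) x hx)
    have e : S.piece m (n + 1) x = S.smooth (n + 1) (m (n + 1)) x - S.smooth n (m n) x := by
      simp only [piece, smooth, atomSum, mul_sub, Finset.sum_sub_distrib, Finset.sum_product]
      congr 1
      · simp_rw [mul_assoc, ← Finset.mul_sum]
        rw [← Finset.sum_mul, h1, one_mul]
      · refine Finset.sum_congr rfl fun z _ => ?_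
        simp_rw [mul_right_comm _ _ (m n z)]
        rw [← Finset.mul_sum, h2, mul_one]
    rw [e]; ring

theorem piece_add (S : NetSystem μ Ω r N M Λ) (m m' : ℕ → X → ℝ) (n : ℕ) (x : X) :
    S.piece (fun n z => m n z + m' n z) n x = S.piece m n x + S.piece m' n x := by
  cases n <;>
  · simp only [piece, smooth, atomSum, ← Finset.sum_add_distrib]
    exact Finset.sum_congr rfl fun _ _ => by ring

theorem piece_mul (S : NetSystem μ Ω r N M Λ) (t : ℝ) (m : ℕ → X → ℝ) (n : ℕ) (x : X) :
    S.piece (fun n z => t * m n z) n x = t * S.piece m n x := by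
  cases n <;>
  · simp only [piece, smooth, atomSum, Finset.mul_sum]
    exact Finset.sum_congr rfl fun _ _ => by ring

/-- The superposition of the averages of `R` over the balls of the `n`-th net. -/
def avgSum (_ : NetSystem μ Ω r N M Λ) (a : ℝ) (n : ℕ) (R : X → ℝ≥0∞) (x : X) : ℝ≥0∞ :=
  ∑' z : N n, (Metric.ball (z : X) (2 * r n)).indicator (fun _ => netAvg μ Ω a (r n) R z) x

theorem avgSum_eq (S : NetSystem μ Ω r N M Λ) (a : ℝ) (n : ℕ) (R : X → ℝ≥0∞) (x : X) :
    S.avgSum a n R x =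
      ∑ z ∈ S.near n x, (Metric.ball z (2 * r n)).indicator (fun _ => netAvg μ Ω a (r n) R z) x := by
  rw [avgSum, tsum_subtype (N n) fun z =>
    (Metric.ball z (2 * r n)).indicator (fun _ => netAvg μ Ω a (r n) R z) x,
    tsum_eq_sum (s := S.near n x)]
  · exact Finset.sum_congr rfl fun z hz => indicator_of_mem (((S.isNet n).mem_near x z).1 hz).1 _
  · intro z hz
    by_cases hI : z ∈ N n
    · rw [indicator_of_mem hI, indicator_of_notMem]
      intro hx
      refine hz (((S.isNet n).mem_near x z).2 ⟨hI, ?_⟩)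
      rw [Metric.mem_ball, dist_comm] at hx
      linarith [S.pos n]
    · rw [indicator_of_notMem hI]

theorem measurable_avgSum [OpensMeasurableSpace X] (S : NetSystem μ Ω r N M Λ) (a : ℝ) (n : ℕ)
    (R : X → ℝ≥0∞) : Measurable (S.avgSum a n R) := by
  have := (S.countable n).to_subtype
  exact Measurable.tsum fun i => measurable_const.indicator measurableSet_ball

theorem lintegral_avgSum_le [OpensMeasurableSpace X] (S : NetSystem μ Ω r N M Λ) {a : ℝ}
    (ha : a ≤ 8) (n : ℕ) {R : X → ℝ≥0∞}
    (hR : AEMeasurable R (μ.restrict Ω)) :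
    ∫⁻ x, S.avgSum a n R x ∂μ ≤ (M : ℝ≥0∞) * M * ∫⁻ x in Ω, R x ∂μ := by
  have := (S.countable n).to_subtype
  unfold avgSum
  rw [lintegral_tsum fun i => (measurable_const.indicator measurableSet_ball).aemeasurable]
  have h1 : ∀ z : N n, ∫⁻ x, (Metric.ball (z : X) (2 * r n)).indicator
      (fun _ => netAvg μ Ω a (r n) R z) x ∂μ ≤
      M * ∫⁻ x in Ω, (Metric.ball (z : X) (8 * r n)).indicator R x ∂μ := fun z => by
    rw [lintegral_indicator_const measurableSet_ball]
    have hd := S.dens n z z.2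
    have hp := S.pos n
    calc netAvg μ Ω a (r n) R z * μ (Metric.ball (z : X) (2 * r n))
        ≤ netAvg μ Ω 8 (r n) R z * (M * μ (Metric.ball (z : X) (r n) ∩ Ω)) := by
          refine mul_le_mul' (netAvg_mono_left hp.le ha R z) (le_trans (measure_mono ?_) hd)
          exact Metric.ball_subset_ball (by linarith)
      _ = M * ∫⁻ x in Metric.ball (z : X) (8 * r n) ∩ Ω, R x ∂μ := by
          rw [netAvg, mul_left_comm, ENNReal.div_mul_cancel (S.dens_pos n z z.2).ne']
          exact ((measure_mono (inter_subset_left.trans (Metric.ball_subset_ball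
            (by linarith)))).trans_lt (S.lt_top n z z.2)).ne
      _ = _ := by
          rw [lintegral_indicator measurableSet_ball, Measure.restrict_restrict measurableSet_ball]
  refine (ENNReal.tsum_le_tsum h1).trans ?_
  rw [ENNReal.tsum_mul_left, mul_assoc]
  gcongr
  rw [← lintegral_tsum fun z => hR.indicator measurableSet_ball, ← lintegral_const_mul'' _ hR]
  refine lintegral_mono fun x => ?_
  rw [tsum_subtype (N n) fun z => (Metric.ball z (8 * r n)).indicator R x,
    tsum_eq_sum (s := S.near n x)]
  · calc _ ≤ ∑ z ∈ S.near n x, R x := Finset.sum_le_sum fun z _ =>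
          (indicator_le_self _ _ z).trans (indicator_le_self _ _ x)
      _ = (S.near n x).card * R x := by rw [Finset.sum_const, nsmul_eq_mul]
      _ ≤ M * R x := by
          gcongr
          exact (S.isNet n).card_le x
  · intro z hz
    by_cases hI : z ∈ N n
    · rw [indicator_of_mem hI, indicator_of_notMem]
      intro hx
      refine hz (((S.isNet n).mem_near x z).2 ⟨hI, ?_⟩)
      rwa [Metric.mem_ball, dist_comm] at hx
    · rw [indicator_of_notMem hI]

end NetSystem

end Pieces

section Approximation

variable [PseudoMetricSpace X]

namespace NetSystem

variable {μ : Measure X} {Ω : Set X} {r : ℕ → ℝ} {N : ℕ → Set X} {M : ℕ} {Λ : ℝ≥0∞}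

/-- The coefficients `m` approximate `u` on `Ω`, the error being controlled by `R`. -/
structure Approximates (S : NetSystem μ Ω r N M Λ) (p a : ℝ) (C : ℝ≥0∞) (m : ℕ → X → ℝ)
    (u : X → ℝ) (R : ℕ → X → ℝ≥0∞) : Prop where
  meas : ∀ n, Measurable (R n)
  anti : Antitone R
  bound : ∀ n, ∀ z ∈ N n, ∀ᵐ x ∂μ.restrict Ω, x ∈ Metric.ball z (8 * r n) →
    ENNReal.ofReal |m n z - u x| ^ p ≤ C * (R n x + netAvg μ Ω a (r n) (R n) z)

theorem ofReal_abs_sub_rpow_le {p : ℝ} (hp : 0 ≤ p) (x y z : ℝ) :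
    ENNReal.ofReal |x - y| ^ p ≤
      2 ^ p * (ENNReal.ofReal |x - z| ^ p + ENNReal.ofReal |y - z| ^ p) := by
  refine le_trans ?_ (add_rpow_le_two_rpow_mul _ _ hp)
  rw [← ENNReal.ofReal_add (abs_nonneg _) (abs_nonneg _)]
  gcongr
  rw [abs_sub_comm y z]
  exact abs_sub_le x z y

theorem dens_lt_top (S : NetSystem μ Ω r N M Λ) {n : ℕ} {z : X} (hz : z ∈ N n) :
    μ (Metric.ball z (r n) ∩ Ω) < ∞ :=
  (measure_mono (inter_subset_left.trans (Metric.ball_subset_ball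
    (by linarith [S.pos n])))).trans_lt (S.lt_top n z hz)

theorem setLIntegral_div_le_netAvg (S : NetSystem μ Ω r N M Λ) {a : ℝ} (ha : 1 ≤ a) (n : ℕ)
    (R : X → ℝ≥0∞) (z : X) :
    (∫⁻ x in Metric.ball z (r n) ∩ Ω, R x ∂μ) / μ (Metric.ball z (r n) ∩ Ω) ≤
      netAvg μ Ω a (r n) R z := by
  refine ENNReal.div_le_div_right (lintegral_mono_set (inter_subset_inter_left _
    (Metric.ball_subset_ball ?_))) _
  nlinarith [S.pos n]

theorem ofReal_abs_smooth_sub_le (S : NetSystem μ Ω r N M Λ) (n : ℕ) (b : X → ℝ) {x : X}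
    (hx : x ∈ Ω) (t : ℝ) :
    ENNReal.ofReal |S.smooth n b x - t| ≤ 2 * ∑ z ∈ S.near n x,
      (Metric.ball z (2 * r n)).indicator (fun _ => ENNReal.ofReal |b z - t|) x := by
  have h1 : S.smooth n b x - t =
      ∑ z ∈ S.near n x, netWeight (r n) (S.near n) z x * (b z - t) := by
    simp only [mul_sub, Finset.sum_sub_distrib, ← Finset.sum_mul,
      (S.isNet n).sum_netWeight (S.cover n x hx), one_mul]
    rfl
  rw [h1, Finset.mul_sum]
  refine (ENNReal.ofReal_le_ofReal (Finset.abs_sum_le_sum_abs _ _)).trans ?_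
  rw [ENNReal.ofReal_sum_of_nonneg fun _ _ => abs_nonneg _]
  refine Finset.sum_le_sum fun z _ => ?_
  by_cases hz : x ∈ Metric.ball z (2 * r n)
  · rw [indicator_of_mem hz, abs_mul, abs_of_nonneg (IsNet.netWeight_nonneg _ _),
      ENNReal.ofReal_mul (IsNet.netWeight_nonneg _ _)]
    gcongr
    rw [← ENNReal.ofReal_ofNat]
    exact ENNReal.ofReal_le_ofReal ((S.isNet n).netWeight_le_two z x)
  · rw [(S.isNet n).netWeight_eq_zero hz]
    simp

namespace Approximates

variable {S : NetSystem μ Ω r N M Λ} {p a : ℝ} {C : ℝ≥0∞} {m : ℕ → X → ℝ} {u : X → ℝ}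
  {R : ℕ → X → ℝ≥0∞}

theorem diff_le (h : S.Approximates p a C m u R) (hΩ : MeasurableSet Ω) [OpensMeasurableSpace X]
    (hp : 0 < p) (ha : 1 ≤ a) {n k : ℕ} (hnk : n ≤ k) {z z' : X} (hz : z ∈ N n) (hz' : z' ∈ N k)
    (hzz : dist z z' < 4 * r n) :
    ENNReal.ofReal |m k z' - m n z| ^ p ≤
      2 ^ p * (3 * C) * (netAvg μ Ω a (r n) (R n) z + netAvg μ Ω a (r k) (R n) z') := by
  set A := Metric.ball z' (r k) ∩ Ω with hA
  have hAm : MeasurableSet A := measurableSet_ball.inter hΩ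
  have hrk := S.anti hnk
  have hae : ∀ᵐ x ∂μ.restrict A, ENNReal.ofReal |m k z' - m n z| ^ p ≤
      2 ^ p * (2 * C) * R n x +
        2 ^ p * C * (netAvg μ Ω a (r n) (R n) z + netAvg μ Ω a (r k) (R n) z') := by
    have hle : μ.restrict A ≤ μ.restrict Ω := Measure.restrict_mono_set μ inter_subset_right
    filter_upwards [ae_mono hle (h.bound n z hz), ae_mono hle (h.bound k z' hz'),
      ae_restrict_mem hAm] with x h1 h2 hxA
    have hxd : dist x z' < r k := hxA.1
    have hx1 := h1 (by
      rw [Metric.mem_ball]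
      have := dist_triangle_right x z z'
      linarith [S.pos n])
    have hx2 := h2 (by rw [Metric.mem_ball]; linarith [S.pos k])
    calc _ ≤ 2 ^ p * (ENNReal.ofReal |m k z' - u x| ^ p + ENNReal.ofReal |m n z - u x| ^ p) :=
          ofReal_abs_sub_rpow_le hp.le _ _ _
      _ ≤ 2 ^ p * (C * (R n x + netAvg μ Ω a (r k) (R n) z') +
            C * (R n x + netAvg μ Ω a (r n) (R n) z)) := by
          gcongr 2 ^ p * (?_ + ?_)
          exact hx2.trans (mul_le_mul' le_rfl (add_le_add (h.anti hnk x)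
            (netAvg_mono_right (h.anti hnk) z')))
      _ = _ := by ring
  have hkey := le_average_add (S.dens_pos k z' hz').ne' (S.dens_lt_top hz').ne hae
  refine hkey.trans ?_
  rw [lintegral_const_mul _ (h.meas n), mul_div_assoc]
  have hav := S.setLIntegral_div_le_netAvg ha k (R n) z'
  calc _ ≤ 2 ^ p * (2 * C) * (netAvg μ Ω a (r n) (R n) z + netAvg μ Ω a (r k) (R n) z') +
        2 ^ p * C * (netAvg μ Ω a (r n) (R n) z + netAvg μ Ω a (r k) (R n) z') := by
        gcongr
        exact hav.trans le_add_self
    _ = _ := by ring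

theorem pieceSize_succ_le (h : S.Approximates p a C m u R) (hΩ : MeasurableSet Ω)
    [OpensMeasurableSpace X] (hp : 0 < p) (ha : 1 ≤ a) (n : ℕ) (x : X) :
    S.pieceSize m (n + 1) x ^ p ≤ ((M * M : ℕ) : ℝ≥0∞) ^ p * (2 ^ p * (3 * C)) * M *
      (S.avgSum a n (R n) x + S.avgSum a (n + 1) (R n) x) := by
  have hr := S.anti n.le_succ
  have hcard1 := (S.isNet n).card_le x
  have hcard2 := (S.isNet (n + 1)).card_le x
  rw [pieceSize, ((S.isNet n).atomFamily_prod (S.isNet (n + 1)) hr).atomSize_eq]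
  refine (sum_rpow_le_card _ _ (M := M * M) ?_ hp).trans ?_
  · rw [Finset.card_product]
    exact Nat.mul_le_mul hcard1 hcard2
  rw [S.avgSum_eq, S.avgSum_eq, mul_assoc (_ ^ p), mul_assoc (_ ^ p)]
  refine mul_le_mul_right ?_ _
  calc _ ≤ ∑ z ∈ S.near n x ×ˢ S.near (n + 1) x, 2 ^ p * (3 * C) *
        ((Metric.ball z.1 (2 * r n)).indicator (fun _ => netAvg μ Ω a (r n) (R n) z.1) x +
          (Metric.ball z.2 (2 * r (n + 1))).indicator
            (fun _ => netAvg μ Ω a (r (n + 1)) (R n) z.2) x) := by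
        refine Finset.sum_le_sum (fun z hz => ?_ : ∀ z ∈ S.near n x ×ˢ S.near (n + 1) x, _ ≤ _)
        by_cases hx : x ∈ Metric.ball z.1 (2 * r n) ∩ Metric.ball z.2 (2 * r (n + 1))
        · rw [indicator_of_mem hx, indicator_of_mem hx.1, indicator_of_mem hx.2]
          have hz' := Finset.mem_product.1 hz
          refine h.diff_le hΩ hp ha n.le_succ (((S.isNet n).mem_near x _).1 hz'.1).1
            (((S.isNet (n + 1)).mem_near x _).1 hz'.2).1 ?_
          have h1 : dist x z.1 < 2 * r n := hx.1
          have h2 : dist x z.2 < 2 * r (n + 1) := hx.2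
          have := dist_triangle_left z.1 z.2 x
          have h3 : r (n + 1) ≤ r n := hr
          linarith
        · rw [indicator_of_notMem hx, ENNReal.zero_rpow_of_pos hp]
          exact zero_le
    _ = 2 ^ p * (3 * C) * ((S.near (n + 1) x).card * (∑ z ∈ S.near n x,
          (Metric.ball z (2 * r n)).indicator (fun _ => netAvg μ Ω a (r n) (R n) z) x) +
        (S.near n x).card * (∑ z ∈ S.near (n + 1) x, (Metric.ball z (2 * r (n + 1))).indicator
            (fun _ => netAvg μ Ω a (r (n + 1)) (R n) z) x)) := by
        rw [← Finset.mul_sum, Finset.sum_add_distrib, Finset.sum_product, Finset.sum_product]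
        congr 2
        · simp only [Finset.sum_const, nsmul_eq_mul, Finset.mul_sum]
        · simp only [Finset.sum_const, nsmul_eq_mul]
    _ ≤ 2 ^ p * (3 * C) * (M * (∑ z ∈ S.near n x,
          (Metric.ball z (2 * r n)).indicator (fun _ => netAvg μ Ω a (r n) (R n) z) x) +
        M * (∑ z ∈ S.near (n + 1) x, (Metric.ball z (2 * r (n + 1))).indicator
            (fun _ => netAvg μ Ω a (r (n + 1)) (R n) z) x)) := by
        gcongr
    _ = _ := by ring

theorem pieceSize_zero_le (h : S.Approximates p a C m u R) (hΩ : MeasurableSet Ω)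
    [OpensMeasurableSpace X] (hC : C ≠ ∞) (hp : 0 < p) (ha : 1 ≤ a) (x : X) :
    S.pieceSize m 0 x ^ p ≤ (M : ℝ≥0∞) ^ p * (2 ^ p * (2 * C + 1)) *
      S.avgSum a 0 (fun x => R 0 x + ENNReal.ofReal |u x| ^ p) x := by
  rw [pieceSize, (S.isNet 0).atomFamily.atomSize_eq]
  refine (sum_rpow_le_card _ _ ((S.isNet 0).card_le x) hp).trans ?_
  rw [S.avgSum_eq, mul_assoc]
  refine mul_le_mul_right ?_ _
  rw [Finset.mul_sum]
  refine Finset.sum_le_sum fun z hz => ?_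
  by_cases hx : x ∈ Metric.ball z (2 * r 0)
  swap
  · rw [indicator_of_notMem hx, ENNReal.zero_rpow_of_pos hp]
    exact zero_le
  rw [indicator_of_mem hx, indicator_of_mem hx]
  have hz : z ∈ N 0 := (((S.isNet 0).mem_near x z).1 hz).1
  set A := Metric.ball z (r 0) ∩ Ω with hA
  have hae : ∀ᵐ x ∂μ.restrict A, ENNReal.ofReal |m 0 z| ^ p ≤
      2 ^ p * (C + 1) * (R 0 x + ENNReal.ofReal |u x| ^ p) +
        2 ^ p * C * netAvg μ Ω a (r 0) (R 0) z := by
    have hle : μ.restrict A ≤ μ.restrict Ω := Measure.restrict_mono_set μ inter_subset_right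
    filter_upwards [ae_mono hle (h.bound 0 z hz),
      ae_restrict_mem (measurableSet_ball.inter hΩ)] with y h1 hyA
    have hyd : dist y z < r 0 := hyA.1
    have hy := h1 (by rw [Metric.mem_ball]; linarith [S.pos 0])
    calc ENNReal.ofReal |m 0 z| ^ p = ENNReal.ofReal |m 0 z - 0| ^ p := by rw [sub_zero]
      _ ≤ 2 ^ p * (ENNReal.ofReal |m 0 z - u y| ^ p + ENNReal.ofReal |0 - u y| ^ p) :=
          ofReal_abs_sub_rpow_le hp.le _ _ _
      _ ≤ 2 ^ p * (C * (R 0 y + netAvg μ Ω a (r 0) (R 0) z) + ENNReal.ofReal |u y| ^ p) := by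
          rw [zero_sub, abs_neg]
          gcongr
      _ ≤ 2 ^ p * (C * (R 0 y + netAvg μ Ω a (r 0) (R 0) z) + ENNReal.ofReal |u y| ^ p) +
          2 ^ p * (R 0 y + C * ENNReal.ofReal |u y| ^ p) := le_self_add
      _ = _ := by ring
  have hkey := le_average_add (S.dens_pos 0 z hz).ne' (S.dens_lt_top hz).ne hae
  refine hkey.trans ?_
  rw [lintegral_const_mul' _ _ (by finiteness), mul_div_assoc]
  have hav := S.setLIntegral_div_le_netAvg ha 0 (fun x => R 0 x + ENNReal.ofReal |u x| ^ p) z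
  calc _ ≤ 2 ^ p * (C + 1) * netAvg μ Ω a (r 0) (fun x => R 0 x + ENNReal.ofReal |u x| ^ p) z +
        2 ^ p * C * netAvg μ Ω a (r 0) (fun x => R 0 x + ENNReal.ofReal |u x| ^ p) z := by
        exact add_le_add (mul_le_mul_right hav _)
          (mul_le_mul_right (netAvg_mono_right (fun x => le_self_add) z) _)
    _ = _ := by ring

theorem smooth_sub_le (h : S.Approximates p a C m u R) (hΩ : MeasurableSet Ω)
    [OpensMeasurableSpace X] (hp : 0 < p) (n : ℕ) :
    ∀ᵐ x ∂μ.restrict Ω, ENNReal.ofReal |S.smooth n (m n) x - u x| ^ p ≤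
      2 ^ p * (M : ℝ≥0∞) ^ p * C * (M + 1) * (R n x + S.avgSum a n (R n) x) := by
  filter_upwards [(ae_ball_iff (S.countable n)).2 (h.bound n), ae_restrict_mem hΩ] with x hx hxΩ
  calc _ ≤ (2 * ∑ z ∈ S.near n x,
        (Metric.ball z (2 * r n)).indicator (fun _ => ENNReal.ofReal |m n z - u x|) x) ^ p := by
        gcongr
        exact S.ofReal_abs_smooth_sub_le n _ hxΩ _
    _ ≤ 2 ^ p * ((M : ℝ≥0∞) ^ p * ∑ z ∈ S.near n x, (Metric.ball z (2 * r n)).indicator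
          (fun _ => ENNReal.ofReal |m n z - u x|) x ^ p) := by
        rw [ENNReal.mul_rpow_of_nonneg _ _ hp.le]
        gcongr
        exact sum_rpow_le_card _ _ ((S.isNet n).card_le x) hp
    _ ≤ 2 ^ p * ((M : ℝ≥0∞) ^ p * ∑ z ∈ S.near n x, C * (R n x +
          (Metric.ball z (2 * r n)).indicator (fun _ => netAvg μ Ω a (r n) (R n) z) x)) := by
        gcongr with z hz
        by_cases hxz : x ∈ Metric.ball z (2 * r n)
        · rw [indicator_of_mem hxz, indicator_of_mem hxz]
          exact hx z (((S.isNet n).mem_near x z).1 hz).1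
            (Metric.ball_subset_ball (by linarith [S.pos n]) hxz)
        · rw [indicator_of_notMem hxz, ENNReal.zero_rpow_of_pos hp]
          exact zero_le
    _ = 2 ^ p * ((M : ℝ≥0∞) ^ p * (C * ((S.near n x).card * R n x + S.avgSum a n (R n) x))) := by
        rw [← Finset.mul_sum, Finset.sum_add_distrib, S.avgSum_eq, Finset.sum_const, nsmul_eq_mul]
    _ ≤ 2 ^ p * ((M : ℝ≥0∞) ^ p * (C * ((M + 1) * R n x + (M + 1) * S.avgSum a n (R n) x))) := by
        gcongr
        · exact_mod_cast ((S.isNet n).card_le x).trans M.le_succ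
        · exact le_mul_of_one_le_left zero_le le_add_self
    _ = _ := by ring

end Approximates

end NetSystem

end Approximation

section ExtensionOfApproximations

variable [PseudoMetricSpace X] [OpensMeasurableSpace X]

namespace NetSystem.Approximates

variable {μ : Measure X} {Ω : Set X} {r : ℕ → ℝ} {N : ℕ → Set X} {M : ℕ} {Λ : ℝ≥0∞}
  {S : NetSystem μ Ω r N M Λ} {p a : ℝ} {C : ℝ≥0∞} {m : ℕ → X → ℝ} {u : X → ℝ}
  {R : ℕ → X → ℝ≥0∞}

theorem lintegral_pieceSize_succ_le (h : S.Approximates p a C m u R) (hΩ : MeasurableSet Ω)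
    (hp : 0 < p) (ha : 1 ≤ a) (ha' : a ≤ 8) (n : ℕ) :
    ∫⁻ x, S.pieceSize m (n + 1) x ^ p ∂μ ≤
      ((M * M : ℕ) : ℝ≥0∞) ^ p * (2 ^ p * (3 * C)) * M * (2 * (M * M)) * ∫⁻ x in Ω, R n x ∂μ := by
  refine (lintegral_mono (h.pieceSize_succ_le hΩ hp ha n)).trans ?_
  have hm : Measurable fun x => S.avgSum a n (R n) x + S.avgSum a (n + 1) (R n) x :=
    (S.measurable_avgSum _ _ _).add (S.measurable_avgSum _ _ _)
  rw [lintegral_const_mul _ hm, lintegral_add_left (S.measurable_avgSum _ _ _), mul_assoc _ (2 * _)]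
  refine mul_le_mul_right ?_ _
  calc _ ≤ (M : ℝ≥0∞) * M * ∫⁻ x in Ω, R n x ∂μ + (M : ℝ≥0∞) * M * ∫⁻ x in Ω, R n x ∂μ :=
        add_le_add (S.lintegral_avgSum_le ha' n (h.meas n).aemeasurable)
          (S.lintegral_avgSum_le ha' (n + 1) (h.meas n).aemeasurable)
    _ = _ := by ring

theorem lintegral_pieceSize_zero_le (h : S.Approximates p a C m u R) (hΩ : MeasurableSet Ω)
    (hu : AEMeasurable u (μ.restrict Ω)) (hC : C ≠ ∞) (hp : 0 < p) (ha : 1 ≤ a) (ha' : a ≤ 8) :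
    ∫⁻ x, S.pieceSize m 0 x ^ p ∂μ ≤ (M : ℝ≥0∞) ^ p * (2 ^ p * (2 * C + 1)) * (M * M) *
      (∫⁻ x in Ω, R 0 x ∂μ + ∫⁻ x in Ω, ENNReal.ofReal |u x| ^ p ∂μ) := by
  refine (lintegral_mono (h.pieceSize_zero_le hΩ hC hp ha)).trans ?_
  rw [lintegral_const_mul _ (S.measurable_avgSum _ _ _), mul_assoc _ ((M : ℝ≥0∞) * M)]
  refine mul_le_mul_right ?_ _
  rw [← lintegral_add_left (h.meas 0)]
  have hum : AEMeasurable (fun x => ENNReal.ofReal |u x| ^ p) (μ.restrict Ω) :=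
    (hu.abs.ennreal_ofReal).pow_const p
  exact S.lintegral_avgSum_le ha' 0 ((h.meas 0).aemeasurable.add hum)

theorem tendsto_smooth (h : S.Approximates p a C m u R) (hΩ : MeasurableSet Ω) (hC : C ≠ ∞)
    (hp : 0 < p) (ha' : a ≤ 8) (hR : ∑' n, ∫⁻ x in Ω, R n x ∂μ ≠ ∞) :
    ∀ᵐ x ∂μ.restrict Ω, Filter.Tendsto (fun n => S.smooth n (m n) x) Filter.atTop (nhds (u x)) := by
  set K : ℝ≥0∞ := 2 ^ p * (M : ℝ≥0∞) ^ p * C * (M + 1) with hK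
  have hKt : K ≠ ∞ := by finiteness
  have hm : ∀ n, Measurable fun x => R n x + S.avgSum a n (R n) x := fun n =>
    (h.meas n).add (S.measurable_avgSum _ _ _)
  have hint : ∫⁻ x in Ω, ∑' n, (R n x + S.avgSum a n (R n) x) ∂μ ≠ ∞ := by
    rw [lintegral_tsum fun n => (hm n).aemeasurable]
    refine ne_top_of_le_ne_top (b := (1 + (M : ℝ≥0∞) * M) * ∑' n, ∫⁻ x in Ω, R n x ∂μ)
      (ENNReal.mul_ne_top (by finiteness) hR) ?_
    rw [← ENNReal.tsum_mul_left]
    refine ENNReal.tsum_le_tsum fun n => ?_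
    rw [lintegral_add_left (h.meas n), add_mul, one_mul]
    gcongr
    exact (setLIntegral_le_lintegral Ω _).trans
      (S.lintegral_avgSum_le ha' n (h.meas n).aemeasurable)
  filter_upwards [ae_lt_top (Measurable.tsum hm) hint, ae_all_iff.2 fun n => h.smooth_sub_le hΩ hp n]
    with x hx hxn
  have h1 : ∑' n, ENNReal.ofReal |S.smooth n (m n) x - u x| ^ p ≠ ∞ := by
    refine ne_top_of_le_ne_top (ENNReal.mul_ne_top hKt hx.ne) ?_
    rw [← ENNReal.tsum_mul_left]
    exact ENNReal.tsum_le_tsum hxn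
  have h2 := ENNReal.tendsto_atTop_zero_of_tsum_ne_top h1
  have h3 := ((ENNReal.continuous_rpow_const (y := 1 / p)).tendsto 0).comp h2
  rw [ENNReal.zero_rpow_of_pos (by positivity)] at h3
  have h4 : (fun x => x ^ (1 / p)) ∘ (fun n => ENNReal.ofReal |S.smooth n (m n) x - u x| ^ p) =
      fun n => ENNReal.ofReal |S.smooth n (m n) x - u x| := by
    ext n
    simp only [Function.comp]
    rw [← ENNReal.rpow_mul, mul_one_div_cancel hp.ne', ENNReal.rpow_one]
  rw [h4] at h3
  have h5 := (ENNReal.tendsto_toReal zero_ne_top).comp h3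
  rw [tendsto_iff_norm_sub_tendsto_zero]
  refine h5.congr fun n => ?_
  simp [Function.comp, ENNReal.toReal_ofReal (abs_nonneg _)]

end NetSystem.Approximates

omit [PseudoMetricSpace X] [OpensMeasurableSpace X] in
/-- The Besov size of a sequence of functions on `Ω`. -/
def scaleNorm (μ : Measure X) (Ω : Set X) (s p : ℝ) (q : ℝ≥0∞) (R : ℕ → X → ℝ≥0∞) : ℝ≥0∞ :=
  lqN q fun k => extZ (fun n => ENNReal.ofReal (2 ^ (n * s)) ^ p * ∫⁻ x in Ω, R n x ∂μ) k ^ (1 / p)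

omit [PseudoMetricSpace X] [OpensMeasurableSpace X] in
theorem tsum_lintegral_ne_top {μ : Measure X} {Ω : Set X} {s p : ℝ} {q : ℝ≥0∞} (hs : 0 < s)
    (hp : 0 < p) (hq : 0 < q) {R : ℕ → X → ℝ≥0∞} (h : scaleNorm μ Ω s p q R ≠ ∞) :
    ∑' n, ∫⁻ x in Ω, R n x ∂μ ≠ ∞ := by
  set T := scaleNorm μ Ω s p q R with hT
  set θ : ℝ≥0∞ := ENNReal.ofReal (2 ^ (-s)) ^ p with hθ
  have hθ1 : θ < 1 := by
    refine ENNReal.rpow_lt_one ?_ hp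
    rw [ENNReal.ofReal_lt_one]
    exact Real.rpow_lt_one_of_one_lt_of_neg one_lt_two (neg_lt_zero.2 hs)
  refine ne_top_of_le_ne_top (b := ∑' n : ℕ, θ ^ n * T ^ p) ?_ (ENNReal.tsum_le_tsum fun n => ?_)
  · rw [ENNReal.tsum_mul_right, ENNReal.tsum_geometric]
    refine ENNReal.mul_ne_top (ENNReal.inv_ne_top.2 (tsub_pos_of_lt hθ1).ne') ?_
    exact ENNReal.rpow_ne_top_of_nonneg hp.le h
  · have h1 : (ENNReal.ofReal (2 ^ (n * s)) ^ p * ∫⁻ x in Ω, R n x ∂μ) ^ (1 / p) ≤ T := by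
      have h1 := le_lqN hq (fun k => extZ (fun n => ENNReal.ofReal (2 ^ (n * s)) ^ p *
        ∫⁻ x in Ω, R n x ∂μ) k ^ (1 / p)) n
      simp only [extZ_natCast] at h1
      exact h1
    have h2 : ENNReal.ofReal (2 ^ (n * s)) ^ p * ∫⁻ x in Ω, R n x ∂μ ≤ T ^ p := by
      rwa [one_div, ENNReal.rpow_inv_le_iff hp] at h1
    have h3 : θ ^ n * ENNReal.ofReal (2 ^ (n * s)) ^ p = 1 := by
      rw [hθ, ← ENNReal.rpow_natCast, ← ENNReal.rpow_mul, mul_comm p, ENNReal.rpow_mul,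
        ← ENNReal.mul_rpow_of_nonneg _ _ hp.le, ENNReal.rpow_natCast,
        ← ENNReal.ofReal_pow (by positivity), ← ENNReal.ofReal_mul (by positivity),
        ← Real.rpow_natCast, ← Real.rpow_mul two_pos.le, ← Real.rpow_add two_pos]
      simp [mul_comm]
    calc ∫⁻ x in Ω, R n x ∂μ = θ ^ n * (ENNReal.ofReal (2 ^ (n * s)) ^ p * ∫⁻ x in Ω, R n x ∂μ) := by
          rw [← mul_assoc, h3, one_mul]
      _ ≤ _ := by gcongr

theorem DistComparable.exists_extension_of_approximates {ρ : X → X → ℝ} {α c : ℝ} {μ : Measure X}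
    (hρ : DistComparable ρ α c) {s p : ℝ} {q : ℝ≥0∞} (hs : 0 < s) (hsα : s < α) (hp : 0 < p)
    (hq : 0 < q) {ε : ℝ} (hε : 0 < ε) (hε1 : ε ≤ 1) {Ω : Set X} (hΩ : MeasurableSet Ω)
    {N : ℕ → Set X} {M : ℕ} {Λ : ℝ≥0∞} (S : NetSystem μ Ω (netRadius ε α) N M Λ) {a : ℝ}
    (ha : 1 ≤ a) (ha' : a ≤ 8) {C : ℝ≥0∞} (hC : C ≠ ∞) :
    ∃ K : ℝ≥0∞, K ≠ ∞ ∧ ∀ m u R, AEMeasurable u (μ.restrict Ω) → S.Approximates p a C m u R →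
      lpOn μ Ω p u ≠ ∞ → scaleNorm μ Ω s p q R ≠ ∞ →
      MemNspq ρ μ univ s p q (seriesVal (S.piece m)) ∧
      (∀ᵐ x ∂μ.restrict Ω, seriesVal (S.piece m) x = u x) ∧
      NNorm ρ μ univ s p q (seriesVal (S.piece m)) ≤
        K * (lpOn μ Ω p u + scaleNorm μ Ω s p q R) := by
  obtain ⟨C₁, hC₁, H₁⟩ := PieceBounds.reconstruct (μ := μ) hρ hs hsα hp hq hε hε1
    (L := 4 * (1 + 2 * (M : ℝ))) (by positivity)
  set K₀ : ℝ≥0∞ := (M : ℝ≥0∞) ^ p * (2 ^ p * (2 * C + 1)) * (M * M) with hK₀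
  set K₁ : ℝ≥0∞ := ((M * M : ℕ) : ℝ≥0∞) ^ p * (2 ^ p * (3 * C)) * M * (2 * (M * M)) with hK₁
  set K₂ : ℝ≥0∞ := K₀ + 2 * (ENNReal.ofReal (2 ^ s) ^ p * K₁) with hK₂
  have hK₂t : K₂ ≠ ∞ := by finiteness
  obtain ⟨C₂, hC₂, H₂⟩ := lqN_geom_le hp hq hK₂t (θ := 2⁻¹) (by norm_num)
  obtain ⟨C₃, hC₃, H₃⟩ := lqN_add_le hq
  refine ⟨C₁ * (C₂ * (2 ^ (1 / p) * C₃)), by finiteness, fun m u R hu h hup hR => ?_⟩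
  set U := ∫⁻ x in Ω, ENNReal.ofReal |u x| ^ p ∂μ with hU
  set b : ℕ → ℝ≥0∞ := fun n => ENNReal.ofReal (2 ^ (n * s)) ^ p * ∫⁻ x in Ω, R n x ∂μ with hb
  set D : ℤ → ℝ≥0∞ := fun k => (if k = 0 then U else 0) + extZ b k with hD
  set A : ℕ → ℝ≥0∞ := fun n =>
    ∫⁻ x, (ENNReal.ofReal (2 ^ (n * s)) * S.pieceSize m n x) ^ p ∂μ with hA
  have hpb := S.pieceBounds m
  have hAeq : ∀ n, A n = ENNReal.ofReal (2 ^ (n * s)) ^ p * ∫⁻ x, S.pieceSize m n x ^ p ∂μ := by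
    intro n
    simp only [hA, ENNReal.mul_rpow_of_nonneg _ _ hp.le]
    rw [lintegral_const_mul _ ((hpb.meas n).pow_const p)]
  have hAD : ∀ j, extZ A j ≤ K₂ * ∑' k : ℤ, (2⁻¹ : ℝ≥0∞) ^ (j - k).natAbs * D k := by
    intro j
    rcases lt_or_ge j 0 with hj | hj
    · rw [extZ, if_neg (by omega)]
      exact zero_le
    obtain ⟨n, rfl⟩ := Int.eq_ofNat_of_zero_le hj
    rw [extZ_natCast, hAeq]
    cases n with
    | zero =>
      calc _ ≤ 1 * (K₀ * (∫⁻ x in Ω, R 0 x ∂μ + U)) := by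
            gcongr
            · simp
            · exact h.lintegral_pieceSize_zero_le hΩ hu hC hp ha ha'
        _ = K₀ * D 0 := by simp [hD, hb, extZ, add_comm]
        _ ≤ K₂ * D 0 := by gcongr; exact le_self_add
        _ ≤ _ := by
            refine mul_le_mul_right ?_ _
            refine le_trans ?_ (ENNReal.le_tsum (0 : ℤ))
            simp
    | succ n =>
      calc _ ≤ ENNReal.ofReal (2 ^ (((n + 1 : ℕ) : ℝ) * s)) ^ p * (K₁ * ∫⁻ x in Ω, R n x ∂μ) := by
            gcongr
            exact h.lintegral_pieceSize_succ_le hΩ hp ha ha' n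
        _ = ENNReal.ofReal (2 ^ s) ^ p * K₁ * b n := by
            have : (2 : ℝ) ^ (((n + 1 : ℕ) : ℝ) * s) = 2 ^ s * 2 ^ (n * s) := by
              rw [← Real.rpow_add two_pos]; push_cast; ring_nf
            rw [this, ENNReal.ofReal_mul (by positivity), ENNReal.mul_rpow_of_nonneg _ _ hp.le]
            ring
        _ ≤ ENNReal.ofReal (2 ^ s) ^ p * K₁ * D n := by
            gcongr
            simp [hD]
        _ = 2 * (ENNReal.ofReal (2 ^ s) ^ p * K₁) * (2⁻¹ * D n) := by
            rw [mul_mul_mul_comm, ENNReal.mul_inv_cancel two_ne_zero ofNat_ne_top, one_mul]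
        _ ≤ K₂ * (2⁻¹ * D n) := by gcongr; exact le_add_self
        _ ≤ _ := by
            refine mul_le_mul_right ?_ _
            refine le_trans ?_ (ENNReal.le_tsum (n : ℤ))
            simp
  have hDle : lqN q (fun k => D k ^ (1 / p)) ≤
      2 ^ (1 / p) * C₃ * (lpOn μ Ω p u + scaleNorm μ Ω s p q R) := by
    calc _ ≤ lqN q (fun k => 2 ^ (1 / p) * ((if k = 0 then lpOn μ Ω p u else 0) +
          extZ b k ^ (1 / p))) := by
          refine lqN_mono fun k => ?_
          have h1p : 0 < 1 / p := by positivity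
          refine (add_rpow_le_two_rpow_mul _ _ h1p.le).trans_eq ?_
          congr 2
          split_ifs
          · rfl
          · exact ENNReal.zero_rpow_of_pos h1p
      _ ≤ 2 ^ (1 / p) * (C₃ * (lpOn μ Ω p u + scaleNorm μ Ω s p q R)) := by
          rw [lqN_const_mul hq]
          refine mul_le_mul_right ((H₃ _ _).trans_eq ?_) _
          rw [lqN_single hq]
          rfl
      _ = _ := by ring
  have hAle := (H₂ _ _ hAD).trans (mul_le_mul_right hDle _)
  have hfin : lqN q (fun k => extZ A k ^ (1 / p)) ≠ ∞ :=
    ne_top_of_le_ne_top (by finiteness) hAle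
  obtain ⟨hsum, hmem, hnorm⟩ := H₁ _ _ hpb hfin
  refine ⟨hmem, ?_, hnorm.trans ((mul_le_mul_right hAle _).trans_eq (by ring))⟩
  filter_upwards [ae_restrict_of_ae hsum, ae_restrict_mem hΩ,
    h.tendsto_smooth hΩ hC hp ha' (tsum_lintegral_ne_top hs hp hq hR)] with x hx hxΩ hxt
  have h1 := tendsto_seriesVal hx
  simp only [S.sum_piece m _ hxΩ] at h1
  exact tendsto_nhds_unique h1 hxt

end ExtensionOfApproximations

section GradientControl

theorem lqN_extZ_shift_le {p : ℝ} (hp : 0 < p) {q : ℝ≥0∞} (hq : 0 < q) {C θ : ℝ≥0∞} (hC : C ≠ ∞)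
    (hθ : θ < 1) : ∃ C' : ℝ≥0∞, C' ≠ ∞ ∧ ∀ (b : ℕ → ℝ≥0∞) (D : ℤ → ℝ≥0∞),
      (∀ n : ℕ, b n ≤ C * ∑' i : ℕ, θ ^ i * D (n + i)) →
      lqN q (fun k => extZ b k ^ (1 / p)) ≤ C' * lqN q (fun k => D k ^ (1 / p)) := by
  obtain ⟨C', hC', H⟩ := lqN_geom_le hp hq hC hθ
  refine ⟨C', hC', fun b D h => H _ _ fun j => ?_⟩
  rcases lt_or_ge j 0 with hj | hj
  · rw [extZ, if_neg (by omega)]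
    exact zero_le
  obtain ⟨n, rfl⟩ := Int.eq_ofNat_of_zero_le hj
  rw [extZ_natCast]
  refine (h n).trans (mul_le_mul_right ?_ _)
  have hinj : Function.Injective fun i : ℕ => (n : ℤ) + i := fun i j hij => by
    simpa using hij
  refine le_trans (le_of_eq (tsum_congr fun i => ?_)) (ENNReal.tsum_comp_le_tsum_of_injective hinj
    fun k : ℤ => θ ^ ((n : ℤ) - k).natAbs * D k)
  simp

/-- The increments of `u` on `Ω` at the scale `r n` are controlled by `R n`. -/
structure PairControl [PseudoMetricSpace X] (μ : Measure X) (Ω : Set X) (r : ℕ → ℝ) (p : ℝ)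
    (u : X → ℝ) (R : ℕ → X → ℝ≥0∞) : Prop where
  meas : ∀ n, Measurable (R n)
  anti : Antitone R
  bound : ∃ E : Set X, μ E = 0 ∧ ∀ n, ∀ x ∈ Ω \ E, ∀ y ∈ Ω \ E, dist x y < 16 * r n →
    ENNReal.ofReal |u x - u y| ^ p ≤ R n x + R n y

/-- The tail of a gradient, starting at the scale `n`. -/
def gradTail (s p : ℝ) (G : ℤ → X → ℝ≥0∞) (n : ℕ) (x : X) : ℝ≥0∞ :=
  ∑' i : ℕ, 2 ^ p * (ENNReal.ofReal (2 ^ (-((n + i : ℕ) * s))) * G ((n + i : ℕ) : ℤ) x) ^ p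

theorem measurable_gradTail {s p : ℝ} {G : ℤ → X → ℝ≥0∞} (hG : ∀ k, Measurable (G k)) (n : ℕ) :
    Measurable (gradTail s p G n) :=
  Measurable.tsum fun _ => (((hG _).const_mul _).pow_const p).const_mul _

omit [MeasurableSpace X] in
theorem gradTail_antitone (s p : ℝ) (G : ℤ → X → ℝ≥0∞) : Antitone (gradTail s p G) := by
  intro n m hnm x
  obtain ⟨k, rfl⟩ := Nat.exists_eq_add_of_le hnm
  have hinj : Function.Injective fun i : ℕ => k + i := add_right_injective k
  refine le_trans (le_of_eq (tsum_congr fun i => ?_)) (ENNReal.tsum_comp_le_tsum_of_injective hinj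
    fun i : ℕ => 2 ^ p * (ENNReal.ofReal (2 ^ (-((n + i : ℕ) * s))) * G ((n + i : ℕ) : ℤ) x) ^ p)
  simp only [add_assoc]

omit [MeasurableSpace X] in
theorem le_gradTail (s p : ℝ) (G : ℤ → X → ℝ≥0∞) {n k : ℕ} (hnk : n ≤ k) (x : X) :
    2 ^ p * (ENNReal.ofReal (2 ^ (-(k * s))) * G k x) ^ p ≤ gradTail s p G n x := by
  obtain ⟨i, rfl⟩ := Nat.exists_eq_add_of_le hnk
  exact ENNReal.le_tsum (f := fun i : ℕ =>
    2 ^ p * (ENNReal.ofReal (2 ^ (-((n + i : ℕ) * s))) * G ((n + i : ℕ) : ℤ) x) ^ p) i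

theorem ofReal_two_rpow_pow_mul (s : ℝ) {p : ℝ} (hp : 0 ≤ p) (n i : ℕ) :
    ENNReal.ofReal (2 ^ (n * s)) ^ p =
      (ENNReal.ofReal (2 ^ (-s)) ^ p) ^ i * ENNReal.ofReal (2 ^ ((n + i : ℕ) * s)) ^ p := by
  rw [← ENNReal.rpow_natCast, ← ENNReal.rpow_mul, mul_comm p, ENNReal.rpow_mul,
    ← ENNReal.mul_rpow_of_nonneg _ _ hp, ENNReal.rpow_natCast,
    ← ENNReal.ofReal_pow (by positivity), ← ENNReal.ofReal_mul (by positivity),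
    ← Real.rpow_natCast, ← Real.rpow_mul two_pos.le, ← Real.rpow_add two_pos]
  congr 3
  push_cast
  ring

theorem scaleNorm_gradTail_le {s p : ℝ} (hs : 0 < s) (hp : 0 < p) {q : ℝ≥0∞} (hq : 0 < q) :
    ∃ K : ℝ≥0∞, K ≠ ∞ ∧ ∀ (μ : Measure X) (Ω : Set X) (G : ℤ → X → ℝ≥0∞),
      (∀ k, Measurable (G k)) →
      scaleNorm μ Ω s p q (gradTail s p G) ≤
        K * lqN q fun k => lpN (μ.restrict Ω) p (G k) := by
  have hθ : ENNReal.ofReal (2 ^ (-s)) ^ p < 1 := by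
    refine ENNReal.rpow_lt_one ?_ hp
    rw [ENNReal.ofReal_lt_one]
    exact Real.rpow_lt_one_of_one_lt_of_neg one_lt_two (neg_lt_zero.2 hs)
  obtain ⟨K, hK, H⟩ := lqN_extZ_shift_le hp hq (C := 2 ^ p) (by finiteness) hθ
  refine ⟨K, hK, fun μ Ω G hG => H _ (fun k => ∫⁻ x in Ω, G k x ^ p ∂μ) fun n => ?_⟩
  unfold gradTail
  rw [lintegral_tsum fun i => ((((hG _).const_mul _).pow_const p).const_mul _).aemeasurable,
    ← ENNReal.tsum_mul_left, ← ENNReal.tsum_mul_left]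
  refine ENNReal.tsum_le_tsum fun i => le_of_eq ?_
  simp only [ENNReal.mul_rpow_of_nonneg _ _ hp.le]
  rw [lintegral_const_mul _ (((hG _).pow_const p).const_mul _),
    lintegral_const_mul _ ((hG _).pow_const p), ofReal_two_rpow_pow_mul s hp.le n i]
  have h1 : ENNReal.ofReal (2 ^ ((n + i : ℕ) * s)) ^ p *
      ENNReal.ofReal (2 ^ (-((n + i : ℕ) * s))) ^ p = 1 := by
    rw [← ENNReal.mul_rpow_of_nonneg _ _ hp.le, ← ENNReal.ofReal_mul (by positivity),
      ← Real.rpow_add two_pos]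
    simp
  calc _ = 2 ^ p * ((ENNReal.ofReal (2 ^ (-s)) ^ p) ^ i *
        (ENNReal.ofReal (2 ^ ((n + i : ℕ) * s)) ^ p *
          ENNReal.ofReal (2 ^ (-((n + i : ℕ) * s))) ^ p) * ∫⁻ x in Ω, G (n + i : ℕ) x ^ p ∂μ) := by
        ring
    _ = _ := by rw [h1, mul_one, Nat.cast_add]

theorem DistComparable.exists_pairControl [PseudoMetricSpace X] {ρ : X → X → ℝ} {α c : ℝ}
    {μ : Measure X} (hρ : DistComparable ρ α c) (h0 : ∀ x y, ρ x y = 0 → x = y) {Ω : Set X}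
    {s p : ℝ} (hs : 0 < s) (hp : 0 < p) {q : ℝ≥0∞} (hq : 0 < q) :
    ∃ K : ℝ≥0∞, K ≠ ∞ ∧ ∀ u, ∀ g ∈ fracGrad ρ μ Ω s u,
      ∃ R, PairControl μ Ω (netRadius (16 * c)⁻¹ α) p u R ∧
        scaleNorm μ Ω s p q R ≤
          K * lqN q fun k => lpN (μ.restrict Ω) p fun x => ENNReal.ofReal (g k x) := by
  obtain ⟨K, hK, H⟩ := scaleNorm_gradTail_le (X := X) hs hp hq
  refine ⟨K, hK, fun u g ⟨hg0, hgm, E, hE, hg⟩ => ?_⟩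
  have hc : 0 < c := zero_lt_one.trans_le hρ.one_le
  have hGm : ∀ k, AEMeasurable (fun x => ENNReal.ofReal (g k x)) (μ.restrict Ω) := fun k =>
    (hgm k).ennreal_ofReal
  set G : ℤ → X → ℝ≥0∞ := fun k => (hGm k).mk with hG
  have hGe : ∀ k, (fun x => ENNReal.ofReal (g k x)) =ᵐ[μ.restrict Ω] G k := fun k => (hGm k).ae_eq_mk
  have hmeas : ∀ k, Measurable (G k) := fun k => (hGm k).measurable_mk
  refine ⟨gradTail s p G, ⟨measurable_gradTail hmeas, gradTail_antitone s p G, ?_⟩, ?_⟩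
  · have hae : ∀ᵐ x ∂μ.restrict Ω, ∀ k, ENNReal.ofReal (g k x) = G k x := ae_all_iff.2 hGe
    set E' : Set X := Ω ∩ {x | ¬ ∀ k, ENNReal.ofReal (g k x) = G k x} with hE'
    have hE'0 : μ E' = 0 := by
      rw [hE', inter_comm]
      exact le_antisymm ((Measure.le_restrict_apply Ω _).trans_eq hae) zero_le
    refine ⟨E ∪ E', measure_union_null hE hE'0, fun n x hx y hy hxy => ?_⟩
    have hxE : x ∈ Ω \ E := ⟨hx.1, fun h => hx.2 (Or.inl h)⟩
    have hyE : y ∈ Ω \ E := ⟨hy.1, fun h => hy.2 (Or.inl h)⟩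
    have hxG : ∀ k, ENNReal.ofReal (g k x) = G k x := by
      by_contra h; exact hx.2 (Or.inr ⟨hx.1, h⟩)
    have hyG : ∀ k, ENNReal.ofReal (g k y) = G k y := by
      by_contra h; exact hy.2 (Or.inr ⟨hy.1, h⟩)
    have hlt : ρ x y < 2 ^ (-(n : ℤ)) := by
      refine (hρ.rho_lt hxy).trans_eq ?_
      have : c * (16 * netRadius (16 * c)⁻¹ α n) = 2 ^ (-(n * α)) := by
        unfold netRadius; field_simp
      rw [this, ← Real.rpow_mul two_pos.le, ← Real.rpow_intCast]
      congr 1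
      have := hρ.pos.ne'
      push_cast
      field_simp
    rcases (hρ.nonneg x y).eq_or_lt with h | hpos
    · rw [h0 x y h.symm]
      simp [hp]
    obtain ⟨m, hm1, hm2⟩ := exists_mem_Ico_zpow hpos (one_lt_two (α := ℝ))
    have hmn : m < -(n : ℤ) := (zpow_lt_zpow_iff_right₀ (one_lt_two (α := ℝ))).1 (hm1.trans_lt hlt)
    obtain ⟨k, hk⟩ : ∃ k : ℕ, (k : ℤ) = -m - 1 := ⟨(-m - 1).toNat, by omega⟩
    have hnk : n ≤ k := by omega
    have hmk : m = -(k : ℤ) - 1 := by omega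
    have hk2 : ρ x y < 2 ^ (-(k : ℤ)) := by
      rw [hmk] at hm2
      simpa using hm2
    have hmain := hg k x hxE y hyE (hmk ▸ hm1) hk2
    have hρs : ρ x y ^ s ≤ 2 ^ (-(k * s)) := by
      refine (Real.rpow_le_rpow hpos.le hk2.le hs.le).trans_eq ?_
      rw [← Real.rpow_intCast, ← Real.rpow_mul two_pos.le]
      congr 1
      push_cast
      ring
    calc ENNReal.ofReal |u x - u y| ^ p
        ≤ (ENNReal.ofReal (2 ^ (-(k * s))) * G k x + ENNReal.ofReal (2 ^ (-(k * s))) * G k y) ^ p := by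
          gcongr
          rw [← mul_add, ← hxG, ← hyG, ← ENNReal.ofReal_add (hg0 _ _) (hg0 _ _),
            ← ENNReal.ofReal_mul (by positivity)]
          refine ENNReal.ofReal_le_ofReal (hmain.trans ?_)
          exact mul_le_mul_of_nonneg_right hρs (add_nonneg (hg0 _ _) (hg0 _ _))
      _ ≤ _ := (add_rpow_le_two_rpow_mul _ _ hp.le).trans_eq (mul_add _ _ _)
      _ ≤ _ := add_le_add (le_gradTail s p G hnk x) (le_gradTail s p G hnk y)
  · refine (H μ Ω G hmeas).trans_eq ?_
    congr 2
    ext k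
    exact congrArg (· ^ (1 / p)) (lintegral_congr_ae ((hGe k).mono fun x hx => by
      simp only [← hx]))

end GradientControl

section Coefficients

theorem lintegral_rpow_le_of_ae_le {ν : Measure X} {p : ℝ} (hp : 0 < p) (hp1 : p ≤ 1)
    {f : X → ℝ≥0∞} {S : ℝ≥0∞} (h : ∀ᵐ x ∂ν, f x ^ p ≤ S) (hS : S ≠ ∞) :
    (∫⁻ x, f x ∂ν) ^ p ≤ S ^ (1 - p) * (∫⁻ x, f x ^ p ∂ν) ^ p := by
  have h1p : 0 ≤ 1 - p := by linarith
  have he : 0 ≤ (1 - p) / p := by positivity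
  calc (∫⁻ x, f x ∂ν) ^ p ≤ (∫⁻ x, S ^ ((1 - p) / p) * f x ^ p ∂ν) ^ p := by
        refine ENNReal.rpow_le_rpow (lintegral_mono_ae (h.mono fun x hx => ?_)) hp.le
        calc f x = (f x ^ p) ^ ((1 - p) / p) * f x ^ p := by
              rw [← ENNReal.rpow_mul, mul_div_cancel₀ _ hp.ne',
                ← ENNReal.rpow_add_of_nonneg _ _ h1p hp.le]
              simp
          _ ≤ _ := by gcongr
    _ = _ := by
        rw [lintegral_const_mul' _ _ (ENNReal.rpow_ne_top_of_nonneg he hS),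
          ENNReal.mul_rpow_of_nonneg _ _ hp.le, ← ENNReal.rpow_mul, div_mul_cancel₀ _ hp.ne']

theorem lintegral_div_rpow_le {μ : Measure X} {A : Set X} (h0 : μ A ≠ 0) (ht : μ A ≠ ∞) {p : ℝ}
    (hp : 1 ≤ p) {f : X → ℝ≥0∞} (hf : AEMeasurable f (μ.restrict A)) :
    ((∫⁻ x in A, f x ∂μ) / μ A) ^ p ≤ (∫⁻ x in A, f x ^ p ∂μ) / μ A := by
  have hp0 : 0 < p := zero_lt_one.trans_le hp
  have h1 := eLpNorm'_le_eLpNorm'_mul_rpow_measure_univ one_pos hp hf.aestronglyMeasurable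
  simp only [eLpNorm', enorm_eq_self, ENNReal.rpow_one, div_one, Measure.restrict_apply_univ] at h1
  have h2 := ENNReal.rpow_le_rpow h1 hp0.le
  rw [ENNReal.mul_rpow_of_nonneg _ _ hp0.le, ← ENNReal.rpow_mul, one_div_mul_cancel hp0.ne',
    ENNReal.rpow_one, ← ENNReal.rpow_mul, sub_mul, one_mul, one_div_mul_cancel hp0.ne'] at h2
  rw [ENNReal.div_rpow_of_nonneg _ _ hp0.le]
  calc _ ≤ ((∫⁻ x in A, f x ^ p ∂μ) * μ A ^ (p - 1)) / μ A ^ p := ENNReal.div_le_div_right h2 _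
    _ = _ := by
        rw [ENNReal.rpow_sub _ _ h0 ht, ENNReal.rpow_one, div_eq_mul_inv, div_eq_mul_inv,
          div_eq_mul_inv, mul_assoc, mul_right_comm (μ A ^ p), ENNReal.mul_inv_cancel, one_mul]
        · exact (ENNReal.rpow_pos (pos_iff_ne_zero.2 h0) ht).ne'
        · exact ENNReal.rpow_ne_top_of_nonneg hp0.le ht

variable [PseudoMetricSpace X]

namespace NetSystem

variable {μ : Measure X} {Ω : Set X} {r : ℕ → ℝ} {N : ℕ → Set X} {M : ℕ} {Λ : ℝ≥0∞}
  {p : ℝ} {C : ℝ≥0∞} {u : X → ℝ} {R : ℕ → X → ℝ≥0∞}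

/-- The mean values of `u` over the parts in `Ω` of the balls of radius `r n`. -/
def mean (μ : Measure X) (Ω : Set X) (r : ℕ → ℝ) (u : X → ℝ) (n : ℕ) (z : X) : ℝ :=
  ⨍ y in Metric.ball z (r n) ∩ Ω, u y ∂μ

theorem exists_approximates (S : NetSystem μ Ω r N M Λ) (hΩ : MeasurableSet Ω)
    (h : PairControl μ Ω r p u R) : ∃ m, S.Approximates p 1 1 m u R := by
  obtain ⟨E, hE, hb⟩ := h.bound
  have key : ∀ n z, ∃ t : ℝ, z ∈ N n → ∃ y ∈ (Metric.ball z (r n) ∩ Ω) \ E, u y = t ∧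
      R n y ≤ netAvg μ Ω 1 (r n) (R n) z := by
    intro n z
    by_cases hz : z ∈ N n
    swap
    · exact ⟨0, fun h => absurd h hz⟩
    have h0 := (S.dens_pos n z hz).ne'
    have ht := (S.dens_lt_top hz).ne
    have hae : (((Metric.ball z (r n) ∩ Ω) \ E : Set X)) =ᵐ[μ] (Metric.ball z (r n) ∩ Ω : Set X) :=
      sdiff_null_ae_eq_self hE
    have hm := measure_congr hae
    obtain ⟨y, hy, hyR⟩ := exists_le_setLAverage (hm.symm ▸ h0) (hm.symm ▸ ht)
      (h.meas n).aemeasurable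
    refine ⟨u y, fun _ => ⟨y, hy, rfl, ?_⟩⟩
    rw [setLAverage_eq, hm, Measure.restrict_congr_set hae] at hyR
    rwa [netAvg, one_mul]
  choose m hm using key
  refine ⟨m, h.meas, h.anti, fun n z hz => ?_⟩
  obtain ⟨y, hy, hyu, hyR⟩ := hm n z hz
  filter_upwards [ae_restrict_mem hΩ,
    ae_restrict_of_ae (measure_eq_zero_iff_ae_notMem.1 hE)] with x hxΩ hxE hxz
  rw [← hyu, one_mul, add_comm]
  refine (hb n y ⟨hy.1.2, hy.2⟩ x ⟨hxΩ, hxE⟩ ?_).trans (add_le_add_left hyR _)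
  have h1 : dist y z < r n := hy.1.1
  have h2 : dist x z < 8 * r n := hxz
  linarith [dist_triangle_right y x z, S.pos n]

omit [PseudoMetricSpace X] in
theorem integrableOn_of_lintegral_sub_ne_top {A : Set X} (ht : μ A ≠ ∞) {t : ℝ}
    (hu : AEMeasurable u (μ.restrict A)) (h : ∫⁻ x in A, ENNReal.ofReal |u x - t| ∂μ ≠ ∞) :
    IntegrableOn u A μ := by
  have h1 : IntegrableOn (fun x => u x - t) A μ := by
    refine ⟨(hu.sub_const t).aestronglyMeasurable, ?_⟩
    simp only [hasFiniteIntegral_iff_norm, Real.norm_eq_abs]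
    exact h.lt_top
  have h2 : IntegrableOn (fun _ : X => t) A μ := integrableOn_const ht
  exact (h1.add h2).congr_fun_ae (Filter.Eventually.of_forall fun x => sub_add_cancel (u x) t)

omit [PseudoMetricSpace X] in
theorem ofReal_abs_setAverage_sub_le {A : Set X} (h0 : μ A ≠ 0) (ht : μ A ≠ ∞) (t : ℝ)
    (hu : IntegrableOn u A μ) :
    ENNReal.ofReal |(⨍ y in A, u y ∂μ) - t| ≤ (∫⁻ x in A, ENNReal.ofReal |u x - t| ∂μ) / μ A := by
  have h1 : (⨍ y in A, u y ∂μ) - t = (μ.real A)⁻¹ * ∫ y in A, (u y - t) ∂μ := by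
    have hA : μ.real A ≠ 0 := (ENNReal.toReal_pos h0 ht).ne'
    rw [integral_sub hu (integrableOn_const ht), setAverage_eq, setIntegral_const, smul_eq_mul,
      smul_eq_mul]
    field_simp
  rw [h1, abs_mul, abs_inv, abs_of_nonneg measureReal_nonneg, ENNReal.ofReal_mul (by positivity),
    Measure.real, ENNReal.ofReal_inv_of_pos (ENNReal.toReal_pos h0 ht), ENNReal.ofReal_toReal ht,
    mul_comm, ← div_eq_mul_inv]
  refine ENNReal.div_le_div_right ?_ _
  have := enorm_integral_le_lintegral_enorm (μ := μ.restrict A) fun y => u y - t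
  simpa only [← ofReal_norm, Real.norm_eq_abs] using this

variable {S : NetSystem μ Ω r N M Λ} {m : ℕ → X → ℝ} {R' : ℕ → X → ℝ≥0∞}

theorem Approximates.of_mean (h : S.Approximates p 1 C m u R) (hp : 0 < p)
    (hu : AEMeasurable u (μ.restrict Ω)) (hm : ∀ n, Measurable (R' n))
    (ha : Antitone R') (hRR' : R ≤ R') {K : ℝ≥0∞} (hK : K ≠ ∞)
    (hfin : ∀ n, ∫⁻ x in Ω, R' n x ∂μ ≠ ∞)
    (hb : ∀ n, ∀ z ∈ N n, ((∫⁻ x in Metric.ball z (r n) ∩ Ω, ENNReal.ofReal |u x - m n z| ∂μ) /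
      μ (Metric.ball z (r n) ∩ Ω)) ^ p ≤ K * netAvg μ Ω 8 (r n) (R' n) z) :
    (∀ n, ∀ z ∈ N n, IntegrableOn u (Metric.ball z (r n) ∩ Ω) μ) ∧
      S.Approximates p 8 (2 ^ p * (K + C)) (mean μ Ω r u) u R' := by
  have hint : ∀ n, ∀ z ∈ N n, IntegrableOn u (Metric.ball z (r n) ∩ Ω) μ := by
    intro n z hz
    have h0 := (S.dens_pos n z hz).ne'
    have ht := (S.dens_lt_top hz).ne
    have h1 : K * netAvg μ Ω 8 (r n) (R' n) z ≠ ∞ := by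
      refine ENNReal.mul_ne_top hK (ENNReal.div_ne_top ?_ h0)
      exact ne_top_of_le_ne_top (hfin n) (lintegral_mono_set inter_subset_right)
    have h2 := ne_top_of_le_ne_top h1 (hb n z hz)
    refine integrableOn_of_lintegral_sub_ne_top (t := m n z) ht
      (hu.mono_measure (Measure.restrict_mono_set μ inter_subset_right)) fun h3 => h2 ?_
    rw [h3, ENNReal.top_div_of_ne_top ht, ENNReal.top_rpow_of_pos hp]
  refine ⟨hint, hm, ha, fun n z hz => ?_⟩
  have h0 := (S.dens_pos n z hz).ne'
  have ht := (S.dens_lt_top hz).ne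
  filter_upwards [h.bound n z hz] with x hx hxz
  have h1 : netAvg μ Ω 1 (r n) (R n) z ≤ netAvg μ Ω 8 (r n) (R' n) z :=
    (netAvg_mono_left (S.pos n).le (by norm_num) _ _).trans (netAvg_mono_right (hRR' n) z)
  calc ENNReal.ofReal |mean μ Ω r u n z - u x| ^ p
      ≤ 2 ^ p * (ENNReal.ofReal |mean μ Ω r u n z - m n z| ^ p +
          ENNReal.ofReal |u x - m n z| ^ p) := ofReal_abs_sub_rpow_le hp.le _ _ _
    _ ≤ 2 ^ p * (K * netAvg μ Ω 8 (r n) (R' n) z +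
          C * (R' n x + netAvg μ Ω 8 (r n) (R' n) z)) := by
        gcongr
        · exact (ENNReal.rpow_le_rpow (ofReal_abs_setAverage_sub_le h0 ht _ (hint n z hz))
            hp.le).trans (hb n z hz)
        · rw [abs_sub_comm]
          exact (hx hxz).trans (mul_le_mul_right (add_le_add (hRR' n x) h1) _)
    _ ≤ 2 ^ p * (K * netAvg μ Ω 8 (r n) (R' n) z +
          C * (R' n x + netAvg μ Ω 8 (r n) (R' n) z)) + 2 ^ p * (K * R' n x) := le_self_add
    _ = _ := by ring

theorem Approximates.mean_of_one_le (h : S.Approximates p 1 C m u R) [OpensMeasurableSpace X]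
    (hΩ : MeasurableSet Ω) (hp : 1 ≤ p) (hC : C ≠ ∞) (hu : AEMeasurable u (μ.restrict Ω))
    (hfin : ∀ n, ∫⁻ x in Ω, R n x ∂μ ≠ ∞) :
    (∀ n, ∀ z ∈ N n, IntegrableOn u (Metric.ball z (r n) ∩ Ω) μ) ∧
      S.Approximates p 8 (2 ^ p * (2 * C + C)) (mean μ Ω r u) u R := by
  refine h.of_mean (zero_lt_one.trans_le hp) hu h.meas h.anti le_rfl (by finiteness) hfin
    fun n z hz => ?_
  have h0 := (S.dens_pos n z hz).ne'
  have ht := (S.dens_lt_top hz).ne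
  set A := Metric.ball z (r n) ∩ Ω with hA
  have hle : μ.restrict A ≤ μ.restrict Ω := Measure.restrict_mono_set μ inter_subset_right
  have hae : ∀ᵐ x ∂μ.restrict A, ENNReal.ofReal |u x - m n z| ^ p ≤
      C * (R n x + netAvg μ Ω 1 (r n) (R n) z) := by
    filter_upwards [ae_mono hle (h.bound n z hz),
      ae_restrict_mem (measurableSet_ball.inter hΩ)] with x hx hxA
    rw [abs_sub_comm]
    exact hx (Metric.ball_subset_ball (by linarith [S.pos n]) hxA.1)
  have hmono : netAvg μ Ω 1 (r n) (R n) z ≤ netAvg μ Ω 8 (r n) (R n) z :=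
    netAvg_mono_left (S.pos n).le (by norm_num) _ _
  calc _ ≤ (∫⁻ x in A, ENNReal.ofReal |u x - m n z| ^ p ∂μ) / μ A :=
        lintegral_div_rpow_le h0 ht hp ((hu.mono_measure hle).sub_const _).abs.ennreal_ofReal
    _ ≤ (∫⁻ x in A, C * (R n x + netAvg μ Ω 1 (r n) (R n) z) ∂μ) / μ A :=
        ENNReal.div_le_div_right (lintegral_mono_ae hae) _
    _ = C * (((∫⁻ x in A, R n x ∂μ) / μ A) + netAvg μ Ω 1 (r n) (R n) z) := by
        rw [lintegral_const_mul' _ _ hC, lintegral_add_right _ measurable_const,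
          setLIntegral_const, mul_div_assoc, ENNReal.add_div, ENNReal.mul_div_cancel_right h0 ht]
    _ ≤ C * (netAvg μ Ω 8 (r n) (R n) z + netAvg μ Ω 8 (r n) (R n) z) := by
        gcongr
        exact S.setLIntegral_div_le_netAvg (by norm_num) n (R n) z
    _ = _ := by ring

end NetSystem

end Coefficients

section MeanCoefficients

/-- The sum of the functions `R k`, `k ≥ n`, with geometrically growing weights. -/
def growTail (η : ℝ≥0∞) (R : ℕ → X → ℝ≥0∞) (n : ℕ) (x : X) : ℝ≥0∞ :=
  ∑' i : ℕ, η ^ i * R (n + i) x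

theorem measurable_growTail (η : ℝ≥0∞) {R : ℕ → X → ℝ≥0∞} (hR : ∀ n, Measurable (R n)) (n : ℕ) :
    Measurable (growTail η R n) := Measurable.tsum fun _ => (hR _).const_mul _

omit [MeasurableSpace X] in
theorem growTail_antitone (η : ℝ≥0∞) {R : ℕ → X → ℝ≥0∞} (hR : Antitone R) :
    Antitone (growTail η R) := fun _ _ hnm x =>
  ENNReal.tsum_le_tsum fun i => mul_le_mul_right (hR (Nat.add_le_add_right hnm i) x) _

omit [MeasurableSpace X] in
theorem le_growTail (η : ℝ≥0∞) (R : ℕ → X → ℝ≥0∞) : R ≤ growTail η R := fun n x => by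
  have h := ENNReal.le_tsum (f := fun i : ℕ => η ^ i * R (n + i) x) 0
  simp only [pow_zero, one_mul, add_zero] at h
  exact h

theorem setLIntegral_growTail (μ : Measure X) (A : Set X) (η : ℝ≥0∞) {R : ℕ → X → ℝ≥0∞}
    (hR : ∀ n, Measurable (R n)) (n : ℕ) :
    ∫⁻ x in A, growTail η R n x ∂μ = ∑' i : ℕ, η ^ i * ∫⁻ x in A, R (n + i) x ∂μ := by
  unfold growTail
  rw [lintegral_tsum fun i => ((hR _).const_mul _).aemeasurable]
  exact tsum_congr fun i => lintegral_const_mul _ (hR _)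

theorem scaleNorm_growTail_le {s p : ℝ} (hp : 0 < p) {q : ℝ≥0∞} (hq : 0 < q) {η : ℝ≥0∞}
    (hη : η * ENNReal.ofReal (2 ^ (-s)) ^ p < 1) :
    ∃ K : ℝ≥0∞, K ≠ ∞ ∧ ∀ (μ : Measure X) (Ω : Set X) (R : ℕ → X → ℝ≥0∞),
      (∀ n, Measurable (R n)) →
      scaleNorm μ Ω s p q (growTail η R) ≤ K * scaleNorm μ Ω s p q R := by
  obtain ⟨K, hK, H⟩ := lqN_extZ_shift_le hp hq (C := 1) one_ne_top hη
  refine ⟨K, hK, fun μ Ω R hR => H _ _ fun n => le_of_eq ?_⟩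
  rw [setLIntegral_growTail μ Ω η hR, ← ENNReal.tsum_mul_left, one_mul]
  refine tsum_congr fun i => ?_
  rw [← Nat.cast_add, extZ_natCast, ofReal_two_rpow_pow_mul s hp.le n i, mul_pow]
  ring

variable [PseudoMetricSpace X]

theorem netAvg_growTail (μ : Measure X) (Ω : Set X) (a t : ℝ) (η : ℝ≥0∞) {R : ℕ → X → ℝ≥0∞}
    (hR : ∀ n, Measurable (R n)) (n : ℕ) (z : X) :
    netAvg μ Ω a t (growTail η R n) z = ∑' i : ℕ, η ^ i * netAvg μ Ω a t (R (n + i)) z := by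
  simp only [netAvg, setLIntegral_growTail μ _ η hR, div_eq_mul_inv, ← ENNReal.tsum_mul_right,
    mul_assoc]

namespace NetSystem

variable {μ : Measure X} {Ω : Set X} {r : ℕ → ℝ} {N : ℕ → Set X} {M : ℕ} {Λ : ℝ≥0∞}

theorem netAvg_le_of_dist_lt (S : NetSystem μ Ω r N M Λ) {n k : ℕ} (hnk : n ≤ k) {z w : X}
    (hz : z ∈ N n) (hw : w ∈ N k) (hzw : dist z w < 4 * r n) (R : X → ℝ≥0∞) :
    netAvg μ Ω 1 (r k) R w ≤ M * Λ ^ (k - n) * netAvg μ Ω 8 (r n) R z := by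
  have hsub : Metric.ball w (1 * r k) ∩ Ω ⊆ Metric.ball z (8 * r n) ∩ Ω := by
    refine inter_subset_inter_left _ (Metric.ball_subset_ball' ?_)
    rw [dist_comm]
    linarith [S.anti hnk, S.pos n]
  rw [netAvg, ENNReal.div_le_iff (S.dens_pos k w hw).ne' (S.dens_lt_top hw).ne]
  calc _ ≤ ∫⁻ y in Metric.ball z (8 * r n) ∩ Ω, R y ∂μ := lintegral_mono_set hsub
    _ = netAvg μ Ω 8 (r n) R z * μ (Metric.ball z (r n) ∩ Ω) :=
        (ENNReal.div_mul_cancel (S.dens_pos n z hz).ne' (S.dens_lt_top hz).ne).symm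
    _ ≤ netAvg μ Ω 8 (r n) R z * (M * Λ ^ (k - n) * μ (Metric.ball w (r k) ∩ Ω)) := by
        gcongr
        exact S.growth n k hnk z hz w hw hzw
    _ = _ := by ring

theorem avgSum_le_of_mem (S : NetSystem μ Ω r N M Λ) {n k : ℕ} (hnk : n ≤ k) {z x : X}
    (hz : z ∈ N n) (hx : x ∈ Metric.ball z (r n)) (R : X → ℝ≥0∞) :
    S.avgSum 1 k R x ≤ M * (M * Λ ^ (k - n) * netAvg μ Ω 8 (r n) R z) := by
  rw [S.avgSum_eq]
  calc _ ≤ ∑ w ∈ S.near k x, M * Λ ^ (k - n) * netAvg μ Ω 8 (r n) R z := by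
        refine Finset.sum_le_sum fun w hw => ?_
        by_cases hxw : x ∈ Metric.ball w (2 * r k)
        · rw [indicator_of_mem hxw]
          refine S.netAvg_le_of_dist_lt hnk hz (((S.isNet k).mem_near x w).1 hw).1 ?_ R
          have h1 : dist x w < 2 * r k := hxw
          have h2 : dist x z < r n := hx
          linarith [dist_triangle_left z w x, S.anti hnk, S.pos n]
        · rw [indicator_of_notMem hxw]
          exact zero_le
    _ ≤ _ := by
        rw [Finset.sum_const, nsmul_eq_mul]
        gcongr
        exact (S.isNet k).card_le x

theorem setLIntegral_avgSum_le [OpensMeasurableSpace X] (S : NetSystem μ Ω r N M Λ)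
    (hΩ : MeasurableSet Ω) {n k : ℕ} (hnk : n ≤ k) (z : X) {R : X → ℝ≥0∞} (hR : Measurable R) :
    ∫⁻ x in Metric.ball z (r n) ∩ Ω, S.avgSum 1 k R x ∂μ ≤
      (M : ℝ≥0∞) * M * ∫⁻ x in Metric.ball z (8 * r n) ∩ Ω, R x ∂μ := by
  set B := Metric.ball z (8 * r n) with hB
  have hBm : MeasurableSet B := measurableSet_ball
  have h1 : ∀ x ∈ Metric.ball z (r n) ∩ Ω, S.avgSum 1 k R x ≤ S.avgSum 1 k (B.indicator R) x := by
    intro x hx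
    rw [S.avgSum_eq, S.avgSum_eq]
    refine Finset.sum_le_sum fun w _ => ?_
    by_cases hxw : x ∈ Metric.ball w (2 * r k)
    swap
    · rw [indicator_of_notMem hxw]
      exact zero_le
    rw [indicator_of_mem hxw, indicator_of_mem hxw]
    refine ENNReal.div_le_div_right (le_of_eq ?_) _
    refine setLIntegral_congr_fun (measurableSet_ball.inter hΩ) fun y hy => ?_
    have h1 : dist x w < 2 * r k := hxw
    have h2 : dist x z < r n := hx.1
    have h3 : dist y w < 1 * r k := hy.1
    have h4 : y ∈ B := by
      rw [hB, Metric.mem_ball]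
      linarith [dist_triangle y w z, dist_triangle_left w z x, S.anti hnk, S.pos n]
    exact (indicator_of_mem h4 R).symm
  calc _ ≤ ∫⁻ x in Metric.ball z (r n) ∩ Ω, S.avgSum 1 k (B.indicator R) x ∂μ :=
        setLIntegral_mono' (measurableSet_ball.inter hΩ) h1
    _ ≤ ∫⁻ x, S.avgSum 1 k (B.indicator R) x ∂μ := setLIntegral_le_lintegral _ _
    _ ≤ (M : ℝ≥0∞) * M * ∫⁻ x in Ω, B.indicator R x ∂μ :=
        S.lintegral_avgSum_le (by norm_num) k (hR.indicator hBm).aemeasurable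
    _ = _ := by rw [lintegral_indicator hBm, Measure.restrict_restrict hBm]

namespace Approximates

variable {S : NetSystem μ Ω r N M Λ} {p : ℝ} {C : ℝ≥0∞} {m : ℕ → X → ℝ} {u : X → ℝ}
  {R : ℕ → X → ℝ≥0∞}

theorem smooth_sub_coeff_le (h : S.Approximates p 1 C m u R) [OpensMeasurableSpace X]
    (hΩ : MeasurableSet Ω) (hp : 0 < p) {n : ℕ} {z x : X} (hz : z ∈ N n)
    (hx : x ∈ Metric.ball z (r n) ∩ Ω) :
    ENNReal.ofReal |S.smooth n (m n) x - m n z| ^ p ≤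
      2 ^ p * ((M : ℝ≥0∞) ^ p * (M * (2 ^ p * (3 * C) * (1 + M)))) *
        netAvg μ Ω 8 (r n) (R n) z := by
  set V := netAvg μ Ω 8 (r n) (R n) z with hV
  calc _ ≤ (2 * ∑ w ∈ S.near n x,
        (Metric.ball w (2 * r n)).indicator (fun _ => ENNReal.ofReal |m n w - m n z|) x) ^ p := by
        gcongr
        exact S.ofReal_abs_smooth_sub_le n _ hx.2 _
    _ ≤ 2 ^ p * ((M : ℝ≥0∞) ^ p * ∑ w ∈ S.near n x, (Metric.ball w (2 * r n)).indicator
          (fun _ => ENNReal.ofReal |m n w - m n z|) x ^ p) := by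
        rw [ENNReal.mul_rpow_of_nonneg _ _ hp.le]
        gcongr
        exact sum_rpow_le_card _ _ ((S.isNet n).card_le x) hp
    _ ≤ 2 ^ p * ((M : ℝ≥0∞) ^ p * ∑ w ∈ S.near n x, 2 ^ p * (3 * C) * ((1 + M) * V)) := by
        gcongr with w hw
        by_cases hxw : x ∈ Metric.ball w (2 * r n)
        swap
        · rw [indicator_of_notMem hxw, ENNReal.zero_rpow_of_pos hp]
          exact zero_le
        rw [indicator_of_mem hxw]
        have hwN := (((S.isNet n).mem_near x w).1 hw).1
        have hd : dist z w < 4 * r n := by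
          have h1 : dist x w < 2 * r n := hxw
          have h2 : dist x z < r n := hx.1
          linarith [dist_triangle_left z w x, S.pos n]
        refine (h.diff_le hΩ hp le_rfl le_rfl hz hwN hd).trans (mul_le_mul_right ?_ _)
        rw [add_mul, one_mul]
        refine add_le_add (netAvg_mono_left (S.pos n).le (by norm_num) _ _) ?_
        simpa using S.netAvg_le_of_dist_lt le_rfl hz hwN hd (R n)
    _ ≤ 2 ^ p * ((M : ℝ≥0∞) ^ p * (M * (2 ^ p * (3 * C) * ((1 + M) * V)))) := by
        rw [Finset.sum_const, nsmul_eq_mul]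
        gcongr
        exact (S.isNet n).card_le x
    _ = _ := by ring

theorem sub_coeff_le_tsum (h : S.Approximates p 1 C m u R) [OpensMeasurableSpace X]
    (hΩ : MeasurableSet Ω) (hC : C ≠ ∞) (hp : 0 < p) (hR : ∑' n, ∫⁻ x in Ω, R n x ∂μ ≠ ∞) :
    ∀ᵐ x ∂μ.restrict Ω, ∀ n z, ENNReal.ofReal |u x - m n z| ≤
      ENNReal.ofReal |S.smooth n (m n) x - m n z| +
        ∑' i, ENNReal.ofReal (4 * (1 + 2 * M)) * S.pieceSize m (n + i + 1) x := by
  filter_upwards [h.tendsto_smooth hΩ hC hp (by norm_num) hR, ae_restrict_mem hΩ] with x hx hxΩ n z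
  have h1 : Filter.Tendsto (fun i => ENNReal.ofReal |S.smooth (i + n) (m (i + n)) x - m n z|)
      Filter.atTop (nhds (ENNReal.ofReal |u x - m n z|)) :=
    ENNReal.tendsto_ofReal ((((Filter.tendsto_add_atTop_iff_nat n).2 hx).sub_const _).abs)
  refine le_of_tendsto' h1 fun i => ?_
  have h2 : S.smooth (i + n) (m (i + n)) x - m n z = S.smooth n (m n) x - m n z +
      ∑ j ∈ Finset.range i, S.piece m (n + j + 1) x := by
    rw [← S.sum_piece m _ hxΩ, ← S.sum_piece m _ hxΩ, show i + n + 1 = n + 1 + i by ring,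
      Finset.sum_range_add, add_sub_right_comm]
    simp only [add_right_comm]
  rw [h2]
  calc _ ≤ ENNReal.ofReal |S.smooth n (m n) x - m n z| +
        ENNReal.ofReal |∑ j ∈ Finset.range i, S.piece m (n + j + 1) x| := by
        rw [← ENNReal.ofReal_add (abs_nonneg _) (abs_nonneg _)]
        exact ENNReal.ofReal_le_ofReal (abs_add_le _ _)
    _ ≤ ENNReal.ofReal |S.smooth n (m n) x - m n z| +
        ∑ j ∈ Finset.range i, ENNReal.ofReal |S.piece m (n + j + 1) x| := by
        gcongr
        rw [← ENNReal.ofReal_sum_of_nonneg fun _ _ => abs_nonneg _]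
        exact ENNReal.ofReal_le_ofReal (Finset.abs_sum_le_sum_abs _ _)
    _ ≤ _ := by
        gcongr
        refine (Finset.sum_le_sum fun j _ => (S.pieceBounds m).bound (n + j + 1) x).trans ?_
        exact ENNReal.sum_le_tsum _

theorem setLIntegral_pieceSize_le (h : S.Approximates p 1 C m u R) [OpensMeasurableSpace X]
    (hΩ : MeasurableSet Ω) (hC : C ≠ ∞) (hp : 0 < p) (hp1 : p ≤ 1) (hΛ : 1 ≤ Λ) (hΛt : Λ ≠ ∞)
    (hR : ∀ n, ∫⁻ x in Ω, R n x ∂μ ≠ ∞) {n : ℕ} {z : X} (hz : z ∈ N n) (i : ℕ) :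
    ((∫⁻ x in Metric.ball z (r n) ∩ Ω, S.pieceSize m (n + i + 1) x ∂μ) /
        μ (Metric.ball z (r n) ∩ Ω)) ^ p ≤
      ((M * M : ℕ) : ℝ≥0∞) ^ p * (2 ^ p * (3 * C)) * M * (2 * (M * M)) *
        ((Λ ^ (1 - p)) ^ (i + 1) * netAvg μ Ω 8 (r n) (R (n + i)) z) := by
  have h0 := (S.dens_pos n z hz).ne'
  have ht := (S.dens_lt_top hz).ne
  have h1p : 0 ≤ 1 - p := by linarith
  set A := Metric.ball z (r n) ∩ Ω with hA
  have hAm : MeasurableSet A := measurableSet_ball.inter hΩ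
  set V := netAvg μ Ω 8 (r n) (R (n + i)) z with hV
  set c₀ : ℝ≥0∞ := ((M * M : ℕ) : ℝ≥0∞) ^ p * (2 ^ p * (3 * C)) * M with hc₀
  set c : ℝ≥0∞ := c₀ * (2 * (M * M)) with hc
  have hct : c ≠ ∞ := by finiteness
  have hVt : V ≠ ∞ := ENNReal.div_ne_top
    (ne_top_of_le_ne_top (hR (n + i)) (lintegral_mono_set inter_subset_right)) h0
  have hVA : ∫⁻ x in Metric.ball z (8 * r n) ∩ Ω, R (n + i) x ∂μ = V * μ A :=
    (ENNReal.div_mul_cancel h0 ht).symm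
  have hsize := h.pieceSize_succ_le hΩ hp le_rfl (n + i)
  have hsup : ∀ᵐ x ∂μ.restrict A, S.pieceSize m (n + i + 1) x ^ p ≤ c * (Λ ^ (i + 1) * V) := by
    filter_upwards [ae_restrict_mem hAm] with x hx
    refine (hsize x).trans ?_
    rw [hc, mul_assoc c₀ (2 * _)]
    refine mul_le_mul_right ?_ _
    have e1 := S.avgSum_le_of_mem (show n ≤ n + i by omega) hz hx.1 (R (n + i))
    have e2 := S.avgSum_le_of_mem (show n ≤ n + i + 1 by omega) hz hx.1 (R (n + i))
    rw [show n + i - n = i by omega] at e1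
    rw [show n + i + 1 - n = i + 1 by omega] at e2
    calc _ ≤ M * (M * Λ ^ (i + 1) * V) + M * (M * Λ ^ (i + 1) * V) := by
          refine add_le_add (e1.trans ?_) e2
          gcongr
          exact i.le_succ
      _ = _ := by ring
  have hint : ∫⁻ x in A, S.pieceSize m (n + i + 1) x ^ p ∂μ ≤ c * V * μ A := by
    refine (lintegral_mono hsize).trans ?_
    have hm : Measurable fun x =>
        S.avgSum 1 (n + i) (R (n + i)) x + S.avgSum 1 (n + i + 1) (R (n + i)) x :=
      (S.measurable_avgSum _ _ _).add (S.measurable_avgSum _ _ _)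
    rw [lintegral_const_mul _ hm, lintegral_add_left (S.measurable_avgSum _ _ _),
      show c * V * μ A = c₀ * (2 * (M * M) * V * μ A) by rw [hc]; ring]
    refine mul_le_mul_right ?_ c₀
    calc _ ≤ (M : ℝ≥0∞) * M * (V * μ A) + (M : ℝ≥0∞) * M * (V * μ A) := by
          rw [← hVA]
          exact add_le_add (S.setLIntegral_avgSum_le hΩ (by omega) z (h.meas _))
            (S.setLIntegral_avgSum_le hΩ (by omega) z (h.meas _))
      _ = _ := by ring
  have hkey := lintegral_rpow_le_of_ae_le hp hp1 hsup (by finiteness)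
  calc _ ≤ (c * (Λ ^ (i + 1) * V)) ^ (1 - p) *
        (∫⁻ x in A, S.pieceSize m (n + i + 1) x ^ p ∂μ) ^ p / μ A ^ p := by
        rw [ENNReal.div_rpow_of_nonneg _ _ hp.le]
        exact ENNReal.div_le_div_right hkey _
    _ ≤ (c * (Λ ^ (i + 1) * V)) ^ (1 - p) * (c * V) ^ p := by
        rw [mul_div_assoc, ← ENNReal.div_rpow_of_nonneg _ _ hp.le]
        gcongr
        exact ENNReal.div_le_of_le_mul hint
    _ = c * (Λ ^ (i + 1)) ^ (1 - p) * V := by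
        rw [mul_left_comm c, ENNReal.mul_rpow_of_nonneg _ _ h1p, mul_assoc,
          ← ENNReal.rpow_add_of_nonneg _ _ h1p hp.le, sub_add_cancel, ENNReal.rpow_one]
        ring
    _ = _ := by
        rw [← ENNReal.rpow_natCast, ← ENNReal.rpow_natCast, ← ENNReal.rpow_mul, ← ENNReal.rpow_mul,
          mul_comm (1 - p), mul_assoc]

theorem mean_of_le_one [OpensMeasurableSpace X] (hC : C ≠ ∞) (hp : 0 < p) (hp1 : p ≤ 1)
    (hΛ : 1 ≤ Λ) (hΛt : Λ ≠ ∞) :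
    ∃ K : ℝ≥0∞, K ≠ ∞ ∧ ∀ m u R, S.Approximates p 1 C m u R → MeasurableSet Ω →
      AEMeasurable u (μ.restrict Ω) → ∑' n, ∫⁻ x in Ω, R n x ∂μ ≠ ∞ →
      (∀ n, ∫⁻ x in Ω, growTail (Λ ^ (1 - p)) R n x ∂μ ≠ ∞) →
      (∀ n, ∀ z ∈ N n, IntegrableOn u (Metric.ball z (r n) ∩ Ω) μ) ∧
      S.Approximates p 8 K (mean μ Ω r u) u (growTail (Λ ^ (1 - p)) R) := by
  set η := Λ ^ (1 - p) with hη
  have hηt : η ≠ ∞ := ENNReal.rpow_ne_top_of_nonneg (by linarith) hΛt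
  set cF : ℝ≥0∞ := 2 ^ p * ((M : ℝ≥0∞) ^ p * (M * (2 ^ p * (3 * C) * (1 + M)))) with hcF
  set cH : ℝ≥0∞ := ((M * M : ℕ) : ℝ≥0∞) ^ p * (2 ^ p * (3 * C)) * M * (2 * (M * M)) with hcH
  set L : ℝ≥0∞ := ENNReal.ofReal (4 * (1 + 2 * M)) with hL
  set K : ℝ≥0∞ := cF + L ^ p * cH * η with hK
  have hKt : K ≠ ∞ := by finiteness
  refine ⟨2 ^ p * (K + C), by finiteness, fun m u R h hΩ hu hR hR' => ?_⟩
  refine h.of_mean hp hu (measurable_growTail η h.meas) (growTail_antitone η h.anti)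
    (le_growTail η R) hKt hR' fun n z hz => ?_
  have h0 := (S.dens_pos n z hz).ne'
  have ht := (S.dens_lt_top hz).ne
  have hRn := ENNReal.ne_top_of_tsum_ne_top hR
  set A := Metric.ball z (r n) ∩ Ω with hA
  have hAm : MeasurableSet A := measurableSet_ball.inter hΩ
  have hle : μ.restrict A ≤ μ.restrict Ω := Measure.restrict_mono_set μ inter_subset_right
  set V : ℕ → ℝ≥0∞ := fun i => netAvg μ Ω 8 (r n) (R (n + i)) z with hV
  have hpm := (S.pieceBounds m).meas
  have hae : ∀ᵐ x ∂μ.restrict A, ENNReal.ofReal |u x - m n z| ≤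
      (cF * V 0) ^ (1 / p) + ∑' i, L * S.pieceSize m (n + i + 1) x := by
    filter_upwards [ae_mono hle (h.sub_coeff_le_tsum hΩ hC hp hR), ae_restrict_mem hAm] with x h1 h2
    refine (h1 n z).trans (add_le_add_left ?_ _)
    rw [one_div, ENNReal.le_rpow_inv_iff hp]
    exact h.smooth_sub_coeff_le hΩ hp hz h2
  have havg : (∫⁻ x in A, ENNReal.ofReal |u x - m n z| ∂μ) / μ A ≤
      (cF * V 0) ^ (1 / p) + ∑' i, L * ((∫⁻ x in A, S.pieceSize m (n + i + 1) x ∂μ) / μ A) := by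
    refine (ENNReal.div_le_div_right (lintegral_mono_ae hae) _).trans_eq ?_
    rw [lintegral_add_left measurable_const, setLIntegral_const, ENNReal.add_div,
      ENNReal.mul_div_cancel_right h0 ht,
      lintegral_tsum fun i => ((hpm _).const_mul _).aemeasurable]
    simp only [div_eq_mul_inv, ← ENNReal.tsum_mul_right, ← mul_assoc]
    congr 1
    exact tsum_congr fun i => by rw [lintegral_const_mul _ (hpm _)]
  calc _ ≤ ((cF * V 0) ^ (1 / p) +
        ∑' i, L * ((∫⁻ x in A, S.pieceSize m (n + i + 1) x ∂μ) / μ A)) ^ p :=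
        ENNReal.rpow_le_rpow havg hp.le
    _ ≤ ((cF * V 0) ^ (1 / p)) ^ p +
        ∑' i, (L * ((∫⁻ x in A, S.pieceSize m (n + i + 1) x ∂μ) / μ A)) ^ p :=
        (ENNReal.rpow_add_le_add_rpow _ _ hp.le hp1).trans
          (add_le_add_right (tsum_rpow_le_tsum_rpow _ hp hp1) _)
    _ ≤ cF * V 0 + ∑' i, L ^ p * (cH * (η ^ (i + 1) * V i)) := by
        rw [← ENNReal.rpow_mul, one_div_mul_cancel hp.ne', ENNReal.rpow_one]
        gcongr with i
        rw [ENNReal.mul_rpow_of_nonneg _ _ hp.le]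
        gcongr
        exact h.setLIntegral_pieceSize_le hΩ hC hp hp1 hΛ hΛt hRn hz i
    _ = cF * V 0 + L ^ p * cH * η * ∑' i, η ^ i * V i := by
        rw [← ENNReal.tsum_mul_left]
        congr 1
        exact tsum_congr fun i => by ring
    _ ≤ cF * (∑' i, η ^ i * V i) + L ^ p * cH * η * ∑' i, η ^ i * V i := by
        gcongr
        simpa using ENNReal.le_tsum (f := fun i => η ^ i * V i) 0
    _ = _ := by rw [netAvg_growTail μ Ω 8 (r n) η h.meas, ← add_mul]

end Approximates

end NetSystem

end MeanCoefficients

section Extension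

omit [MeasurableSpace X] in
theorem seriesVal_add (f g : ℕ → X → ℝ) :
    seriesVal (fun n x => f n x + g n x) = fun x => seriesVal f x + seriesVal g x := by
  funext x
  simp only [seriesVal, Finset.sum_add_distrib]
  exact map_add genLim _ _

omit [MeasurableSpace X] in
theorem seriesVal_mul (t : ℝ) (f : ℕ → X → ℝ) :
    seriesVal (fun n x => t * f n x) = fun x => t * seriesVal f x := by
  funext x
  simp only [seriesVal, ← Finset.mul_sum]
  exact map_smul genLim t _

theorem lpOn_zero (μ : Measure X) (Ω : Set X) {p : ℝ} (hp : 0 < p) :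
    lpOn μ Ω p (fun _ => 0) = 0 := by
  simp [lpOn, lpN, hp]

theorem lpN_zero (μ : Measure X) {p : ℝ} (hp : 0 < p) : lpN μ p (fun _ => 0) = 0 := by
  simp [lpN, hp]

theorem lqN_zero {q : ℝ≥0∞} (hq : 0 < q) : lqN q (fun _ => 0) = 0 := by
  unfold lqN
  split_ifs with h
  · simp
  · simp [ENNReal.toReal_pos hq.ne' h]

theorem NdotNorm_zero (ρ : X → X → ℝ) (μ : Measure X) (Ω : Set X)
    {s p : ℝ} (hp : 0 < p) {q : ℝ≥0∞} (hq : 0 < q) :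
    NdotNorm ρ μ Ω s p q (fun _ => 0) = 0 := by
  refine le_antisymm (iInf₂_le_of_le (fun _ _ => 0) ?_ ?_) zero_le
  · exact ⟨fun _ _ => le_rfl, fun _ => aemeasurable_const, ∅, measure_empty,
      fun k x _ y _ _ _ => by simp⟩
  · simp [lpN_zero, lqN_zero, hp, hq]

theorem exists_fracGrad_le {ρ : X → X → ℝ} {μ : Measure X} {Ω : Set X} {s p : ℝ} {q : ℝ≥0∞}
    {u : X → ℝ} (hu : MemNspq ρ μ Ω s p q u) (h0 : NNorm ρ μ Ω s p q u ≠ 0) :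
    ∃ g ∈ fracGrad ρ μ Ω s u,
      (lqN q fun k => lpN (μ.restrict Ω) p fun x => ENNReal.ofReal (g k x)) ≤
        2 * NNorm ρ μ Ω s p q u := by
  have ht : NNorm ρ μ Ω s p q u ≠ ∞ := ENNReal.add_ne_top.2 ⟨hu.2.2, hu.2.1⟩
  have h : NdotNorm ρ μ Ω s p q u < 2 * NNorm ρ μ Ω s p q u := by
    refine lt_of_le_of_lt (le_self_add : _ ≤ NNorm ρ μ Ω s p q u) ?_
    rw [two_mul]
    exact ENNReal.lt_add_right ht h0
  obtain ⟨g, hg⟩ := iInf_lt_iff.1 h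
  obtain ⟨hg, hlt⟩ := iInf_lt_iff.1 hg
  exact ⟨g, hg, hlt.le⟩

theorem le_mul_NNorm_of_forall_fracGrad {ρ : X → X → ℝ} {μ : Measure X} {Ω : Set X} {s p : ℝ}
    {q : ℝ≥0∞} {u : X → ℝ} {A K : ℝ≥0∞} (hK0 : K ≠ 0) (hK : K ≠ ∞)
    (h : ∀ g ∈ fracGrad ρ μ Ω s u, A ≤ K * (lpOn μ Ω p u +
      lqN q fun k => lpN (μ.restrict Ω) p fun x => ENNReal.ofReal (g k x))) :
    A ≤ K * NNorm ρ μ Ω s p q u := by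
  rw [← ENNReal.div_le_iff' hK0 hK, NNorm, ← tsub_le_iff_right]
  refine le_iInf₂ fun g hg => ?_
  rw [tsub_le_iff_left, ENNReal.div_le_iff' hK0 hK]
  exact h g hg

variable [PseudoMetricSpace X]

namespace NetSystem

variable {μ : Measure X} {Ω : Set X} {r : ℕ → ℝ} {N : ℕ → Set X} {M : ℕ} {Λ : ℝ≥0∞}

theorem piece_congr (S : NetSystem μ Ω r N M Λ) {m m' : ℕ → X → ℝ}
    (h : ∀ n, ∀ z ∈ N n, m n z = m' n z) : S.piece m = S.piece m' := by
  funext n x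
  have hN : ∀ n, ∀ z ∈ S.near n x, m n z = m' n z := fun n z hz =>
    h n z (((S.isNet n).mem_near x z).1 hz).1
  cases n with
  | zero => exact Finset.sum_congr rfl fun z hz => by rw [hN 0 z hz]
  | succ n =>
    refine Finset.sum_congr rfl fun z hz => ?_
    rw [Finset.mem_product] at hz
    simp only [hN _ _ hz.1, hN _ _ hz.2]

/-- The extension of `u` obtained from its mean values over the balls of the net. -/
def meanExtension (S : NetSystem μ Ω r N M Λ) (u : X → ℝ) : X → ℝ :=
  seriesVal (S.piece (mean μ Ω r u))

theorem meanExtension_add (S : NetSystem μ Ω r N M Λ) {u v : X → ℝ}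
    (hu : ∀ n, ∀ z ∈ N n, IntegrableOn u (Metric.ball z (r n) ∩ Ω) μ)
    (hv : ∀ n, ∀ z ∈ N n, IntegrableOn v (Metric.ball z (r n) ∩ Ω) μ) :
    S.meanExtension (fun x => u x + v x) = fun x => S.meanExtension u x + S.meanExtension v x := by
  have h : S.piece (mean μ Ω r fun x => u x + v x) =
      S.piece fun n z => mean μ Ω r u n z + mean μ Ω r v n z :=
    S.piece_congr fun n z hz => by
      simp only [mean, setAverage_eq]
      rw [integral_add (hu n z hz) (hv n z hz), smul_add]
  rw [meanExtension, h]
  exact (congrArg seriesVal (funext₂ fun n x => S.piece_add _ _ n x)).trans (seriesVal_add _ _)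

theorem meanExtension_mul (S : NetSystem μ Ω r N M Λ) (t : ℝ) (u : X → ℝ) :
    S.meanExtension (fun x => t * u x) = fun x => t * S.meanExtension u x := by
  have h : (mean μ Ω r fun x => t * u x) = fun n z => t * mean μ Ω r u n z := by
    funext n z
    simp only [mean, setAverage_eq, integral_const_mul, smul_eq_mul]
    ring
  rw [meanExtension, h]
  exact (congrArg seriesVal (funext₂ fun n x => S.piece_mul _ _ n x)).trans (seriesVal_mul _ _)

theorem exists_mean_approximates [OpensMeasurableSpace X] (S : NetSystem μ Ω r N M Λ)
    (hΩ : MeasurableSet Ω) {s p : ℝ} (hs : 0 < s) (hp : 0 < p) {q : ℝ≥0∞} (hq : 0 < q)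
    (hΛ : 1 ≤ Λ) (hΛt : Λ ≠ ∞) (hη : p < 1 → Λ ^ (1 - p) * ENNReal.ofReal (2 ^ (-s)) ^ p < 1) :
    ∃ C : ℝ≥0∞, C ≠ ∞ ∧ ∃ K : ℝ≥0∞, K ≠ ∞ ∧ ∀ u R, AEMeasurable u (μ.restrict Ω) →
      PairControl μ Ω r p u R → scaleNorm μ Ω s p q R ≠ ∞ →
      (∀ n, ∀ z ∈ N n, IntegrableOn u (Metric.ball z (r n) ∩ Ω) μ) ∧
      ∃ R', S.Approximates p 8 C (mean μ Ω r u) u R' ∧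
        scaleNorm μ Ω s p q R' ≤ K * scaleNorm μ Ω s p q R := by
  rcases le_or_gt 1 p with hp1 | hp1
  · refine ⟨2 ^ p * (2 * 1 + 1), by finiteness, 1, one_ne_top, fun u R hu h hR => ?_⟩
    obtain ⟨m, hm⟩ := S.exists_approximates hΩ h
    have hfin := ENNReal.ne_top_of_tsum_ne_top (tsum_lintegral_ne_top hs hp hq hR)
    obtain ⟨h1, h2⟩ := hm.mean_of_one_le hΩ hp1 one_ne_top hu hfin
    exact ⟨h1, R, h2, (one_mul _).ge⟩
  · obtain ⟨K, hK, H⟩ := scaleNorm_growTail_le (X := X) hp hq (hη hp1)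
    obtain ⟨C, hC, H'⟩ := Approximates.mean_of_le_one (S := S) (p := p) one_ne_top hp hp1.le hΛ hΛt
    refine ⟨C, hC, K, hK, fun u R hu h hR => ?_⟩
    obtain ⟨m, hm⟩ := S.exists_approximates hΩ h
    have hle := H μ Ω R h.meas
    have hfin := ENNReal.ne_top_of_tsum_ne_top (tsum_lintegral_ne_top hs hp hq
      (ne_top_of_le_ne_top (ENNReal.mul_ne_top hK hR) hle))
    obtain ⟨h1, h2⟩ := H' m u R hm hΩ hu (tsum_lintegral_ne_top hs hp hq hR) hfin
    exact ⟨h1, _, h2, hle⟩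

end NetSystem

namespace DistComparable

variable {ρ : X → X → ℝ} {α c : ℝ} {μ : Measure X} {s p : ℝ} {q : ℝ≥0∞} {Ω : Set X}
  {N : ℕ → Set X} {M : ℕ} {Λ : ℝ≥0∞}

omit [MeasurableSpace X] in
theorem inv_mul_le_one (hρ : DistComparable ρ α c) : 0 < (16 * c)⁻¹ ∧ (16 * c)⁻¹ ≤ 1 := by
  have := hρ.one_le
  exact ⟨by positivity, inv_le_one_of_one_le₀ (by linarith)⟩

variable [OpensMeasurableSpace X]

theorem exists_extension (hρ : DistComparable ρ α c) (h0 : ∀ x y, ρ x y = 0 → x = y)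
    (hs : 0 < s) (hsα : s < α) (hp : 0 < p) (hq : 0 < q) (hΩ : MeasurableSet Ω)
    (S : NetSystem μ Ω (netRadius (16 * c)⁻¹ α) N M Λ) :
    ∃ K : ℝ≥0∞, K ≠ ∞ ∧ ∀ u, MemNspq ρ μ Ω s p q u → ∃ v, MemNspq ρ μ univ s p q v ∧
      (∀ᵐ x ∂μ.restrict Ω, v x = u x) ∧
      NNorm ρ μ univ s p q v ≤ K * NNorm ρ μ Ω s p q u := by
  obtain ⟨K₁, hK₁, H₁⟩ := hρ.exists_pairControl (μ := μ) h0 (Ω := Ω) hs hp hq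
  obtain ⟨K₂, hK₂, H₂⟩ := hρ.exists_extension_of_approximates hs hsα hp hq hρ.inv_mul_le_one.1
    hρ.inv_mul_le_one.2 hΩ S le_rfl (by norm_num) one_ne_top
  refine ⟨K₂ * (1 + K₁ * 2), by finiteness, fun u hu => ?_⟩
  by_cases hN : NNorm ρ μ Ω s p q u = 0
  · have hz := NdotNorm_zero ρ μ univ (s := s) hp hq
    have hl := lpOn_zero μ univ hp
    refine ⟨fun _ => 0, ⟨aemeasurable_const, by simp [hl], by simp [hz]⟩, ?_,
      by simp [NNorm, hz, hl]⟩
    have hu0 : lpOn μ Ω p u = 0 := (add_eq_zero.1 hN).2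
    rw [lpOn, lpN, ENNReal.rpow_eq_zero_iff_of_pos (by positivity),
      lintegral_eq_zero_iff' (hu.1.abs.ennreal_ofReal.pow_const p)] at hu0
    filter_upwards [hu0] with x hx
    rw [Pi.zero_apply, ENNReal.rpow_eq_zero_iff_of_pos hp, ENNReal.ofReal_eq_zero] at hx
    exact (abs_nonpos_iff.1 hx).symm
  obtain ⟨g, hg, hle⟩ := exists_fracGrad_le hu hN
  obtain ⟨R, hR, hRg⟩ := H₁ u g hg
  obtain ⟨m, hm⟩ := S.exists_approximates hΩ hR
  have ht : NNorm ρ μ Ω s p q u ≠ ∞ := ENNReal.add_ne_top.2 ⟨hu.2.2, hu.2.1⟩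
  have hRN : scaleNorm μ Ω s p q R ≤ K₁ * (2 * NNorm ρ μ Ω s p q u) :=
    hRg.trans (mul_le_mul_right hle _)
  obtain ⟨h1, h2, h3⟩ := H₂ m u R hu.1 hm hu.2.1 (ne_top_of_le_ne_top (by finiteness) hRN)
  refine ⟨_, h1, h2, h3.trans ?_⟩
  calc _ ≤ K₂ * (NNorm ρ μ Ω s p q u + K₁ * (2 * NNorm ρ μ Ω s p q u)) := by
        gcongr
        exact le_add_self
    _ = _ := by ring

theorem exists_meanExtension_bound (hρ : DistComparable ρ α c) (h0 : ∀ x y, ρ x y = 0 → x = y)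
    (hs : 0 < s) (hsα : s < α) (hp : 0 < p) (hq : 0 < q) (hΩ : MeasurableSet Ω)
    (S : NetSystem μ Ω (netRadius (16 * c)⁻¹ α) N M Λ) (hΛ : 1 ≤ Λ) (hΛt : Λ ≠ ∞)
    (hη : p < 1 → Λ ^ (1 - p) * ENNReal.ofReal (2 ^ (-s)) ^ p < 1) :
    ∃ K : ℝ≥0∞, K ≠ ∞ ∧ ∀ u, MemNspq ρ μ Ω s p q u →
      (∀ n, ∀ z ∈ N n, IntegrableOn u (Metric.ball z (netRadius (16 * c)⁻¹ α n) ∩ Ω) μ) ∧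
      MemNspq ρ μ univ s p q (S.meanExtension u) ∧
      (∀ᵐ x ∂μ.restrict Ω, S.meanExtension u x = u x) ∧
      NNorm ρ μ univ s p q (S.meanExtension u) ≤ K * NNorm ρ μ Ω s p q u := by
  obtain ⟨K₁, hK₁, H₁⟩ := hρ.exists_pairControl (μ := μ) h0 (Ω := Ω) hs hp hq
  obtain ⟨C, hC, K₂, hK₂, H₂⟩ := S.exists_mean_approximates hΩ hs hp hq hΛ hΛt hη
  obtain ⟨K₃, hK₃, H₃⟩ := hρ.exists_extension_of_approximates hs hsα hp hq hρ.inv_mul_le_one.1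
    hρ.inv_mul_le_one.2 hΩ S (a := 8) (by norm_num) le_rfl hC
  set K : ℝ≥0∞ := 1 + K₃ * (1 + K₂ * K₁) with hK
  have key : ∀ u, MemNspq ρ μ Ω s p q u → ∀ g ∈ fracGrad ρ μ Ω s u,
      (lqN q fun k => lpN (μ.restrict Ω) p fun x => ENNReal.ofReal (g k x)) ≠ ∞ →
      (∀ n, ∀ z ∈ N n, IntegrableOn u (Metric.ball z (netRadius (16 * c)⁻¹ α n) ∩ Ω) μ) ∧
      MemNspq ρ μ univ s p q (S.meanExtension u) ∧
      (∀ᵐ x ∂μ.restrict Ω, S.meanExtension u x = u x) ∧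
      NNorm ρ μ univ s p q (S.meanExtension u) ≤ K * (lpOn μ Ω p u +
        lqN q fun k => lpN (μ.restrict Ω) p fun x => ENNReal.ofReal (g k x)) := by
    intro u hu g hg hgt
    obtain ⟨R, hR, hRg⟩ := H₁ u g hg
    set T := lqN q fun k => lpN (μ.restrict Ω) p fun x => ENNReal.ofReal (g k x)
    obtain ⟨h1, R', h2, h3⟩ := H₂ u R hu.1 hR (ne_top_of_le_ne_top (by finiteness) hRg)
    have h4 : scaleNorm μ Ω s p q R' ≤ K₂ * (K₁ * T) := h3.trans (mul_le_mul_right hRg _)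
    obtain ⟨h5, h6, h7⟩ := H₃ _ u R' hu.1 h2 hu.2.1 (ne_top_of_le_ne_top (by finiteness) h4)
    refine ⟨h1, h5, h6, h7.trans ?_⟩
    calc _ ≤ K₃ * (1 * lpOn μ Ω p u + K₂ * K₁ * T) := by
          rw [one_mul, mul_assoc K₂]
          gcongr
      _ ≤ K₃ * ((1 + K₂ * K₁) * lpOn μ Ω p u + (1 + K₂ * K₁) * T) := by
          gcongr
          · exact le_self_add
          · exact le_add_self
      _ = K₃ * (1 + K₂ * K₁) * (lpOn μ Ω p u + T) := by ring
      _ ≤ _ := by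
          gcongr
          exact le_add_self
  refine ⟨K, by finiteness, fun u hu => ?_⟩
  obtain ⟨g, hg⟩ := iInf_lt_iff.1 (lt_top_iff_ne_top.2 hu.2.2)
  obtain ⟨hg, hgt⟩ := iInf_lt_iff.1 hg
  obtain ⟨h1, h2, h3, -⟩ := key u hu g hg hgt.ne
  refine ⟨h1, h2, h3, le_mul_NNorm_of_forall_fracGrad (by simp [hK]) (by finiteness)
    fun g hg => ?_⟩
  by_cases hgt : (lqN q fun k => lpN (μ.restrict Ω) p fun x => ENNReal.ofReal (g k x)) = ∞
  · rw [hgt, add_top, ENNReal.mul_top (by simp [hK])]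
    exact le_top
  · exact (key u hu g hg hgt).2.2.2

end DistComparable

theorem two_rpow_rpow_mul_lt_one {Q s p : ℝ} (hQ : 0 < Q) (hs : 0 < s) (h : Q / (Q + s) < p) :
    ENNReal.ofReal (2 ^ Q) ^ (1 - p) * ENNReal.ofReal (2 ^ (-s)) ^ p < 1 := by
  rw [ENNReal.ofReal_rpow_of_pos (by positivity), ENNReal.ofReal_rpow_of_pos (by positivity),
    ← Real.rpow_mul zero_le_two, ← Real.rpow_mul zero_le_two,
    ← ENNReal.ofReal_mul (by positivity), ← Real.rpow_add zero_lt_two, ENNReal.ofReal_lt_one]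
  rw [div_lt_iff₀ (by positivity)] at h
  exact Real.rpow_lt_one_of_one_lt_of_neg one_lt_two (by linarith)

theorem exists_real_constant {K : ℝ≥0∞} (hK : K ≠ ∞) : ∃ C : ℝ, 0 < C ∧ K ≤ ENNReal.ofReal C :=
  ⟨K.toReal + 1, by positivity, (ENNReal.ofReal_toReal hK).ge.trans
    (ENNReal.ofReal_le_ofReal (by linarith))⟩

end Extension

/-- Theorem 1.1 (Besov part): for `s < ind(X,ρ)`, measure density implies the `N^s_{p,q}`
extension property, and a bounded linear extension operator exists when `p,q > Q/(Q+s)`. -/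
theorem measure_density_implies_N_extension
    {X : Type*} [MeasurableSpace X] (ρ : X → X → ℝ) (μ : Measure X)
    (hX : IsQMMS ρ μ) (hreg : BorelRegular μ)
    (Q : ℝ) (hQ : 0 < Q) (hdoub : QDoubling ρ μ Q)
    (s p : ℝ) (q : ℝ≥0∞) (hs : 0 < s) (hp : 0 < p) (hq : 0 < q)
    (hind : SLtIndex ρ s)
    (Ω : Set X) (hΩmeas : MeasurableSet Ω) (hΩne : Ω.Nonempty)
    (hdens : MeasDensity ρ μ Ω) :
    (∃ C : ℝ, 0 < C ∧ ∀ u : X → ℝ, MemNspq ρ μ Ω s p q u →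
      ∃ v : X → ℝ, MemNspq ρ μ Set.univ s p q v ∧
        (∀ᵐ x ∂μ.restrict Ω, v x = u x) ∧
        NNorm ρ μ Set.univ s p q v ≤ ENNReal.ofReal C * NNorm ρ μ Ω s p q u) ∧
    (Q / (Q + s) < p → ENNReal.ofReal (Q / (Q + s)) < q →
      ∃ E : (X → ℝ) → (X → ℝ), ∃ C : ℝ, 0 < C ∧
        (∀ u : X → ℝ, MemNspq ρ μ Ω s p q u →
          MemNspq ρ μ Set.univ s p q (E u) ∧
          (∀ᵐ x ∂μ.restrict Ω, E u x = u x) ∧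
          NNorm ρ μ Set.univ s p q (E u) ≤ ENNReal.ofReal C * NNorm ρ μ Ω s p q u) ∧
        (∀ u v : X → ℝ, MemNspq ρ μ Ω s p q u → MemNspq ρ μ Ω s p q v →
          E (fun x => u x + v x) = fun x => E u x + E v x) ∧
        (∀ (a : ℝ) (u : X → ℝ), MemNspq ρ μ Ω s p q u →
          E (fun x => a * u x) = fun x => a * E u x)) := by
  obtain ⟨α, c, hsα, hc, m, hm⟩ := SLtIndex.exists_pseudoMetric hs hind
  let _ := m
  have hρ : DistComparable ρ α c :=
    ⟨hX.quasi.1, hs.trans hsα, hc, fun x y => (hm x y).1, fun x y => (hm x y).2⟩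
  have h0 : ∀ x y, ρ x y = 0 → x = y := fun x y => (hX.quasi.2.1 x y).1
  have := hρ.opensMeasurableSpace hX hdoub
  obtain ⟨N, M, S⟩ := hρ.exists_netSystem hX hdoub hdens hρ.inv_mul_le_one.1 hρ.inv_mul_le_one.2
  refine ⟨?_, fun hpQ _ => ?_⟩
  · obtain ⟨K, hK, H⟩ := hρ.exists_extension h0 hs hsα hp hq hΩmeas S
    obtain ⟨C, hC, hKC⟩ := exists_real_constant hK
    refine ⟨C, hC, fun u hu => ?_⟩
    obtain ⟨v, h1, h2, h3⟩ := H u hu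
    exact ⟨v, h1, h2, h3.trans (mul_le_mul_left hKC _)⟩
  · have hΛ : 1 ≤ ENNReal.ofReal (2 ^ Q) :=
      ENNReal.one_le_ofReal.2 (Real.one_le_rpow one_le_two hQ.le)
    obtain ⟨K, hK, H⟩ := hρ.exists_meanExtension_bound h0 hs hsα hp hq hΩmeas S hΛ
      ENNReal.ofReal_ne_top fun _ => two_rpow_rpow_mul_lt_one hQ hs hpQ
    obtain ⟨C, hC, hKC⟩ := exists_real_constant hK
    refine ⟨S.meanExtension, C, hC, fun u hu => ?_,
      fun u v hu hv => S.meanExtension_add (H u hu).1 (H v hv).1,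
      fun a u _ => S.meanExtension_mul a u⟩
    obtain ⟨-, h1, h2, h3⟩ := H u hu
    exact ⟨h1, h2, h3.trans (mul_le_mul_left hKC _)⟩

end HajlaszPaper
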